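/- Let h be a Brouwer homeomorphism of the plane and let O₁, O₂ be two distinct orbits of h. Let Φ and Φ′ be admissible straightenings for (h, O₁, O₂), let γ, γ′ : [0,1] → ℝ² be continuous curves with γ(0), γ′(0) ∈ ℤ₁ and γ(1), γ′(1) ∈ ℤ₂, let θ be an angle function for Φ∘h∘Φ⁻¹ along γ, and let θ′ be an angle function for Φ′∘h∘Φ′⁻¹ along γ′. Then θ(1) − θ(0) = θ′(1) − θ′(0). In other words, the Poincaré index I(h, O₁, O₂) := (θ(1) − θ(0))/(2π) depends neither on the choice of the curve nor on the choice of the admissible straightening. -/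

import Mathlib

open Set

/-- The plane. -/
abbrev Plane : Type := ℝ × ℝ

/-- `f` is (the underlying function of) a homeomorphism of the plane. -/
def IsHomeoFun (f : Plane → Plane) : Prop :=
  ∃ e : Plane ≃ₜ Plane, ∀ x, e x = f x

/-- `g` and `g'` are isotopic relative to `O` : there is a continuous family
`F (t, ·)`, `t ∈ [0,1]`, of homeomorphisms of the plane going from `g` to `g'`
and agreeing with `g` on `O` for all times. -/
def IsotopicRel (g g' : Plane → Plane) (O : Set Plane) : Prop :=
  ∃ F : ℝ × Plane → Plane, Continuous F ∧
    (∀ t ∈ Icc (0:ℝ) 1, IsHomeoFun fun x => F (t, x)) ∧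
    (∀ x, F (0, x) = g x) ∧
    (∀ x, F (1, x) = g' x) ∧
    (∀ t ∈ Icc (0:ℝ) 1, ∀ x ∈ O, F (t, x) = g x)

/-- A homeomorphism of the plane is orientation preserving iff it is isotopic
to the identity. -/
def OrientationPreserving (h : Plane ≃ₜ Plane) : Prop :=
  IsotopicRel id (⇑h) (∅ : Set Plane)

/-- A Brouwer homeomorphism: orientation preserving and fixed point free. -/
def IsBrouwer (h : Plane ≃ₜ Plane) : Prop :=
  OrientationPreserving h ∧ ∀ x, h x ≠ x

/-- The orbit of a point under a homeomorphism. -/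
def horbit (h : Plane ≃ₜ Plane) (x : Plane) : Set Plane :=
  {y | ∃ n : ℤ, y = (h.toEquiv ^ n) x}

/-- `ℤ₁ = ℤ × {1}`. -/
def Z1 : Set Plane := {p | ∃ n : ℤ, p = ((n : ℝ), 1)}

/-- `ℤ₂ = ℤ × {2}`. -/
def Z2 : Set Plane := {p | ∃ n : ℤ, p = ((n : ℝ), 2)}

/-- The shear homeomorphism `(x, y) ↦ (x + f y, y)`. -/
def shear (f : ℝ → ℝ) (hf : Continuous f) : Plane ≃ₜ Plane where
  toFun p := (p.1 + f p.2, p.2)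
  invFun p := (p.1 - f p.2, p.2)
  left_inv p := by simp
  right_inv p := by simp
  continuous_toFun := (continuous_fst.add (hf.comp continuous_snd)).prodMk continuous_snd
  continuous_invFun := (continuous_fst.sub (hf.comp continuous_snd)).prodMk continuous_snd

/-- The translation `T (x, y) = (x + 1, y)`. -/
def T : Plane ≃ₜ Plane := shear (fun _ => 1) continuous_const

/-- The twist `T₁ (x, y) = (x + 2 - y, y)`. -/
def T₁ : Plane ≃ₜ Plane := shear (fun y => 2 - y) (by continuity)

/-- The twist `T₂ (x, y) = (x + y - 1, y)`. -/
def T₂ : Plane ≃ₜ Plane := shear (fun y => y - 1) (by continuity)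

/-- The model Reeb homeomorphism `R₀ = T₁ ∘ T₂⁻¹`, `R₀ (x, y) = (x + 3 - 2y, y)`. -/
def R₀ : Plane ≃ₜ Plane := shear (fun y => 3 - 2 * y) (by continuity)

/-- The Euclidean norm on the plane. -/
noncomputable def planeNorm (p : Plane) : ℝ := Real.sqrt (p.1 ^ 2 + p.2 ^ 2)

/-- An angle function for a fixed point free map `h'` along a curve `γ`. -/
def IsAngleFunction (h' : Plane → Plane) (γ : ℝ → Plane) (θ : ℝ → ℝ) : Prop :=
  ContinuousOn θ (Icc 0 1) ∧
    ∀ t ∈ Icc (0:ℝ) 1,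
      h' (γ t) - γ t =
        planeNorm (h' (γ t) - γ t) • (Real.cos (θ t), Real.sin (θ t))

/-- The conjugate `Φ ∘ h ∘ Φ⁻¹`. -/
def conjH (Φ h : Plane ≃ₜ Plane) : Plane ≃ₜ Plane := Φ.symm.trans (h.trans Φ)

/-- An admissible straightening `Φ` for `(h, O₁, O₂)` : an orientation preserving
homeomorphism sending `O₁, O₂` to `ℤ₁, ℤ₂` such that `Φ ∘ h ∘ Φ⁻¹` is isotopic
relative to `ℤ₁ ∪ ℤ₂` to a homeomorphism translating each line `ℝ × {i}` by `±1`. -/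
def AdmissibleStraightening (h : Plane ≃ₜ Plane) (O₁ O₂ : Set Plane)
    (Φ : Plane ≃ₜ Plane) : Prop :=
  OrientationPreserving Φ ∧ Φ '' O₁ = Z1 ∧ Φ '' O₂ = Z2 ∧
    ∃ ε₁ ε₂ : ℝ, (ε₁ = 1 ∨ ε₁ = -1) ∧ (ε₂ = 1 ∨ ε₂ = -1) ∧
      ∃ g : Plane ≃ₜ Plane,
        (∀ x : ℝ, g (x, 1) = (x + ε₁, 1)) ∧
        (∀ x : ℝ, g (x, 2) = (x + ε₂, 2)) ∧
        IsotopicRel (⇑(conjH Φ h)) (⇑g) (Z1 ∪ Z2)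

/-- A flow on the plane. -/
def IsFlow (φ : ℝ → Plane → Plane) : Prop :=
  Continuous (fun p : ℝ × Plane => φ p.1 p.2) ∧
    (∀ x, φ 0 x = x) ∧ ∀ s t x, φ (s + t) x = φ s (φ t x)

/-- A topological line in the plane: the image of a proper injective continuous
map from `ℝ` to the plane. -/
def IsTopLine (L : Set Plane) : Prop :=
  ∃ f : ℝ → Plane, Continuous f ∧ Function.Injective f ∧ IsProperMap f ∧ range f = L

namespace BrouwerIndex

open Complex in
/-- `θ` is an argument of the complex number `z`. -/
def IsArg (θ : ℝ) (z : ℂ) : Prop := z = ‖z‖ * exp (θ * I)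

namespace IsArg

open Complex

lemma mul {a b : ℝ} {z w : ℂ} (ha : IsArg a z) (hb : IsArg b w) : IsArg (a + b) (z * w) := by
  unfold IsArg at *
  rw [norm_mul]
  push_cast
  rw [add_mul, exp_add]
  calc z * w = (‖z‖ * exp (a * I)) * (‖w‖ * exp (b * I)) := by rw [← ha, ← hb]
    _ = _ := by ring

lemma inv {a : ℝ} {z : ℂ} (ha : IsArg a z) : IsArg (-a) z⁻¹ := by
  unfold IsArg at *
  rw [norm_inv]
  push_cast
  rw [neg_mul, exp_neg]
  calc z⁻¹ = (‖z‖ * exp (a * I))⁻¹ := by rw [← ha]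
    _ = _ := by rw [mul_inv]

lemma div {a b : ℝ} {z w : ℂ} (ha : IsArg a z) (hb : IsArg b w) : IsArg (a - b) (z / w) := by
  rw [div_eq_mul_inv, sub_eq_add_neg]
  exact ha.mul hb.inv

lemma neg {a : ℝ} {z : ℂ} (ha : IsArg a z) : IsArg (a + Real.pi) (-z) := by
  unfold IsArg at *
  rw [norm_neg]
  push_cast
  rw [add_mul, exp_add, exp_pi_mul_I]
  linear_combination -ha

lemma of_nonneg {r : ℝ} (hr : 0 ≤ r) : IsArg 0 (r : ℂ) := by
  unfold IsArg
  simp [abs_of_nonneg hr]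

lemma one : IsArg 0 1 := by simpa using of_nonneg zero_le_one

lemma arg (z : ℂ) : IsArg (arg z) z := (norm_mul_exp_arg_mul_I z).symm

lemma add_int {a : ℝ} {z : ℂ} (ha : IsArg a z) (k : ℤ) : IsArg (a + 2 * Real.pi * k) z := by
  unfold IsArg at *
  have : ((a + 2 * Real.pi * k : ℝ) : ℂ) * I = a * I + k * (2 * Real.pi * I) := by
    push_cast; ring
  rw [this, exp_add, exp_int_mul_two_pi_mul_I, mul_one]
  exact ha

lemma exists_int {a b : ℝ} {z : ℂ} (hz : z ≠ 0) (ha : IsArg a z) (hb : IsArg b z) :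
    ∃ k : ℤ, b = a + 2 * Real.pi * k := by
  unfold IsArg at *
  have h : exp (b * I) = exp (a * I) := by
    have hn : (‖z‖ : ℂ) ≠ 0 := by simpa using hz
    exact mul_left_cancel₀ hn (hb.symm.trans ha)
  obtain ⟨n, hn⟩ := exp_eq_exp_iff_exists_int.1 h
  refine ⟨n, ?_⟩
  have : ((b : ℂ) * I) = ((a + 2 * Real.pi * n : ℝ) : ℂ) * I := by
    rw [hn]; push_cast; ring
  exact_mod_cast mul_right_cancel₀ I_ne_zero this

end IsArg

lemma eq_zero_of_two_pi_mul {a b : ℤ} (h : 2 * Real.pi * (a : ℝ) = 2 * Real.pi * b) : a = b := by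
  have := mul_left_cancel₀ (by positivity) h
  exact_mod_cast this

lemma IsPreconnected.eq_of_two_pi_mul {X : Type*} [TopologicalSpace X] {S : Set X}
    (hS : IsPreconnected S) {f : X → ℝ} (hf : ContinuousOn f S)
    (h : ∀ x ∈ S, ∃ k : ℤ, f x = 2 * Real.pi * k) {x y : X} (hx : x ∈ S) (hy : y ∈ S) :
    f x = f y := by
  have hπ : (2 * Real.pi) ≠ 0 := by positivity
  have h1 : ContinuousOn (fun x => f x / (2 * Real.pi)) S := hf.div_const _
  have h2 : ContinuousOn (fun x => (round (f x / (2 * Real.pi)) : ℤ)) S := by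
    intro x hx
    obtain ⟨k, hk⟩ := h x hx
    have hxk : f x / (2 * Real.pi) = k := by rw [hk]; field_simp
    have := (h1 x hx).eventually (Metric.ball_mem_nhds _ (one_half_pos (α := ℝ)))
    refine ContinuousWithinAt.congr_of_eventuallyEq (f := fun _ => k)
      continuousWithinAt_const ?_ (by simp [hxk])
    filter_upwards [this, self_mem_nhdsWithin] with y hy hyS
    obtain ⟨l, hl⟩ := h y hyS
    have hyl : f y / (2 * Real.pi) = l := by rw [hl]; field_simp
    simp only [hxk, hyl, Real.dist_eq] at hy
    have h3 : |((l - k : ℤ) : ℝ)| < 1 := by push_cast; linarith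
    have : |l - k| < 1 := by exact_mod_cast h3
    rw [hyl, round_intCast]
    have := Int.abs_lt_one_iff.1 this
    omega
  have := hS.constant h2 hx hy
  obtain ⟨k, hk⟩ := h x hx
  obtain ⟨l, hl⟩ := h y hy
  have hxk : f x / (2 * Real.pi) = k := by rw [hk]; field_simp
  have hyl : f y / (2 * Real.pi) = l := by rw [hl]; field_simp
  simp only [hxk, hyl, round_intCast] at this
  rw [hk, hl, this]

/-- Two continuous choices of arguments on a preconnected set differ by a constant. -/
lemma IsArg.exists_int_of_preconnected {X : Type*} [TopologicalSpace X] {S : Set X}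
    (hS : IsPreconnected S) {a b : X → ℝ} {v : X → ℂ} (ha : ContinuousOn a S)
    (hb : ContinuousOn b S) (hav : ∀ x ∈ S, IsArg (a x) (v x)) (hbv : ∀ x ∈ S, IsArg (b x) (v x))
    (hv : ∀ x ∈ S, v x ≠ 0) : ∃ k : ℤ, ∀ x ∈ S, b x = a x + 2 * Real.pi * k := by
  rcases S.eq_empty_or_nonempty with rfl | ⟨x₀, hx₀⟩
  · exact ⟨0, by simp⟩
  have key : ∀ x ∈ S, ∃ k : ℤ, b x - a x = 2 * Real.pi * k := fun x hx => by
    obtain ⟨k, hk⟩ := (hav x hx).exists_int (hv x hx) (hbv x hx)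
    exact ⟨k, by rw [hk]; ring⟩
  obtain ⟨k, hk⟩ := key x₀ hx₀
  refine ⟨k, fun x hx => ?_⟩
  have := IsPreconnected.eq_of_two_pi_mul hS (hb.sub ha) key hx hx₀
  simp only [Pi.sub_apply] at this
  linarith

lemma IsArg.exists_int_arg {X : Type*} [TopologicalSpace X] {S : Set X}
    (hS : IsPreconnected S) {a : X → ℝ} {v : X → ℂ} (ha : ContinuousOn a S)
    (hvc : ContinuousOn v S) (hav : ∀ x ∈ S, IsArg (a x) (v x))
    (hv : ∀ x ∈ S, v x ∈ Complex.slitPlane) :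
    ∃ k : ℤ, ∀ x ∈ S, a x = Complex.arg (v x) + 2 * Real.pi * k :=
  IsArg.exists_int_of_preconnected hS
    (fun x hx => (Complex.continuousAt_arg (hv x hx)).comp_continuousWithinAt (hvc x hx)) ha
    (fun _ _ => IsArg.arg _) hav (fun x hx => Complex.slitPlane_ne_zero (hv x hx))

/-- Lifting of arguments along a homotopy. -/
lemma exists_arg_homotopy {A : Type*} [TopologicalSpace A] {H : unitInterval × A → ℂ}
    (hH : Continuous H) (hne : ∀ p, H p ≠ 0) {θ₀ : A → ℝ} (hθ₀ : Continuous θ₀)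
    (h0 : ∀ a, IsArg (θ₀ a) (H (0, a))) :
    ∃ θ : unitInterval × A → ℝ, Continuous θ ∧ (∀ a, θ (0, a) = θ₀ a) ∧
      ∀ p, IsArg (θ p) (H p) := by
  let Hc : C(unitInterval × A, {z : ℂ // z ≠ 0}) :=
    ⟨fun p => ⟨H p, hne p⟩, by fun_prop⟩
  have hlog : Continuous fun a => Real.log ‖H (0, a)‖ := by
    refine Continuous.log (by fun_prop) fun a => by simpa using hne _
  let f : C(A, ℂ) := ⟨fun a => (Real.log ‖H (0, a)‖ : ℝ) + (θ₀ a : ℝ) * Complex.I,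
    by fun_prop⟩
  have H0 : ∀ a, Hc (0, a) = (fun z => (⟨Complex.exp z, z.exp_ne_zero⟩ : {z : ℂ // z ≠ 0})) (f a) :=
    by
    intro a
    apply Subtype.ext
    change H (0, a) = Complex.exp ((Real.log ‖H (0, a)‖ : ℝ) + (θ₀ a : ℝ) * Complex.I)
    rw [Complex.exp_add, ← Complex.ofReal_exp, Real.exp_log (by simpa using hne _)]
    exact h0 a
  let L := Complex.isCoveringMap_exp.liftHomotopy Hc f H0
  have hL1 := Complex.isCoveringMap_exp.liftHomotopy_lifts Hc f H0
  have hL0 := Complex.isCoveringMap_exp.liftHomotopy_zero Hc f H0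
  refine ⟨fun p => (L p).im, Complex.continuous_im.comp L.continuous, fun a => ?_, fun p => ?_⟩
  · simp [L, hL0, f]
  · have h1 : Complex.exp (L p) = H p := congrArg Subtype.val (congrFun hL1 p)
    unfold IsArg
    rw [← h1, Complex.norm_exp, Complex.ofReal_exp, ← Complex.exp_add, Complex.re_add_im]

/-- Existence of continuous arguments on a real topological vector space. -/
lemma exists_arg {V : Type*} [AddCommGroup V] [Module ℝ V] [TopologicalSpace V]
    [ContinuousSMul ℝ V] {v : V → ℂ} (hv : Continuous v) (hne : ∀ x, v x ≠ 0) :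
    ∃ θ : V → ℝ, Continuous θ ∧ ∀ x, IsArg (θ x) (v x) := by
  obtain ⟨θ, h1, -, h3⟩ := exists_arg_homotopy
    (H := fun p : unitInterval × V => v ((p.1 : ℝ) • p.2)) (by fun_prop) (fun _ => hne _)
    (θ₀ := fun _ => Complex.arg (v 0)) continuous_const (fun a => by simpa using IsArg.arg _)
  exact ⟨fun x => θ (1, x), by fun_prop, fun x => by simpa using h3 (1, x)⟩

/-- `τ` measures how much `f` turns vectors `y - x`, continuously off the diagonal. -/
structure IsTurn (f : ℂ → ℂ) (τ : ℂ → ℂ → ℝ) : Prop where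
  cont : ContinuousOn (fun p : ℂ × ℂ => τ p.1 p.2) {p | p.1 ≠ p.2}
  isArg : ∀ x y, x ≠ y → IsArg (τ x y) ((f y - f x) / (y - x))

lemma isPreconnected_offDiag : IsPreconnected {p : ℂ × ℂ | p.1 ≠ p.2} := by
  have h1 : IsPreconnected ((univ : Set ℂ) ×ˢ ({0}ᶜ : Set ℂ)) :=
    isPreconnected_univ.prod (isConnected_compl_singleton_of_one_lt_rank
      (by simp [Complex.rank_real_complex]) 0).isPreconnected
  have h2 := h1.image (fun p => (p.1, p.1 + p.2)) (by fun_prop)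
  convert h2 using 1
  ext ⟨x, y⟩
  simp only [mem_ofPred_eq, mem_image, mem_prod, mem_univ, true_and, mem_compl_iff,
    mem_singleton_iff, Prod.mk.injEq, Prod.exists]
  constructor
  · intro h
    exact ⟨x, y - x, sub_ne_zero.2 (Ne.symm h), rfl, by ring⟩
  · rintro ⟨a, b, hb, rfl, rfl⟩ h
    exact hb (by linear_combination -h)

namespace IsTurn

variable {f g : ℂ → ℂ} {τ σ : ℂ → ℂ → ℝ}

lemma id : IsTurn (fun x => x) (fun _ _ => 0) where
  cont := continuousOn_const
  isArg x y h := by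
    rw [div_self (sub_ne_zero.2 h.symm)]
    exact IsArg.one

lemma continuousOn_comp (h : IsTurn f τ) {X : Type*} [TopologicalSpace X] {S : Set X}
    {a b : X → ℂ} (ha : ContinuousOn a S) (hb : ContinuousOn b S) (hne : ∀ x ∈ S, a x ≠ b x) :
    ContinuousOn (fun x => τ (a x) (b x)) S :=
  h.cont.comp (ha.prodMk hb) (fun x hx => hne x hx)

lemma continuous_comp (h : IsTurn f τ) {X : Type*} [TopologicalSpace X]
    {a b : X → ℂ} (ha : Continuous a) (hb : Continuous b) (hne : ∀ x, a x ≠ b x) :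
    Continuous (fun x => τ (a x) (b x)) :=
  continuousOn_univ.1 (h.continuousOn_comp ha.continuousOn hb.continuousOn fun x _ => hne x)

lemma add_arg (h : IsTurn f τ) {x y : ℂ} (hxy : x ≠ y) {a : ℝ} (ha : IsArg a (y - x)) :
    IsArg (a + τ x y) (f y - f x) := by
  have := ha.mul (h.isArg x y hxy)
  rwa [mul_div_cancel₀ _ (sub_ne_zero.2 hxy.symm)] at this

lemma exists_int (hf : Function.Injective f) (h : IsTurn f τ) (h' : IsTurn f σ) :
    ∃ k : ℤ, ∀ x y, x ≠ y → σ x y = τ x y + 2 * Real.pi * k := by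
  obtain ⟨k, hk⟩ := IsArg.exists_int_of_preconnected isPreconnected_offDiag h.cont h'.cont
    (fun p hp => h.isArg _ _ hp) (fun p hp => h'.isArg _ _ hp)
    (fun p hp => div_ne_zero (sub_ne_zero.2 (hf.ne (Ne.symm hp))) (sub_ne_zero.2 (Ne.symm hp)))
  exact ⟨k, fun x y hxy => hk (x, y) hxy⟩

lemma symm (hf : Function.Injective f) (h : IsTurn f τ) {x y : ℂ} (hxy : x ≠ y) :
    τ x y = τ y x := by
  have h' : IsTurn f (fun x y => τ y x) :=
    ⟨h.cont.comp (by fun_prop : Continuous fun p : ℂ × ℂ => (p.2, p.1)).continuousOn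
      fun p hp => Ne.symm hp, fun x y hxy => by
        have := h.isArg y x hxy.symm
        rwa [← neg_sub (f y), ← neg_sub y, neg_div_neg_eq] at this⟩
  obtain ⟨k, hk⟩ := h.exists_int hf h'
  have h1 := hk x y hxy
  have h2 := hk y x hxy.symm
  linarith

lemma comp (hf : IsTurn f τ) (hg : IsTurn g σ) (hgi : Function.Injective g)
    (hgc : Continuous g) : IsTurn (fun x => f (g x)) (fun x y => σ x y + τ (g x) (g y)) where
  cont := hg.cont.add (hf.continuousOn_comp (by fun_prop) (by fun_prop) fun p hp => hgi.ne hp)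
  isArg x y hxy := by
    have := (hg.isArg x y hxy).mul (hf.isArg _ _ (hgi.ne hxy))
    rwa [mul_comm, div_mul_div_cancel₀ (sub_ne_zero.2 (hgi.ne hxy.symm))] at this

lemma inv (e : ℂ ≃ₜ ℂ) (h : IsTurn e τ) :
    IsTurn e.symm (fun x y => -τ (e.symm x) (e.symm y)) where
  cont := (h.continuousOn_comp (by fun_prop) (by fun_prop)
    fun p hp => e.symm.injective.ne hp).neg
  isArg x y hxy := by
    have := (h.isArg _ _ (e.symm.injective.ne hxy)).inv
    simpa using this

lemma add_int (h : IsTurn f τ) (k : ℤ) : IsTurn f (fun x y => τ x y + 2 * Real.pi * k) where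
  cont := h.cont.add continuousOn_const
  isArg x y hxy := (h.isArg x y hxy).add_int k

/-- Transport of a turn function along an isotopy, fixed on pairs of fixed points. -/
lemma transport (h : IsTurn f τ) (F : ℝ × ℂ → ℂ) (hF : Continuous F)
    (hinj : ∀ t ∈ Icc (0:ℝ) 1, Function.Injective fun x => F (t, x))
    (h0 : ∀ x, F (0, x) = f x) (h1 : ∀ x, F (1, x) = g x) :
    ∃ σ, IsTurn g σ ∧ ∀ x y, x ≠ y → (∀ t ∈ Icc (0:ℝ) 1, F (t, x) = f x) →
      (∀ t ∈ Icc (0:ℝ) 1, F (t, y) = f y) → σ x y = τ x y := by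
  obtain ⟨θ, c1, c2, c3⟩ := exists_arg_homotopy (A := {p : ℂ × ℂ // p.1 ≠ p.2})
    (H := fun q => (F (q.1, q.2.1.2) - F (q.1, q.2.1.1)) / (q.2.1.2 - q.2.1.1))
    (by
      refine Continuous.div (by fun_prop) (by fun_prop) fun q => sub_ne_zero.2 q.2.2.symm)
    (fun q => div_ne_zero (sub_ne_zero.2 ((hinj _ q.1.2).ne q.2.2.symm))
      (sub_ne_zero.2 q.2.2.symm))
    (θ₀ := fun q => τ q.1.1 q.1.2)
    (h.continuous_comp (by fun_prop) (by fun_prop) fun q => q.2)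
    (fun q => by simpa [h0] using h.isArg _ _ q.2)
  classical
  refine ⟨fun x y => if hxy : x ≠ y then θ (1, ⟨(x, y), hxy⟩) else 0, ⟨?_, ?_⟩, ?_⟩
  · rw [continuousOn_iff_continuous_domRestrict]
    have : Continuous fun q : {p : ℂ × ℂ // p.1 ≠ p.2} => θ (1, q) := by fun_prop
    refine this.congr fun q => ?_
    have := q.2
    simp only [domRestrict_apply]
    rw [dif_pos q.2]
  · intro x y hxy
    rw [dif_pos hxy]
    simpa [h1] using c3 (1, ⟨(x, y), hxy⟩)
  · intro x y hxy hx hy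
    simp only
    rw [dif_pos hxy, ← c2 ⟨(x, y), hxy⟩]
    obtain ⟨k, hk⟩ := IsArg.exists_int_of_preconnected (X := unitInterval) (S := univ)
      isPreconnected_univ (a := fun _ => θ (0, ⟨(x, y), hxy⟩))
      (b := fun t => θ (t, ⟨(x, y), hxy⟩)) (v := fun _ => (f y - f x) / (y - x))
      (by fun_prop) (by fun_prop)
      (fun t _ => by simpa [h0] using c3 (0, ⟨(x, y), hxy⟩))
      (fun t _ => by simpa [hx t t.2, hy t t.2] using c3 (t, ⟨(x, y), hxy⟩))
      (fun t _ => div_ne_zero (sub_ne_zero.2 (by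
        have := hinj 0 (by simp)
        have := this.ne hxy.symm
        simpa [h0] using this)) (sub_ne_zero.2 hxy.symm))
    have e0 := hk 0 (mem_univ _)
    have e1 := hk 1 (mem_univ _)
    linarith

end IsTurn

/-- An argument of the displacement of a fixed point free map, and its increments along orbits. -/
lemma exists_displacement_arg {h : ℂ → ℂ} (hc : Continuous h)
    (hfp : ∀ x, h x ≠ x) : ∃ A : ℂ → ℝ, Continuous A ∧ ∀ x, IsArg (A x) (h x - x) :=
  exists_arg (by fun_prop) fun x => sub_ne_zero.2 (hfp x)

lemma IsTurn.displacement {h : ℂ → ℂ} {τ : ℂ → ℂ → ℝ} {A : ℂ → ℝ} (hτ : IsTurn h τ)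
    (hc : Continuous h) (hfp : ∀ x, h x ≠ x) (hA : Continuous A)
    (hAa : ∀ x, IsArg (A x) (h x - x)) :
    ∃ c : ℤ, ∀ x, A (h x) = A x + τ x (h x) + 2 * Real.pi * c := by
  obtain ⟨c, hc⟩ := IsArg.exists_int_of_preconnected (X := ℂ) (S := univ) isPreconnected_univ
    (a := fun x => A x + τ x (h x)) (b := fun x => A (h x)) (v := fun x => h (h x) - h x)
    (hA.add (hτ.continuous_comp continuous_id hc fun x => (hfp x).symm)).continuousOn
    (hA.comp hc).continuousOn
    (fun x _ => hτ.add_arg (hfp x).symm (hAa x)) (fun x _ => hAa _)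
    (fun x _ => sub_ne_zero.2 (hfp _))
  exact ⟨c, fun x => hc x (mem_univ x)⟩

lemma IsTurn.no_period_two {h : ℂ → ℂ} {τ : ℂ → ℂ → ℝ} (hτ : IsTurn h τ)
    (hi : Function.Injective h) (hc : Continuous h) (hfp : ∀ x, h x ≠ x) (x : ℂ) :
    h (h x) ≠ x := by
  intro hx
  obtain ⟨A, hA, hAa⟩ := exists_displacement_arg hc hfp
  obtain ⟨c, hc⟩ := hτ.displacement hc hfp hA hAa
  have h1 := hc x
  have h2 := hc (h x)
  rw [hx, hτ.symm hi (hfp x)] at h2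
  have h3 := hτ.isArg x (h x) (hfp x).symm
  rw [hx, ← neg_sub, neg_div_self (sub_ne_zero.2 (hfp x))] at h3
  obtain ⟨k, hk⟩ := (IsArg.one.neg).exists_int (by norm_num) h3
  have : (2 * Real.pi) * ((2 * (c + k) + 1 : ℤ) : ℝ) = 2 * Real.pi * ((0 : ℤ) : ℝ) := by
    push_cast
    linarith
  have := eq_zero_of_two_pi_mul this
  omega

end BrouwerIndex

namespace BrouwerIndex

/-- Orientation preserving homeomorphisms of `ℂ`, in the sense that vectors turn continuously. -/
def IsOP (h : ℂ ≃ₜ ℂ) : Prop := ∃ τ, IsTurn h τ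

lemma IsOP.mul {f g : ℂ ≃ₜ ℂ} (hf : IsOP f) (hg : IsOP g) : IsOP (f * g) := by
  obtain ⟨τ, hτ⟩ := hf
  obtain ⟨σ, hσ⟩ := hg
  exact ⟨_, hτ.comp hσ g.injective g.continuous⟩

lemma IsOP.inv {f : ℂ ≃ₜ ℂ} (hf : IsOP f) : IsOP f⁻¹ := by
  obtain ⟨τ, hτ⟩ := hf
  exact ⟨_, hτ.inv f⟩

/-- Pushing a point inside a small ball. -/
lemma exists_push {a b : ℂ} {r : ℝ} (hr : 0 < r) (hab : ‖b - a‖ < r / 2) :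
    ∃ g : ℂ ≃ₜ ℂ, IsOP g ∧ (∀ x ∉ Metric.ball a r, g x = x) ∧ g a = b := by
  let φ : ℂ → ℂ := fun z => (max 0 (1 - ‖z - a‖ / r) : ℝ) * (b - a)
  have hφ : ∀ x y, ‖φ x - φ y‖ ≤ (1 / 2 : NNReal) * ‖x - y‖ := by
    intro x y
    have h1 : |max 0 (1 - ‖x - a‖ / r) - max 0 (1 - ‖y - a‖ / r)| ≤ ‖x - y‖ / r := by
      refine (abs_max_sub_max_le_max _ _ _ _).trans ?_
      rw [sub_self, abs_zero, max_eq_right (abs_nonneg _)]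
      have : (1 - ‖x - a‖ / r) - (1 - ‖y - a‖ / r) = (‖y - a‖ - ‖x - a‖) / r := by ring
      rw [this, abs_div, abs_of_pos hr]
      gcongr
      refine (abs_norm_sub_norm_le _ _).trans ?_
      rw [sub_sub_sub_cancel_right, norm_sub_rev]
    have h2 : φ x - φ y = ((max 0 (1 - ‖x - a‖ / r) - max 0 (1 - ‖y - a‖ / r) : ℝ) : ℂ) * (b - a) :=
      by
      simp only [φ]; push_cast; ring
    rw [h2, norm_mul, Complex.norm_real, Real.norm_eq_abs]
    calc _ ≤ ‖x - y‖ / r * (r / 2) := by gcongr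
      _ = ((1 / 2 : NNReal) : ℝ) * ‖x - y‖ := by push_cast; field_simp
  have happ : ApproximatesLinearOn (fun z => z + φ z)
      ((ContinuousLinearEquiv.refl ℝ ℂ : ℂ ≃L[ℝ] ℂ) : ℂ →L[ℝ] ℂ) univ (1 / 2) := by
    intro x _ y _
    have : x + φ x - (y + φ y) - (x - y) = φ x - φ y := by ring
    simpa [this] using hφ x y
  have hlt : Subsingleton ℂ ∨ (1 / 2 : NNReal) <
      ‖((ContinuousLinearEquiv.refl ℝ ℂ).symm : ℂ →L[ℝ] ℂ)‖₊⁻¹ := by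
    right
    have : ‖((ContinuousLinearEquiv.refl ℝ ℂ).symm : ℂ →L[ℝ] ℂ)‖₊ = 1 := by
      apply NNReal.eq
      exact ContinuousLinearMap.norm_id
    rw [this, inv_one]
    exact NNReal.half_lt_self one_ne_zero
  let g : ℂ ≃ₜ ℂ := happ.toHomeomorph _ hlt
  have hg : ∀ z, g z = z + φ z := fun z => rfl
  have hre : ∀ x y, x ≠ y → 0 < ((g y - g x) / (y - x)).re := by
    intro x y hxy
    have hyx : y - x ≠ 0 := sub_ne_zero.2 hxy.symm
    have h1 : (g y - g x) / (y - x) = 1 + (φ y - φ x) / (y - x) := by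
      rw [hg, hg]; field_simp; ring
    have h2 : ‖(φ y - φ x) / (y - x)‖ ≤ 1 / 2 := by
      rw [norm_div, div_le_iff₀ (norm_pos_iff.2 hyx)]
      simpa using hφ y x
    have h3 := (abs_le.1 ((Complex.abs_re_le_norm _).trans h2)).1
    rw [h1, Complex.add_re, Complex.one_re]
    linarith
  refine ⟨g, ⟨fun x y => Complex.arg ((g y - g x) / (y - x)), ?_, fun x y _ => IsArg.arg _⟩, ?_, ?_⟩
  · intro p hp
    have hne : p.2 - p.1 ≠ 0 := sub_ne_zero.2 (Ne.symm hp)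
    have hc : ContinuousAt (fun p : ℂ × ℂ => (g p.2 - g p.1) / (p.2 - p.1)) p :=
      ContinuousAt.div (by fun_prop) (by fun_prop) hne
    exact ((Complex.continuousAt_arg (Or.inl (hre _ _ hp))).comp
      (f := fun p : ℂ × ℂ => (g p.2 - g p.1) / (p.2 - p.1)) hc).continuousWithinAt
  · intro x hx
    rw [Metric.mem_ball, not_lt, dist_eq_norm] at hx
    have : 1 - ‖x - a‖ / r ≤ 0 := by rw [sub_nonpos, le_div_iff₀ hr]; linarith
    simp [hg, φ, max_eq_left this]
  · simp [hg, φ]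

/-- Connected open sets are homogeneous under compactly supported homeomorphisms. -/
lemma exists_supported_map {U : Set ℂ} (hU : IsOpen U) (hUc : IsPreconnected U) {a b : ℂ}
    (ha : a ∈ U) (hb : b ∈ U) :
    ∃ g : ℂ ≃ₜ ℂ, IsOP g ∧ (∀ x ∉ U, g x = x) ∧ g a = b := by
  refine hUc.induction₂ (fun a b => ∃ g : ℂ ≃ₜ ℂ, IsOP g ∧ (∀ x ∉ U, g x = x) ∧ g a = b)
    ?_ ?_ ?_ ha hb
  · intro x hx
    obtain ⟨r, hr, hrU⟩ := Metric.isOpen_iff.1 hU x hx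
    refine Filter.Eventually.filter_mono nhdsWithin_le_nhds ?_
    filter_upwards [Metric.ball_mem_nhds x (half_pos hr)] with y hy
    rw [Metric.mem_ball, dist_eq_norm] at hy
    obtain ⟨g, h1, h2, h3⟩ := exists_push hr hy
    exact ⟨g, h1, fun z hz => h2 z fun h => hz (hrU h), h3⟩
  · rintro x y z - - - ⟨g, h1, h2, h3⟩ ⟨g', h1', h2', h3'⟩
    exact ⟨g' * g, h1'.mul h1, fun w hw => by rw [Homeomorph.mul_apply, h2 w hw, h2' w hw],
      by rw [Homeomorph.mul_apply, h3, h3']⟩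
  · rintro x y - - ⟨g, h1, h2, h3⟩
    exact ⟨g⁻¹, h1.inv, fun w hw => g.symm_apply_eq.2 (h2 w hw).symm,
      g.symm_apply_eq.2 h3.symm⟩

lemma pow_succ_apply (h : ℂ ≃ₜ ℂ) (n : ℕ) (x : ℂ) : (h ^ (n + 1)) x = h ((h ^ n) x) := by
  rw [pow_succ']; rfl

/-- Fixed point free orientation preserving homeomorphisms. -/
structure IsBrouwerC (h : ℂ ≃ₜ ℂ) : Prop where
  op : IsOP h
  fpf : ∀ x, h x ≠ x

/-- A set is free if it is disjoint from its image. -/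
def Free (h : ℂ ≃ₜ ℂ) (U : Set ℂ) : Prop := ∀ x ∈ U, h x ∉ U

/-- Perturbing a Brouwer homeomorphism inside a free set. -/
lemma IsBrouwerC.perturb {h g : ℂ ≃ₜ ℂ} (hh : IsBrouwerC h) (hg : IsOP g) {U : Set ℂ}
    (hU : Free h U) (hgU : ∀ x ∉ U, g x = x) : IsBrouwerC (g * h) := by
  refine ⟨hg.mul hh.op, fun x hx => ?_⟩
  rw [Homeomorph.mul_apply] at hx
  by_cases hxU : h x ∈ U
  · have h1 : x ∉ U := fun h' => hU x h' hxU
    have h2 : g (h x) = h x := g.injective (by rw [hx, hgU x h1])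
    exact hh.fpf x (h2.symm.trans hx)
  · exact hh.fpf x ((hgU _ hxU).symm.trans hx)

lemma perturb_pow {h g : ℂ ≃ₜ ℂ} {U : Set ℂ} (hgU : ∀ x ∉ U, g x = x) {z : ℂ} {n : ℕ}
    (hz : ∀ k, 1 ≤ k → k ≤ n → (h ^ k) z ∉ U) : ((g * h) ^ n) z = (h ^ n) z := by
  induction n with
  | zero => simp
  | succ n ih =>
    rw [pow_succ_apply, ih fun k h1 h2 => hz k h1 (by omega), Homeomorph.mul_apply,
      ← pow_succ_apply, hgU _ (hz (n + 1) (by omega) le_rfl)]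

/-- No point of period dividing `n`. -/
def NoPeriod (n : ℕ) : Prop := ∀ h : ℂ ≃ₜ ℂ, IsBrouwerC h → ∀ x, (h ^ n) x ≠ x

/-- Free connected open sets do not return at time `n`. -/
def NoReturn (n : ℕ) : Prop := ∀ h : ℂ ≃ₜ ℂ, IsBrouwerC h → ∀ U, IsOpen U → IsPreconnected U →
  Free h U → ∀ x ∈ U, (h ^ n) x ∉ U

lemma noReturn_of_noPeriod {n : ℕ} (hn : 1 ≤ n) (hP : NoPeriod n)
    (hQ : ∀ k, 1 ≤ k → k < n → NoReturn k) : NoReturn n := by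
  intro h hh U hU hUc hUf z hz hnz
  obtain ⟨g, h1, h2, h3⟩ := exists_supported_map hU hUc hnz hz
  refine hP (g * h) (hh.perturb h1 hUf h2) z ?_
  obtain ⟨m, rfl⟩ : ∃ m, n = m + 1 := ⟨n - 1, by omega⟩
  rw [pow_succ_apply, perturb_pow h2 (fun k hk hkm => hQ k hk (by omega) h hh U hU hUc hUf z hz),
    Homeomorph.mul_apply, ← pow_succ_apply, h3]

end BrouwerIndex

namespace BrouwerIndex

lemma exists_equivariant_extension (h : ℂ ≃ₜ ℂ) {κ : ℝ → ℂ} (hκ : Continuous κ)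
    (h01 : h (κ 0) = κ 1) :
    ∃ β : ℝ → ℂ, Continuous β ∧ (∀ s ∈ Icc (0:ℝ) 1, β s = κ s) ∧ ∀ s, β (s + 1) = h (β s) := by
  let β : ℝ → ℂ := fun s => (h ^ ⌊s⌋) (κ (s - ⌊s⌋))
  have hβ : ∀ n : ℤ, ∀ s ∈ Icc (n : ℝ) (n + 1), β s = (h ^ n) (κ (s - n)) := by
    intro n s hs
    rcases hs.2.lt_or_eq with h1 | h1
    · have : ⌊s⌋ = n := Int.floor_eq_iff.2 ⟨hs.1, h1⟩
      simp only [β, this]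
    · have : ⌊s⌋ = n + 1 := by rw [h1]; simp
      simp only [β, this]
      rw [h1]
      push_cast
      rw [sub_self, add_sub_cancel_left, ← h01, zpow_add, zpow_one]
      rfl
  have hcont : ∀ n : ℤ, ContinuousOn β (Icc (n : ℝ) (n + 1)) := fun n =>
    ContinuousOn.congr (by fun_prop) (hβ n)
  refine ⟨β, continuous_iff_continuousAt.2 fun s => ?_, fun s hs => ?_, fun s => ?_⟩
  · have h1 := hcont (⌊s⌋ - 1)
    have h2 := hcont ⌊s⌋
    push_cast at h1
    rw [sub_add_cancel] at h1
    have h3 := h1.union_of_isClosed h2 isClosed_Icc isClosed_Icc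
    rw [Icc_union_Icc_eq_Icc (by linarith) (by linarith)] at h3
    exact h3.continuousAt (Icc_mem_nhds (by linarith [Int.floor_le s]) (Int.lt_floor_add_one s))
  · simpa using hβ 0 s (by simpa using hs)
  · simp only [β, Int.floor_add_one]
    rw [add_comm ⌊s⌋, zpow_add, zpow_one, Homeomorph.mul_apply]
    congr 3
    push_cast
    ring

lemma Free.disjoint_closure {h : ℂ ≃ₜ ℂ} {U : Set ℂ} (hU : IsOpen U) (hf : Free h U) :
    (∀ x ∈ closure U, h x ∉ U) ∧ ∀ x ∈ U, h x ∉ closure U := by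
  have hd : Disjoint U (h ⁻¹' U) := by
    rw [disjoint_left]; exact hf
  have hd' : Disjoint (h ⁻¹' U) U := hd.symm
  constructor
  · exact disjoint_left.1 (hd.closure_left (hU.preimage h.continuous))
  · have := hd'.closure_left hU
    rw [← h.preimage_closure] at this
    exact fun x hx hx' => disjoint_left.1 this hx' hx

lemma Free.pow {h : ℂ ≃ₜ ℂ} (hh : IsBrouwerC h) {n : ℕ} (hn : NoReturn n) {U : Set ℂ}
    (hU : IsOpen U) (hUc : IsPreconnected U) (hf : Free h U) : Free (h ^ n) U :=
  hn h hh U hU hUc hf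

/-- A maximal free disc around a point and the associated equivariant path. -/
lemma IsBrouwerC.exists_path {h : ℂ ≃ₜ ℂ} (hh : IsBrouwerC h) (p : ℂ) :
    ∃ (r : ℝ) (β : ℝ → ℂ), 0 < r ∧ Continuous β ∧ β 0 = p ∧ (∀ s, β (s + 1) = h (β s)) ∧
      Free h (Metric.ball p r) ∧ (∀ s ∈ Ioo (-(1 / 2) : ℝ) (1 / 2), β s ∈ Metric.ball p r) ∧
      β (-(1 / 2)) ∈ closure (Metric.ball p r) ∧
      ∀ s ∈ Ico (-(1 / 2) : ℝ) 0, ∀ t ∈ Icc (0:ℝ) (1 / 2), β s ≠ β t := by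
  obtain ⟨q', hq'⟩ : ∃ q', ∀ z, max (dist q' p) (dist (h q') p) ≤ max (dist z p) (dist (h z) p) :=
    by
    refine Continuous.exists_forall_le (f := fun z => max (dist z p) (dist (h z) p))
      (by fun_prop) ?_
    exact Filter.tendsto_atTop_mono (fun z => le_max_left _ _) (tendsto_dist_right_cocompact_atTop p)
  set q := h q' with hq
  set r := max (dist q' p) (dist q p) with hr
  have hqq' : q ≠ q' := hh.fpf q'
  have hr0 : 0 < r := by
    by_contra! hcon
    have h1 := le_trans (le_max_left _ _) hcon
    have h2 := le_trans (le_max_right _ _) hcon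
    exact hqq' ((dist_le_zero.1 h2).trans (dist_le_zero.1 h1).symm)
  have hfree : Free h (Metric.ball p r) := fun z h1 h2 =>
    (hq' z).not_gt (max_lt h1 h2)
  have hcl := hfree.disjoint_closure Metric.isOpen_ball
  rw [closure_ball p hr0.ne'] at hcl
  have hq1 : dist q' p ≤ r := le_max_left _ _
  have hq2 : dist q p ≤ r := le_max_right _ _
  have e1 : dist q' p = r := by
    refine hq1.antisymm (not_lt.1 fun hlt => hcl.2 q' hlt hq2)
  have e2 : dist q p = r := by
    refine hq2.antisymm (not_lt.1 fun hlt => hcl.1 q' hq1 hlt)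
  rw [dist_eq_norm] at e1 e2
  let κ : ℝ → ℂ := fun u => p + ((max 0 (2 * u) : ℝ) : ℂ) * (q - p) + ((max 0 (-(2 * u)) : ℝ) :
      ℂ) * (q' - p)
  have κneg : ∀ u ≤ 0, κ u = p + ((-(2 * u) : ℝ) : ℂ) * (q' - p) := by
    intro u hu
    simp only [κ]
    rw [max_eq_left (by linarith), max_eq_right (by linarith)]
    simp
  have κpos : ∀ u, 0 ≤ u → κ u = p + ((2 * u : ℝ) : ℂ) * (q - p) := by
    intro u hu
    simp only [κ]
    rw [max_eq_right (by linarith), max_eq_left (by linarith)]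
    simp
  have κc : Continuous κ := by
    simp only [κ]
    have h1 : Continuous fun u : ℝ => max 0 (2 * u) := by fun_prop
    have h2 : Continuous fun u : ℝ => max 0 (-(2 * u)) := by fun_prop
    fun_prop
  obtain ⟨α, hα, hα1, hα2⟩ := exists_equivariant_extension h (κ := fun s => κ (s - 1 / 2))
    (by fun_prop) (by
      rw [κneg _ (by norm_num), κpos _ (by norm_num)]
      norm_num [hq])
  have hβ : ∀ s ∈ Icc (-(1 / 2) : ℝ) (1 / 2), α (s + 1 / 2) = κ s := by
    intro s hs
    rw [hα1 _ ⟨by linarith [hs.1], by linarith [hs.2]⟩]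
    congr 1; ring
  refine ⟨r, fun s => α (s + 1 / 2), hr0, by fun_prop, ?_, fun s => ?_, hfree, fun s hs => ?_, ?_,
    ?_⟩
  · simp only
    rw [hβ 0 (by norm_num), κpos 0 le_rfl]; simp
  · simp only
    rw [← hα2]; congr 1; ring
  · simp only
    rw [hβ s ⟨hs.1.le, hs.2.le⟩, Metric.mem_ball, dist_eq_norm]
    rcases le_total s 0 with h0 | h0
    · rw [κneg s h0, add_sub_cancel_left, norm_mul, e1, Complex.norm_real, Real.norm_eq_abs,
        abs_of_nonneg (by linarith)]
      nlinarith [hs.1]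
    · rw [κpos s h0, add_sub_cancel_left, norm_mul, e2, Complex.norm_real, Real.norm_eq_abs,
        abs_of_nonneg (by linarith)]
      nlinarith [hs.2]
  · simp only
    rw [hβ _ (by norm_num), κneg _ (by norm_num), closure_ball p hr0.ne', Metric.mem_closedBall,
      dist_eq_norm, add_sub_cancel_left, norm_mul, e1, Complex.norm_real]
    norm_num
  · intro s hs t ht
    simp only
    rw [hβ s ⟨hs.1, by linarith [hs.2]⟩, hβ t ⟨by linarith [ht.1], ht.2⟩, κneg s hs.2.le,
      κpos t ht.1]
    intro heq
    have heq := add_left_cancel heq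
    have hn := congrArg norm heq
    rw [norm_mul, norm_mul, e1, e2, Complex.norm_real, Complex.norm_real, Real.norm_eq_abs,
      Real.norm_eq_abs, abs_of_nonneg (by linarith [hs.2]),
        abs_of_nonneg (by linarith [ht.1])] at hn
    have hn := mul_right_cancel₀ hr0.ne' hn
    rw [hn] at heq
    have h2 := mul_left_cancel₀ (by
      rw [Complex.ofReal_ne_zero]; linarith [hs.2]) heq
    exact hqq' (sub_left_injective h2).symm

lemma equivariant_zpow {h : ℂ ≃ₜ ℂ} {β : ℝ → ℂ} (hβ : ∀ s, β (s + 1) = h (β s)) (n : ℤ) (s : ℝ) :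
    β (s + n) = (h ^ n) (β s) := by
  induction n using Int.induction_on with
  | zero => simp
  | succ i ih =>
    push_cast at ih ⊢
    rw [← add_assoc, hβ, ih, add_comm (i : ℤ), zpow_add, zpow_one]; rfl
  | pred i ih =>
    have h1 : β (s + (-(i : ℤ) : ℤ)) = h (β (s + ((-(i : ℤ) - 1 : ℤ) : ℝ))) := by
      rw [← hβ]; congr 1; push_cast; ring
    have h2 : (h ^ (-(i : ℤ))) (β s) = h ((h ^ (-(i : ℤ) - 1)) (β s)) := by
      rw [← Homeomorph.mul_apply, ← zpow_one_add]; congr 2; ring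
    rw [ih, h2] at h1
    exact (h.injective h1).symm

lemma equivariant_pow {h : ℂ ≃ₜ ℂ} {β : ℝ → ℂ} (hβ : ∀ s, β (s + 1) = h (β s)) (n : ℕ) (s : ℝ) :
    β (s + n) = (h ^ n) (β s) := by
  have := equivariant_zpow hβ n s
  simpa using this

/-- Points of an equivariant path in different translates of the disc are different. -/
lemma IsBrouwerC.path_ne {h : ℂ ≃ₜ ℂ} (hh : IsBrouwerC h) {p : ℂ} {r : ℝ} {β : ℝ → ℂ}
    (hβ : ∀ s, β (s + 1) = h (β s)) (hfree : Free h (Metric.ball p r))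
    (hin : ∀ s ∈ Ioo (-(1 / 2) : ℝ) (1 / 2), β s ∈ Metric.ball p r)
    (hcl : β (-(1 / 2)) ∈ closure (Metric.ball p r)) {n : ℕ} (hP : NoPeriod n) (hQ : NoReturn n)
    {s t : ℝ} (hst : ⌊t + 1 / 2⌋ = ⌊s + 1 / 2⌋ + n) : β s ≠ β t := by
  have hf := hfree.pow hh hQ Metric.isOpen_ball (convex_ball p r).isPreconnected
  have hf' := hf.disjoint_closure Metric.isOpen_ball
  have main : ∀ u ∈ Ico (-(1 / 2) : ℝ) (1 / 2), ∀ v ∈ Ico (-(1 / 2) : ℝ) (1 / 2),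
      β u ≠ (h ^ n) (β v) := by
    intro u hu v hv heq
    rcases hu.1.eq_or_lt with h1 | h1 <;> rcases hv.1.eq_or_lt with h2 | h2
    · rw [← h1, ← h2] at heq
      exact hP h hh _ heq.symm
    · rw [← h1] at heq
      exact hf'.2 _ (hin v ⟨h2, hv.2⟩) (heq ▸ hcl)
    · rw [← h2] at heq
      exact hf'.1 _ hcl (heq ▸ hin u ⟨h1, hu.2⟩)
    · exact hf _ (hin v ⟨h2, hv.2⟩) (heq ▸ hin u ⟨h1, hu.2⟩)
  set m := ⌊s + 1 / 2⌋ with hm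
  have hs := Int.floor_eq_iff.1 hm.symm
  have ht := Int.floor_eq_iff.1 hst
  push_cast at ht
  intro heq
  have e1 : β s = (h ^ m) (β (s - m)) := by
    rw [← equivariant_zpow hβ]; congr 1; ring
  have e2 : β t = (h ^ m) ((h ^ n) (β (t - n - m))) := by
    rw [← equivariant_pow hβ, ← equivariant_zpow hβ]; congr 1; ring
  rw [e1, e2] at heq
  exact main (s - m) ⟨by linarith, by linarith⟩ (t - n - m) ⟨by linarith, by linarith⟩
    ((h ^ m).injective heq)

end BrouwerIndex

namespace BrouwerIndex

lemma noPeriod_one : NoPeriod 1 := fun h hh x => by simpa using hh.fpf x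

lemma noPeriod_two : NoPeriod 2 := fun h hh x => by
  obtain ⟨τ, hτ⟩ := hh.op
  have := hτ.no_period_two h.injective h.continuous hh.fpf x
  rwa [pow_two, Homeomorph.mul_apply]

/-- A free compact connected set can be thickened to a free connected open set whose image
avoids a given closed set. -/
lemma exists_free_nhd {h : ℂ ≃ₜ ℂ} {K C : Set ℂ} (hK : IsCompact K) (hKc : IsPreconnected K)
    (hne : K.Nonempty) (hC : IsClosed C) (hf : ∀ x ∈ K, h x ∉ K) (hKC : ∀ x ∈ K, h x ∉ C) :
    ∃ U, IsOpen U ∧ IsPreconnected U ∧ K ⊆ U ∧ Free h U ∧ ∀ x ∈ U, h x ∉ C := by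
  obtain ⟨x₀, hx₀⟩ := hne
  have hd : Disjoint K (h '' K) := by
    rw [disjoint_left]
    rintro _ hx ⟨y, hy, rfl⟩
    exact hf y hy hx
  obtain ⟨A, B, hA, hB, hKA, hKB, hAB⟩ :=
    SeparatedNhds.of_isCompact_isCompact hK (hK.image h.continuous) hd
  set U₀ := A ∩ h ⁻¹' (B ∩ Cᶜ) with hU₀
  have hU₀o : IsOpen U₀ := hA.inter ((hB.inter hC.isOpen_compl).preimage h.continuous)
  have hKU₀ : K ⊆ U₀ := fun x hx => ⟨hKA hx, hKB (mem_image_of_mem h hx), hKC x hx⟩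
  have hsub : connectedComponentIn U₀ x₀ ⊆ U₀ := connectedComponentIn_subset _ _
  refine ⟨connectedComponentIn U₀ x₀, hU₀o.connectedComponentIn,
    isPreconnected_connectedComponentIn,
    hKc.subset_connectedComponentIn hx₀ hKU₀, fun x hx hx' => ?_, fun x hx => (hsub hx).2.2⟩
  exact disjoint_left.1 hAB (hsub hx').1 (hsub hx).2.1

lemma noPeriod_succ {n : ℕ} (hn : 2 ≤ n) (hP : ∀ k, 1 ≤ k → k ≤ n → NoPeriod k)
    (hQ : ∀ k, 1 ≤ k → k ≤ n → NoReturn k) : NoPeriod (n + 1) := by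
  intro h hh x hx
  obtain ⟨r, β, hr, hβc, hβ0, hβ1, hfree, hin, hcl, hinj⟩ := hh.exists_path x
  have hne : ∀ k, 1 ≤ k → k ≤ n → ∀ s t : ℝ, ⌊t + 1 / 2⌋ = ⌊s + 1 / 2⌋ + (k : ℕ) → β s ≠ β t :=
    fun k h1 h2 s t hst => hh.path_ne hβ1 hfree hin hcl (hP k h1 h2) (hQ k h1 h2) hst
  have hfl0 : ⌊(0:ℝ) + 1 / 2⌋ = 0 := by norm_num
  have hper : β (n + 1) = x := by
    have := equivariant_pow hβ1 (n + 1) 0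
    rw [hβ0, hx] at this
    simpa using this
  have hx1 : x ∉ β '' Icc 1 (n : ℝ) := by
    rintro ⟨t, ht, htx⟩
    have h1 : (1 : ℤ) ≤ ⌊t + 1 / 2⌋ := by rw [Int.le_floor]; push_cast; linarith [ht.1]
    have h2 : ⌊t + 1 / 2⌋ < (n : ℤ) + 1 := by
      rw [Int.floor_lt]; push_cast; linarith [ht.2]
    refine hne (⌊t + 1 / 2⌋).toNat (by omega) (by omega) 0 t ?_ (hβ0.trans htx.symm)
    rw [hfl0]; omega
  have hcomp : IsCompact (β '' Icc 1 (n : ℝ)) := isCompact_Icc.image hβc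
  obtain ⟨ρ, hρ, hρsub⟩ := Metric.nhds_basis_closedBall.mem_iff.1
    (hcomp.isClosed.isOpen_compl.mem_nhds hx1)
  set ρ' := min ρ r with hρ'
  have hρ'0 : 0 < ρ' := lt_min hρ hr
  have hVsub : Metric.ball x ρ' ⊆ Metric.ball x r := Metric.ball_subset_ball (min_le_right _ _)
  have hVρ : Metric.ball x ρ' ⊆ Metric.closedBall x ρ :=
    (Metric.ball_subset_ball (min_le_left _ _)).trans Metric.ball_subset_closedBall
  have hVfree : Free h (Metric.ball x ρ') := fun y hy hy' => hfree y (hVsub hy) (hVsub hy')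
  obtain ⟨δ, hδ, hδV⟩ : ∃ δ > 0, ∀ s : ℝ, |s - (n + 1)| < δ → β s ∈ Metric.ball x ρ' := by
    have := hβc.continuousAt.preimage_mem_nhds (x := (n + 1 : ℝ))
      (t := Metric.ball x ρ') (by rw [hper]; exact Metric.ball_mem_nhds x hρ'0)
    obtain ⟨δ, hδ, h1⟩ := Metric.mem_nhds_iff.1 this
    exact ⟨δ, hδ, fun s hs => h1 (by rwa [Metric.mem_ball, Real.dist_eq])⟩
  set ε := min (δ / 2) 1 with hε
  have hε0 : 0 < ε := lt_min (by positivity) one_pos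
  have hεδ : ε < δ := (min_le_left _ _).trans_lt (by linarith)
  have hε1 : ε ≤ 1 := min_le_right _ _
  have hn' : (2 : ℝ) ≤ n := by exact_mod_cast hn
  obtain ⟨U, hU, hUc, hKU, hUf, hUC⟩ := exists_free_nhd (h := h) (K := β '' Icc 0 (1 - ε))
    (C := Metric.closedBall x ρ) (isCompact_Icc.image hβc)
    (isPreconnected_Icc.image _ hβc.continuousOn)
    (⟨β 0, mem_image_of_mem β ⟨le_rfl, by linarith⟩⟩) Metric.isClosed_closedBall
    (by
      rintro _ ⟨t, ht, rfl⟩ ⟨s, hs, hst⟩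
      rw [← hβ1] at hst
      have a1 : 0 ≤ ⌊s + 1 / 2⌋ := by rw [Int.le_floor]; push_cast; linarith [hs.1]
      have a2 : ⌊s + 1 / 2⌋ < 2 := by rw [Int.floor_lt]; push_cast; linarith [hs.2]
      have b1 : 1 ≤ ⌊t + 1 + 1 / 2⌋ := by rw [Int.le_floor]; push_cast; linarith [ht.1]
      have b2 : ⌊t + 1 + 1 / 2⌋ < 3 := by rw [Int.floor_lt]; push_cast; linarith [ht.2]
      rcases lt_or_ge ⌊s + 1 / 2⌋ ⌊t + 1 + 1 / 2⌋ with hlt | hge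
      · refine hne (⌊t + 1 + 1 / 2⌋ - ⌊s + 1 / 2⌋).toNat (by omega) (by omega) s (t + 1) (by omega) hst
      · have c1 : ⌊s + 1 / 2⌋ = 1 := by omega
        have c2 : ⌊t + 1 + 1 / 2⌋ = 1 := by omega
        have c1 := (Int.floor_eq_iff.1 c1).1
        have c2 := (Int.floor_eq_iff.1 c2).2
        push_cast at c1 c2
        refine hinj (s - 1) ⟨by linarith, by linarith [hs.2]⟩ t ⟨ht.1, by linarith⟩ (h.injective ?_)
        rw [← hβ1, ← hβ1, ← hst, sub_add_cancel])
    (by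
      rintro _ ⟨t, ht, rfl⟩ hC
      rw [← hβ1] at hC
      exact hρsub hC (mem_image_of_mem β ⟨by linarith [ht.1], by linarith [ht.2]⟩))
  have hzU : β (1 - ε) ∈ U := hKU (mem_image_of_mem β ⟨by linarith, le_rfl⟩)
  have hxU : x ∈ U := hKU ⟨0, ⟨le_rfl, by linarith⟩, hβ0⟩
  have hzn : (h ^ n) (β (1 - ε)) ∈ Metric.ball x ρ' := by
    rw [← equivariant_pow hβ1]
    apply hδV
    have : (1 - ε + n - (n + 1) : ℝ) = -ε := by ring
    rw [this, abs_neg, abs_of_pos hε0]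
    exact hεδ
  obtain ⟨g, g1, g2, g3⟩ := exists_supported_map Metric.isOpen_ball
    (convex_ball x ρ').isPreconnected hzn (Metric.mem_ball_self hρ'0)
  obtain ⟨m, rfl⟩ : ∃ m, n = m + 1 := ⟨n - 1, by omega⟩
  refine hQ (m + 1) (by omega) le_rfl (g * h) (hh.perturb g1 hVfree g2) U hU hUc ?_ _ hzU ?_
  · intro y hy
    rw [Homeomorph.mul_apply, g2 _ fun h' => hUC y hy (hVρ h')]
    exact hUf y hy
  · rw [pow_succ_apply, perturb_pow g2, Homeomorph.mul_apply, ← pow_succ_apply, g3]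
    · exact hxU
    · intro k h1 h2 hk
      rw [← equivariant_pow hβ1] at hk
      have h1' : (1 : ℝ) ≤ k := by exact_mod_cast h1
      have h2' : (k : ℝ) ≤ m := by exact_mod_cast h2
      exact hρsub (hVρ hk) (mem_image_of_mem β ⟨by linarith, by push_cast; linarith⟩)

lemma noPeriod_and_noReturn (n : ℕ) (hn : 1 ≤ n) : NoPeriod n ∧ NoReturn n := by
  induction n using Nat.strong_induction_on with
  | _ n ih =>
    have hP : NoPeriod n := by
      rcases (by omega : n = 1 ∨ n = 2 ∨ 3 ≤ n) with rfl | rfl | h3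
      · exact noPeriod_one
      · exact noPeriod_two
      · obtain ⟨m, rfl⟩ : ∃ m, n = m + 1 := ⟨n - 1, by omega⟩
        exact noPeriod_succ (by omega) (fun k h1 h2 => (ih k (by omega) h1).1)
          fun k h1 h2 => (ih k (by omega) h1).2
    exact ⟨hP, noReturn_of_noPeriod hn hP fun k h1 h2 => (ih k h2 h1).2⟩

/-- Brouwer's lemma on translation arcs. -/
theorem IsBrouwerC.exists_translation_path {h : ℂ ≃ₜ ℂ} (hh : IsBrouwerC h) (p : ℂ) :
    ∃ β : ℝ → ℂ, Continuous β ∧ β 0 = p ∧ (∀ s, β (s + 1) = h (β s)) ∧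
      ∀ s t, s + 1 ≤ t → β s ≠ β t := by
  obtain ⟨r, β, hr, hβc, hβ0, hβ1, hfree, hin, hcl, -⟩ := hh.exists_path p
  refine ⟨β, hβc, hβ0, hβ1, fun s t hst => ?_⟩
  have h1 : ⌊s + 1 / 2⌋ + 1 ≤ ⌊t + 1 / 2⌋ := by
    rw [← Int.floor_add_one]
    exact Int.floor_le_floor (by linarith)
  obtain ⟨h2, h3⟩ := noPeriod_and_noReturn (⌊t + 1 / 2⌋ - ⌊s + 1 / 2⌋).toNat (by omega)
  exact hh.path_ne hβ1 hfree hin hcl h2 h3 (by omega)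

end BrouwerIndex

namespace BrouwerIndex

/-- The point of abscissa `x` on the line of height `l + 1`. -/
def pt (l : Fin 2) (x : ℝ) : ℂ := ⟨x, (l : ℕ) + 1⟩

lemma pt_sub (l : Fin 2) (x y : ℝ) : pt l x - pt l y = ((x - y : ℝ) : ℂ) := by
  apply Complex.ext <;> simp [pt]

lemma pt_re (l : Fin 2) (x : ℝ) : (pt l x).re = x := rfl

lemma pt_injective (l : Fin 2) : Function.Injective (pt l) := fun _ _ h => congrArg Complex.re h

lemma continuous_pt (l : Fin 2) : Continuous (pt l) := by
  have : pt l = fun x : ℝ => (x : ℂ) + (((l : ℕ) + 1 : ℝ) : ℂ) * Complex.I := by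
    ext x
    apply Complex.ext <;> simp [pt]
  rw [this]
  fun_prop

lemma pt_zero_ne_pt_one (x y : ℝ) : pt 0 x ≠ pt 1 y := by
  intro h
  have := congrArg Complex.im h
  norm_num [pt] at this

lemma pt_one_sub_pt_zero_im (x y : ℝ) : (pt 1 y - pt 0 x).im = 1 := by
  norm_num [pt]

/-- A Brouwer homeomorphism isotopic, relative to the integer points of the two lines, to a
homeomorphism translating both lines. -/
structure IsStraight (h : ℂ ≃ₜ ℂ) (ε : Fin 2 → ℤ) : Prop where
  brouwer : IsBrouwerC h
  eps : ∀ l, ε l = 1 ∨ ε l = -1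
  isotopy : ∃ (g : ℂ ≃ₜ ℂ) (F : ℝ × ℂ → ℂ), (∀ l x, g (pt l x) = pt l (x + ε l)) ∧
    Continuous F ∧ (∀ t ∈ Icc (0:ℝ) 1, Function.Injective fun x => F (t, x)) ∧
    (∀ x, F (0, x) = h x) ∧ (∀ x, F (1, x) = g x) ∧
    ∀ t ∈ Icc (0:ℝ) 1, ∀ l, ∀ n : ℤ, F (t, pt l n) = h (pt l n)

/-- Far away arguments: if two arguments of vectors with positive real parts agree in direction
at the endpoints, they are equal. -/
lemma IsArg.eq_of_path {a : ℝ → ℝ} {v : ℝ → ℂ} {s t : ℝ}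
    (ha : ContinuousOn a (uIcc s t)) (hvc : ContinuousOn v (uIcc s t))
    (hav : ∀ x ∈ uIcc s t, IsArg (a x) (v x)) (hv : ∀ x ∈ uIcc s t, 0 < (v x).re)
    (hs : (v s).im = 0) (ht : (v t).im = 0) : a s = a t := by
  obtain ⟨k, hk⟩ := IsArg.exists_int_arg isPreconnected_uIcc ha hvc hav
    (fun x hx => Or.inl (hv x hx))
  have h1 : ∀ x ∈ uIcc s t, (v x).im = 0 → a x = 2 * Real.pi * k := by
    intro x hx h0
    rw [hk x hx, Complex.arg_eq_zero_iff.2 ⟨(hv x hx).le, h0⟩, zero_add]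
  rw [h1 s left_mem_uIcc hs, h1 t right_mem_uIcc ht]

/-- A sequence indexed by pairs which is invariant up to a constant under translation and
eventually locally constant in each variable is invariant. -/
lemma eq_zero_of_far {f : ℤ → ℤ → ℝ} {D : ℝ}
    (hD : ∀ n m, n < m → f (n + 1) (m + 1) = f n m + D)
    (h1 : ∃ M : ℤ, ∀ m ≥ M, f 0 m = f 1 m) (h2 : ∃ M : ℤ, ∀ m ≥ M, f (-m) 0 = f (-m) 1) :
    D = 0 := by
  obtain ⟨M₁, h1⟩ := h1
  obtain ⟨M₂, h2⟩ := h2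
  have hpow : ∀ k : ℕ, ∀ n m, n < m → f (n + k) (m + k) = f n m + k * D := by
    intro k
    induction k with
    | zero => simp
    | succ k ih =>
      intro n m hnm
      push_cast
      rw [← add_assoc, ← add_assoc, hD _ _ (by omega), ih n m hnm]
      ring
  obtain ⟨k, hk⟩ : ∃ k : ℕ, M₁ ≤ k ∧ M₂ ≤ k ∧ (2 : ℤ) ≤ k :=
    ⟨(max (max M₁ M₂) 2).toNat, by omega, by omega, by omega⟩
  have e1 := h1 (k + 1) (by omega)
  have e2 := h2 k (by omega)
  have e3 := hpow k (-k) 0 (by omega)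
  have e4 := hpow k (-k) 1 (by omega)
  have e5 := hD 0 k (by omega)
  simp only [neg_add_cancel, zero_add] at e3 e4 e5
  rw [add_comm (1 : ℤ)] at e4
  linarith

section Line

variable {h : ℂ ≃ₜ ℂ} {τ : ℂ → ℂ → ℝ} {A : ℂ → ℝ}

/-- The winding of a Brouwer homeomorphism between the points of an orbit straightened on a line. -/
lemma IsBrouwerC.turn_add_eq_zero (hh : IsBrouwerC h) (hτ : IsTurn h τ) (hA : Continuous A)
    (hAa : ∀ x, IsArg (A x) (h x - x)) {c : ℤ}
    (hc : ∀ x, A (h x) = A x + τ x (h x) + 2 * Real.pi * c) {l : Fin 2} {ε : ℤ}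
    (hε : ε = 1 ∨ ε = -1) (hp : ∀ n : ℤ, h (pt l n) = pt l ((n + ε : ℤ) : ℝ)) {a : ℝ}
    (ha : ∀ n m : ℤ, n ≠ m → τ (pt l n) (pt l m) = a) : a + 2 * Real.pi * c = 0 := by
  obtain ⟨β, hβc, hβ0, hβ1, hβne⟩ := hh.exists_translation_path (pt l (0 : ℤ))
  have hεε : (ε : ℝ) * ε = 1 := by rcases hε with rfl | rfl <;> norm_num
  have hβn : ∀ n : ℤ, β n = pt l ((ε * n : ℤ) : ℝ) := by
    have step : ∀ (n : ℤ) (s : ℝ), β s = pt l ((ε * n : ℤ) : ℝ) → β (s + 1) = pt l ((ε * (n + 1) :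
      ℤ) : ℝ) := by
      intro n s hs
      rw [hβ1, hs, hp]; congr 2; ring
    intro n
    induction n using Int.induction_on with
    | zero => simpa using hβ0
    | succ i ih => push_cast at ih ⊢; simpa using step i i (by simpa using ih)
    | pred i ih =>
      apply h.injective
      rw [← hβ1, hp]
      have e1 : (((-(i : ℤ) - 1 : ℤ) : ℝ) + 1) = ((-(i : ℤ) : ℤ) : ℝ) := by push_cast; ring
      rw [e1, ih]; congr 2; ring
  obtain ⟨B, hBc, hB⟩ := exists_arg (V := ℝ × ℝ)
    (v := fun p => β (p.1 + 1 + |p.2|) - β p.1) (by fun_prop)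
    (fun p => sub_ne_zero.2 (hβne _ _ (by linarith [abs_nonneg p.2])).symm)
  let B' : ℝ → ℝ → ℝ := fun s t => B (s, t - s - 1)
  have hB' : ∀ s t, s + 1 ≤ t → IsArg (B' s t) (β t - β s) := by
    intro s t hst
    have := hB (s, t - s - 1)
    simp only at this
    rwa [abs_of_nonneg (by linarith), show s + 1 + (t - s - 1) = t by ring] at this
  have hB'c : Continuous fun p : ℝ × ℝ => B' p.1 p.2 := by
    simp only [B']; fun_prop
  have hconv : IsPreconnected {p : ℝ × ℝ | p.1 + 1 ≤ p.2} := by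
    apply Convex.isPreconnected
    intro p hp q hq a b ha hb hab
    simp only [mem_ofPred_eq, Prod.fst_add, Prod.snd_add, Prod.smul_fst, Prod.smul_snd,
      smul_eq_mul] at hp hq ⊢
    nlinarith
  obtain ⟨c₀, hc₀⟩ := IsArg.exists_int_of_preconnected hconv
    (a := fun p => B' p.1 p.2 + τ (β p.1) (β p.2)) (b := fun p => B' (p.1 + 1) (p.2 + 1))
    (v := fun p => β (p.2 + 1) - β (p.1 + 1))
    (hB'c.continuousOn.add (hτ.continuousOn_comp (by fun_prop) (by fun_prop)
      fun p hp => hβne _ _ hp)) (by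
        have : Continuous fun p : ℝ × ℝ => B' (p.1 + 1) (p.2 + 1) :=
          hB'c.comp (by fun_prop : Continuous fun p : ℝ × ℝ => (p.1 + 1, p.2 + 1))
        exact this.continuousOn)
    (fun p hp => by
      have := hτ.add_arg (hβne _ _ hp) (hB' _ _ hp)
      rwa [← hβ1, ← hβ1] at this)
    (fun p hp => hB' _ _ (by have : p.1 + 1 ≤ p.2 := hp; linarith))
    (fun p hp => sub_ne_zero.2 (hβne _ _ (by have : p.1 + 1 ≤ p.2 := hp; linarith)).symm)
  have hcc : c₀ = c := by
    obtain ⟨k, hk⟩ := IsArg.exists_int_of_preconnected (X := ℝ) (S := univ) isPreconnected_univ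
      (a := fun s => A (β s)) (b := fun s => B' s (s + 1)) (v := fun s => β (s + 1) - β s)
      (by fun_prop) (hB'c.comp (by fun_prop : Continuous fun s : ℝ => (s, s + 1))).continuousOn
      (fun s _ => by rw [hβ1]; exact hAa _) (fun s _ => hB' _ _ le_rfl)
      (fun s _ => sub_ne_zero.2 (hβne _ _ le_rfl).symm)
    have k0 := hk 0 (mem_univ _)
    have k1 := hk (0 + 1) (mem_univ _)
    have k2 := hc₀ (0, 0 + 1) (by simp)
    simp only at k0 k1 k2
    rw [k1, k0, hβ1 0, hc] at k2
    apply eq_zero_of_two_pi_mul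
    linarith
  subst hcc
  obtain ⟨R, hR⟩ := (isCompact_Icc (a := (0:ℝ)) (b := 1)).exists_bound_of_continuousOn
    hβc.continuousOn
  have hre : ∀ (m : ℤ) (s : ℝ), (ε * (β m - β s)).re = m - ε * (β s).re := by
    intro m s
    rw [hβn, mul_sub, Complex.sub_re]
    rw [show (ε : ℂ) = ((ε : ℝ) : ℂ) by push_cast; rfl, Complex.re_ofReal_mul,
      Complex.re_ofReal_mul, pt_re]
    push_cast
    rw [← mul_assoc, hεε, one_mul]
  have hbd : ∀ s ∈ Icc (0:ℝ) 1, |ε * (β s).re| ≤ R := by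
    intro s hs
    have : |(ε : ℝ)| = 1 := by rcases hε with rfl | rfl <;> norm_num
    rw [abs_mul, this, one_mul]
    exact (Complex.abs_re_le_norm _).trans (hR s hs)
  have hIccuIcc : uIcc (0:ℝ) 1 = Icc 0 1 := uIcc_of_le zero_le_one
  have him : ∀ (m n : ℤ), (ε * (β m - β n)).im = 0 := by
    intro m n
    rw [hβn, hβn, pt_sub, show (ε : ℂ) = ((ε : ℝ) : ℂ) by push_cast; rfl, ← Complex.ofReal_mul,
      Complex.ofReal_im]
  have hargε : ∃ b, IsArg b (ε : ℂ) := ⟨_, IsArg.arg _⟩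
  obtain ⟨b, hb⟩ := hargε
  refine eq_zero_of_far (f := fun n m => B' n m) ?_ ?_ ?_
  · intro n m hnm
    have h1 := hc₀ (n, m) (by
      have : n + 1 ≤ m := hnm
      simp only [mem_ofPred_eq]
      exact_mod_cast this)
    simp only at h1
    push_cast
    rw [h1, hβn, hβn, ha]
    · ring
    · intro h0
      rcases hε with rfl | rfl <;> omega
  · refine ⟨⌈R⌉ + 2, fun m hm => ?_⟩
    have hm' : R + 2 ≤ m := (by linarith [Int.le_ceil R] :
        R + 2 ≤ ⌈R⌉ + 2).trans (by exact_mod_cast hm)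
    have hR0 : 0 ≤ R := (norm_nonneg _).trans (hR 0 (by simp))
    have := IsArg.eq_of_path (a := fun s => b + B' s m) (v := fun s => ε * (β m - β s)) (s := 0)
      (t := 1) (continuousOn_const.add (hB'c.comp (by fun_prop : Continuous fun s : ℝ => (s,
          (m:ℝ)))).continuousOn)
      (by fun_prop) (fun s hs => hb.mul (hB' s m (by rw [hIccuIcc] at hs; linarith [hs.2])))
      (fun s hs => by
        rw [hIccuIcc] at hs
        rw [hre]
        have := (abs_le.1 (hbd s hs)).2
        linarith)
      (by simpa using him m 0) (by simpa using him m 1)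
    push_cast
    linarith
  · refine ⟨⌈R⌉ + 2, fun m hm => ?_⟩
    have hm' : R + 2 ≤ m := (by linarith [Int.le_ceil R] :
        R + 2 ≤ ⌈R⌉ + 2).trans (by exact_mod_cast hm)
    have hR0 : 0 ≤ R := (norm_nonneg _).trans (hR 0 (by simp))
    have := IsArg.eq_of_path (a := fun s => b + B' (-m) s) (v := fun s => ε * (β s - β (-m))) (s :=
        0)
      (t := 1) (continuousOn_const.add (hB'c.comp (by fun_prop : Continuous fun s : ℝ => ((-m : ℝ),
          s))).continuousOn)
      (by fun_prop) (fun s hs => hb.mul (hB' _ _ (by rw [hIccuIcc] at hs; linarith [hs.1])))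
      (fun s hs => by
        rw [hIccuIcc] at hs
        have h0 := hre (-m) s
        push_cast at h0
        rw [← neg_sub, mul_neg, Complex.neg_re, h0]
        have := (abs_le.1 (hbd s hs)).1
        linarith)
      (by simpa using him 0 (-m)) (by simpa using him 1 (-m))
    push_cast
    linarith

end Line

namespace IsStraight

variable {h : ℂ ≃ₜ ℂ} {τ : ℂ → ℂ → ℝ} {ε : Fin 2 → ℤ}

lemma apply_pt (hs : IsStraight h ε) (l : Fin 2) (n : ℤ) : h (pt l n) = pt l ((n + ε l : ℤ) : ℝ) :=
    by
  obtain ⟨g, F, hg, -, -, -, hF1, hF⟩ := hs.isotopy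
  rw [← hF 1 (by simp), hF1, hg]
  push_cast; rfl

lemma exists_turn_line (hs : IsStraight h ε) (hτ : IsTurn h τ) (l : Fin 2) :
    ∃ a : ℤ, ∀ n m : ℤ, n ≠ m → τ (pt l n) (pt l m) = 2 * Real.pi * a := by
  obtain ⟨g, F, hg, hFc, hFi, hF0, hF1, hF⟩ := hs.isotopy
  obtain ⟨σ, hσ, hστ⟩ := hτ.transport F hFc hFi hF0 hF1
  have hconv : IsPreconnected {p : ℝ × ℝ | p.1 < p.2} := by
    apply Convex.isPreconnected
    have : {p : ℝ × ℝ | p.1 < p.2} = {p : ℝ × ℝ | (p.1 - p.2) < 0} := by ext p; simp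
    rw [this]
    exact convex_halfSpace_lt (LinearMap.fst ℝ ℝ ℝ - LinearMap.snd ℝ ℝ ℝ).isLinear 0
  obtain ⟨k, hk⟩ := IsArg.exists_int_of_preconnected hconv (a := fun _ => 0)
    (b := fun p => σ (pt l p.1) (pt l p.2)) (v := fun _ => 1) continuousOn_const
    (hσ.continuousOn_comp ((continuous_pt l).comp continuous_fst).continuousOn
      ((continuous_pt l).comp continuous_snd).continuousOn
      fun p hp => (pt_injective l).ne (ne_of_lt hp)) (fun _ _ => IsArg.one)
    (fun p hp => by
      have hp : p.1 < p.2 := hp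
      have := hσ.isArg _ _ ((pt_injective l).ne hp.ne)
      rw [hg, hg, pt_sub, pt_sub, add_sub_add_right_eq_sub, div_self] at this
      · exact this
      · rw [Complex.ofReal_ne_zero, sub_ne_zero]; exact hp.ne')
    (fun _ _ => one_ne_zero)
  have key : ∀ n m : ℤ, n < m → τ (pt l n) (pt l m) = 2 * Real.pi * k := by
    intro n m hnm
    have hnm' : (n : ℝ) < m := by exact_mod_cast hnm
    have h1 := hk (n, m) hnm'
    have h2 := hστ (pt l n) (pt l m) ((pt_injective l).ne hnm'.ne)
      (fun t ht => hF t ht l n) (fun t ht => hF t ht l m)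
    simp only at h1
    rw [← h2, h1, zero_add]
  refine ⟨k, fun n m hnm => ?_⟩
  rcases lt_or_gt_of_ne hnm with h1 | h1
  · exact key n m h1
  · rw [hτ.symm h.injective, key m n h1]
    exact (pt_injective l).ne (by exact_mod_cast hnm)

lemma exists_turn_mixed (hs : IsStraight h ε) (hτ : IsTurn h τ) :
    ∃ a : ℤ, ∀ n m : ℤ, τ (pt 0 n) (pt 1 m) =
      Complex.arg (h (pt 1 m) - h (pt 0 n)) - Complex.arg (pt 1 m - pt 0 n) + 2 * Real.pi * a := by
  obtain ⟨g, F, hg, hFc, hFi, hF0, hF1, hF⟩ := hs.isotopy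
  obtain ⟨σ, hσ, hστ⟩ := hτ.transport F hFc hFi hF0 hF1
  have hcarg : ∀ u v : ℝ × ℝ → ℝ, Continuous u → Continuous v →
      Continuous fun p => Complex.arg (pt 1 (u p) - pt 0 (v p)) := by
    intro u v hu hv
    refine continuous_iff_continuousAt.2 fun p => ContinuousAt.comp (f :=
      fun p => pt 1 (u p) - pt 0 (v p))
      (Complex.continuousAt_arg (Or.inr ?_)) ?_
    · rw [pt_one_sub_pt_zero_im]; exact one_ne_zero
    · exact (((continuous_pt 1).comp hu).sub ((continuous_pt 0).comp hv)).continuousAt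
  obtain ⟨k, hk⟩ := IsArg.exists_int_of_preconnected (X := ℝ × ℝ) isPreconnected_univ
    (a := fun p => Complex.arg (g (pt 1 p.2) - g (pt 0 p.1)) - Complex.arg (pt 1 p.2 - pt 0 p.1))
    (b := fun p => σ (pt 0 p.1) (pt 1 p.2))
    (v := fun p => (g (pt 1 p.2) - g (pt 0 p.1)) / (pt 1 p.2 - pt 0 p.1))
    (by
      simp only [hg]
      exact ((hcarg _ _ (by fun_prop) (by fun_prop)).sub
        (hcarg _ _ (by fun_prop) (by fun_prop))).continuousOn)
    (hσ.continuousOn_comp ((continuous_pt 0).comp continuous_fst).continuousOn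
      ((continuous_pt 1).comp continuous_snd).continuousOn fun p _ => pt_zero_ne_pt_one _ _)
    (fun p _ => (IsArg.arg _).div (IsArg.arg _)) (fun p _ => hσ.isArg _ _ (pt_zero_ne_pt_one _ _))
    (fun p _ => div_ne_zero (sub_ne_zero.2 (g.injective.ne (pt_zero_ne_pt_one _ _).symm))
      (sub_ne_zero.2 (pt_zero_ne_pt_one _ _).symm))
  refine ⟨k, fun n m => ?_⟩
  have h1 := hk (n, m) (mem_univ _)
  have h2 := hστ (pt 0 n) (pt 1 m) (pt_zero_ne_pt_one _ _)
    (fun t ht => hF t ht 0 n) (fun t ht => hF t ht 1 m)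
  have h3 : ∀ (l : Fin 2) (n : ℤ), g (pt l n) = h (pt l n) := fun l n => by
    rw [← hF 1 (by simp), hF1]
  simp only [h3] at h1
  rw [← h2, h1]

end IsStraight

end BrouwerIndex

namespace BrouwerIndex

lemma int_cast_eq (n : ℤ) : (n : ℂ) = ((n : ℝ) : ℂ) := by push_cast; rfl

namespace IsStraight

variable {h : ℂ ≃ₜ ℂ} {τ : ℂ → ℂ → ℝ} {ε : Fin 2 → ℤ} {A : ℂ → ℝ}

lemma exists_turn (hs : IsStraight h ε) (hτ : IsTurn h τ) :
    ∃ a : ℝ, ∀ l, ∀ n m : ℤ, n ≠ m → τ (pt l n) (pt l m) = a := by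
  obtain ⟨A, hA, hAa⟩ := exists_displacement_arg h.continuous hs.brouwer.fpf
  obtain ⟨c, hc⟩ := hτ.displacement h.continuous hs.brouwer.fpf hA hAa
  refine ⟨-(2 * Real.pi * c), fun l n m hnm => ?_⟩
  obtain ⟨a, ha⟩ := hs.exists_turn_line hτ l
  have := hs.brouwer.turn_add_eq_zero hτ hA hAa hc (hs.eps l) (hs.apply_pt l) ha
  rw [ha n m hnm]
  linarith

/-- The argument of the displacement is constant along each straightened orbit. -/
lemma displacement_eq (hs : IsStraight h ε) (hA : Continuous A)
    (hAa : ∀ x, IsArg (A x) (h x - x)) (l : Fin 2) (n m : ℤ) : A (pt l n) = A (pt l m) := by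
  obtain ⟨τ, hτ⟩ := hs.brouwer.op
  obtain ⟨c, hc⟩ := hτ.displacement h.continuous hs.brouwer.fpf hA hAa
  obtain ⟨a, ha⟩ := hs.exists_turn_line hτ l
  have h0 := hs.brouwer.turn_add_eq_zero hτ hA hAa hc (hs.eps l) (hs.apply_pt l) ha
  have step : ∀ n : ℤ, A (pt l ((n + ε l : ℤ) : ℝ)) = A (pt l n) := by
    intro n
    have h1 := hc (pt l n)
    rw [hs.apply_pt, ha n (n + ε l) (by rcases hs.eps l with h | h <;> omega)] at h1
    linarith
  have step' : ∀ n : ℤ, A (pt l ((n + 1 : ℤ) : ℝ)) = A (pt l n) := by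
    intro n
    rcases hs.eps l with h | h
    · have := step n
      rwa [h] at this
    · have := step (n + 1)
      rw [h, add_neg_cancel_right] at this
      exact this.symm
  have all : ∀ n : ℤ, A (pt l n) = A (pt l (0 : ℤ)) := by
    intro n
    induction n using Int.induction_on with
    | zero => rfl
    | succ i ih => rw [step', ih]
    | pred i ih => rw [← step', sub_add_cancel, ih]
  rw [all n, all m]

end IsStraight

/-- Arguments towards far away points of a straightened orbit. -/
lemma IsTurn.far {Ψ : ℂ ≃ₜ ℂ} {τ : ℂ → ℂ → ℝ} (hτ : IsTurn Ψ τ) {l : Fin 2} {s σ k : ℤ}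
    (hs : s = 1 ∨ s = -1) (hσ : σ = 1 ∨ σ = -1)
    (hy : ∀ n : ℤ, Ψ (pt l n) = pt l ((σ * n + k : ℤ) : ℝ)) (x₀ x₁ : ℂ) :
    ∃ M : ℤ, ∀ m ≥ M, τ x₀ (pt l ((s * m : ℤ) : ℝ)) -
        (Complex.arg ((σ * s : ℤ) * (Ψ (pt l ((s * m : ℤ) : ℝ)) - Ψ x₀)) -
          Complex.arg (s * (pt l ((s * m : ℤ) : ℝ) - x₀))) =
      τ x₁ (pt l ((s * m : ℤ) : ℝ)) -
        (Complex.arg ((σ * s : ℤ) * (Ψ (pt l ((s * m : ℤ) : ℝ)) - Ψ x₁)) -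
          Complex.arg (s * (pt l ((s * m : ℤ) : ℝ) - x₁))) := by
  let x : ℝ → ℂ := fun u => x₀ + u * (x₁ - x₀)
  have hxc : Continuous x := by fun_prop
  obtain ⟨R₁, hR₁⟩ := (isCompact_Icc (a := (0:ℝ)) (b := 1)).exists_bound_of_continuousOn
    hxc.continuousOn
  obtain ⟨R₂, hR₂⟩ := (isCompact_Icc (a := (0:ℝ)) (b := 1)).exists_bound_of_continuousOn
    (Ψ.continuous.comp hxc).continuousOn
  have hss : (s : ℝ) * s = 1 := by rcases hs with rfl | rfl <;> norm_num
  have hσσ : (σ : ℝ) * σ = 1 := by rcases hσ with rfl | rfl <;> norm_num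
  have habs : ∀ s : ℤ, (s = 1 ∨ s = -1) → |(s : ℝ)| = 1 := by
    rintro s (rfl | rfl) <;> norm_num
  refine ⟨⌈R₁⌉ + ⌈R₂⌉ + |k| + 1, fun m hm => ?_⟩
  have hR10 : 0 ≤ R₁ := (norm_nonneg _).trans (hR₁ 0 (by simp))
  have hR20 : 0 ≤ R₂ := (norm_nonneg _).trans (hR₂ 0 (by simp))
  have hm' : R₁ + R₂ + |(k : ℝ)| + 1 ≤ m := by
    have : ((⌈R₁⌉ + ⌈R₂⌉ + |k| + 1 : ℤ) : ℝ) ≤ m := by exact_mod_cast hm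
    push_cast at this
    linarith [Int.le_ceil R₁, Int.le_ceil R₂]
  set y := pt l ((s * m : ℤ) : ℝ) with hydef
  have hre1 : ∀ u ∈ Icc (0:ℝ) 1, 0 < (s * (y - x u)).re := by
    intro u hu
    rw [int_cast_eq, Complex.re_ofReal_mul, Complex.sub_re, hydef, pt_re, mul_sub]
    push_cast
    rw [← mul_assoc, hss, one_mul]
    have := (Complex.abs_re_le_norm _).trans (hR₁ u hu)
    have h2 : |s * (x u).re| ≤ R₁ := by rwa [abs_mul, habs s hs, one_mul]
    have := (abs_le.1 h2).2
    linarith [abs_nonneg (k : ℝ)]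
  have hre2 : ∀ u ∈ Icc (0:ℝ) 1, 0 < ((σ * s : ℤ) * (Ψ y - Ψ (x u))).re := by
    intro u hu
    rw [int_cast_eq, Complex.re_ofReal_mul, Complex.sub_re, hydef, hy, pt_re, mul_sub]
    push_cast
    have e : (σ * s * (σ * (s * m) + k) : ℝ) = m + σ * s * k := by
      linear_combination (s * s * m) * hσσ + m * hss
    rw [e]
    have := (Complex.abs_re_le_norm _).trans (hR₂ u hu)
    have h2 : |σ * s * (Ψ (x u)).re| ≤ R₂ := by
      rw [abs_mul, abs_mul, habs s hs, habs σ hσ, one_mul, one_mul]; exact this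
    have h3 : |σ * s * (k : ℝ)| ≤ |(k : ℝ)| := by
      rw [abs_mul, abs_mul, habs s hs, habs σ hσ, one_mul, one_mul]
    have := (abs_le.1 h2).2
    have := (abs_le.1 h3).1
    linarith
  have hne : ∀ u ∈ Icc (0:ℝ) 1, x u ≠ y := by
    intro u hu h0
    have := hre1 u hu
    rw [h0] at this
    simp at this
  obtain ⟨c, hc⟩ := IsArg.exists_int_of_preconnected (X := ℝ) (S := Icc 0 1) isPreconnected_Icc
    (a := fun u => Complex.arg ((σ * s : ℤ) * (Ψ y - Ψ (x u))) - Complex.arg (s * (y - x u)))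
    (b := fun u => Complex.arg σ + τ (x u) y)
    (v := fun u => ((σ * s : ℤ) * (Ψ y - Ψ (x u))) / (s * (y - x u)))
    (by
      refine ContinuousOn.sub (fun u hu => ?_) (fun u hu => ?_)
      · exact ((Complex.continuousAt_arg (Or.inl (hre2 u hu))).comp
          (f := fun u => ((σ * s : ℤ) : ℂ) * (Ψ y - Ψ (x u))) (by fun_prop)).continuousWithinAt
      · exact ((Complex.continuousAt_arg (Or.inl (hre1 u hu))).comp
          (f := fun u => (s : ℂ) * (y - x u)) (by fun_prop)).continuousWithinAt)
    (continuousOn_const.add (hτ.continuousOn_comp (by fun_prop) (by fun_prop) hne))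
    (fun u _ => (IsArg.arg _).div (IsArg.arg _))
    (fun u hu => by
      have h1 := (IsArg.arg (σ : ℂ)).mul (hτ.isArg _ _ (hne u hu))
      have h2 : (s : ℂ) ≠ 0 := by rcases hs with rfl | rfl <;> norm_num
      have h3 : y - x u ≠ 0 := sub_ne_zero.2 (hne u hu).symm
      convert h1 using 1
      push_cast
      field_simp)
    (fun u hu => by
      refine div_ne_zero ?_ ?_
      · intro h0
        have := hre2 u hu
        rw [h0] at this
        simp at this
      · intro h0
        have := hre1 u hu
        rw [h0] at this
        simp at this)
  have c0 := hc 0 (by simp)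
  have c1 := hc 1 (by simp)
  have hx0 : x 0 = x₀ := by simp [x]
  have hx1 : x 1 = x₁ := by simp [x]
  simp only [hx0, hx1] at c0 c1
  linarith

lemma arg_int_mul_of_im_pos {s : ℤ} (hs : s = 1 ∨ s = -1) {w : ℂ} (hw : 0 < w.im) :
    Complex.arg (s * w) = Complex.arg w - Real.pi * (1 - s) / 2 := by
  rcases hs with rfl | rfl
  · simp
  · have : ((-1 : ℤ) : ℂ) * w = -w := by push_cast; ring
    rw [this, Complex.arg_neg_eq_arg_sub_pi_of_im_pos hw]
    push_cast; ring

lemma arg_int_mul_of_im_neg {s : ℤ} (hs : s = 1 ∨ s = -1) {w : ℂ} (hw : 0 < w.im) :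
    Complex.arg (s * -w) = Complex.arg w - Real.pi * (1 + s) / 2 := by
  have : (s : ℂ) * -w = ((-s : ℤ) : ℂ) * w := by push_cast; ring
  rw [this, arg_int_mul_of_im_pos (by omega) hw]
  push_cast; ring

lemma arg_ofReal_pos {r : ℝ} (hr : 0 < r) : Complex.arg r = 0 := Complex.arg_ofReal_of_nonneg hr.le

section Comparison

variable {h k Ψ : ℂ ≃ₜ ℂ} {τ : ℂ → ℂ → ℝ} {ε δ : Fin 2 → ℤ}

/-- The form of a conjugacy on the straightened orbits. -/
lemma conj_apply_pt (hs : IsStraight h ε) (hs' : IsStraight k δ)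
    (hcomm : ∀ x, Ψ (h x) = k (Ψ x)) (hΨ : ∀ l, ∀ n : ℤ, ∃ m : ℤ, Ψ (pt l n) = pt l m)
    (l : Fin 2) : ∃ σ c : ℤ, (σ = ε l * δ l) ∧ (σ = 1 ∨ σ = -1) ∧
      ∀ n : ℤ, Ψ (pt l n) = pt l ((σ * n + c : ℤ) : ℝ) := by
  choose j hj using hΨ l
  have step : ∀ n, j (n + ε l) = j n + δ l := by
    intro n
    have h1 := hcomm (pt l n)
    rw [hs.apply_pt, hj, hj, hs'.apply_pt] at h1
    exact_mod_cast pt_injective l h1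
  have step' : ∀ n, j (n + 1) = j n + ε l * δ l := by
    intro n
    rcases hs.eps l with h | h
    · have := step n
      rw [h] at this ⊢
      rw [this]; ring
    · have := step (n + 1)
      rw [h, add_neg_cancel_right] at this
      rw [h, this]; ring
  refine ⟨ε l * δ l, j 0, rfl, ?_, fun n => ?_⟩
  · rcases hs.eps l with h | h <;> rcases hs'.eps l with h' | h' <;> simp [h, h']
  · rw [hj]
    congr 2
    induction n using Int.induction_on with
    | zero => simp
    | succ i ih => rw [step', ih]; ring
    | pred i ih =>
      have := step' (-(i : ℤ) - 1)
      rw [sub_add_cancel, ih] at this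
      linarith

/-- The commutation relation between the turn functions. -/
lemma conj_turn {τh τk : ℂ → ℂ → ℝ} (hτ : IsTurn Ψ τ) (hτh : IsTurn h τh) (hτk : IsTurn k τk)
    (hcomm : ∀ x, Ψ (h x) = k (Ψ x)) :
    ∃ e : ℤ, ∀ x y, x ≠ y →
      τ (h x) (h y) + τh x y = τ x y + τk (Ψ x) (Ψ y) + 2 * Real.pi * e := by
  have h1 := hτ.comp hτh h.injective h.continuous
  have h2 := hτk.comp hτ Ψ.injective Ψ.continuous
  have h3 : (fun x => Ψ (h x)) = fun x => k (Ψ x) := funext hcomm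
  rw [h3] at h1
  obtain ⟨e, he⟩ := h2.exists_int (k.injective.comp Ψ.injective) h1
  exact ⟨e, fun x y hxy => by linarith [he x y hxy]⟩

/-- The turn function of a conjugacy is translation invariant on each straightened orbit. -/
lemma conj_turn_line (hτ : IsTurn Ψ τ) (hs : IsStraight h ε) (hs' : IsStraight k δ)
    (hcomm : ∀ x, Ψ (h x) = k (Ψ x)) (hΨ : ∀ l, ∀ n : ℤ, ∃ m : ℤ, Ψ (pt l n) = pt l m)
    (l : Fin 2) (n m : ℤ) (hnm : n < m) :
    τ (pt l ((n + 1 : ℤ) : ℝ)) (pt l ((m + 1 : ℤ) : ℝ)) = τ (pt l n) (pt l m) := by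
  obtain ⟨σ, c, -, hσ, hj⟩ := conj_apply_pt hs hs' hcomm hΨ l
  obtain ⟨τh, hτh⟩ := hs.brouwer.op
  obtain ⟨τk, hτk⟩ := hs'.brouwer.op
  obtain ⟨e, he⟩ := conj_turn hτ hτh hτk hcomm
  obtain ⟨a, ha⟩ := hs.exists_turn hτh
  obtain ⟨b, hb⟩ := hs'.exists_turn hτk
  have hinj : ∀ {n m : ℤ}, n ≠ m → pt l n ≠ pt l m :=
    fun h => (pt_injective l).ne (by exact_mod_cast h)
  have step : ∀ n m : ℤ, n < m → τ (pt l ((n + ε l : ℤ) : ℝ)) (pt l ((m + ε l : ℤ) : ℝ)) =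
      τ (pt l n) (pt l m) + (b - a + 2 * Real.pi * e) := by
    intro n m hnm
    have h1 := he _ _ (hinj hnm.ne)
    rw [hs.apply_pt, hs.apply_pt, hj, hj, ha _ _ _ hnm.ne, hb] at h1
    · linarith
    · intro h0
      rcases hσ with rfl | rfl <;> omega
  obtain ⟨D, hD⟩ : ∃ D, ∀ n m : ℤ, n < m → τ (pt l ((n + 1 : ℤ) : ℝ)) (pt l ((m + 1 : ℤ) : ℝ)) =
      τ (pt l n) (pt l m) + D := by
    rcases hs.eps l with h | h
    · exact ⟨_, fun n m hnm => by simpa only [h] using step n m hnm⟩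
    · refine ⟨-(b - a + 2 * Real.pi * e), fun n m hnm => ?_⟩
      have := step (n + 1) (m + 1) (by omega)
      simp only [h, add_neg_cancel_right] at this
      linarith
  have far : ∀ s : ℤ, (s = 1 ∨ s = -1) → ∃ M : ℤ, ∀ m ≥ M,
      τ (pt l (0 : ℤ)) (pt l ((s * m : ℤ) : ℝ)) = τ (pt l (1 : ℤ)) (pt l ((s * m : ℤ) : ℝ)) := by
    intro s hs1
    obtain ⟨M, hM⟩ := hτ.far hs1 hσ hj (pt l (0 : ℤ)) (pt l (1 : ℤ))
    refine ⟨max M 2, fun m hm => ?_⟩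
    have := hM m (by omega)
    have hm2 : (2 : ℝ) ≤ m := by exact_mod_cast (le_max_right M 2).trans hm
    have hss : (s : ℝ) * s = 1 := by rcases hs1 with rfl | rfl <;> norm_num
    have hσσ : (σ : ℝ) * σ = 1 := by rcases hσ with rfl | rfl <;> norm_num
    have hsle : |(s : ℝ)| = 1 := by rcases hs1 with rfl | rfl <;> norm_num
    have e1 : ∀ i : ℤ, (i = 0 ∨ i = 1) → Complex.arg (s * (pt l ((s * m : ℤ) : ℝ) - pt l i)) = 0 :=
      by
      intro i hi
      rw [pt_sub, int_cast_eq s, ← Complex.ofReal_mul]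
      apply arg_ofReal_pos
      push_cast
      have : (s * (s * m - i) : ℝ) = m - s * i := by linear_combination m * hss
      rw [this]
      have := (abs_le.1 hsle.le).2
      rcases hi with rfl | rfl <;> push_cast <;> linarith
    have e2 : ∀ i : ℤ, (i = 0 ∨ i = 1) →
        Complex.arg ((σ * s : ℤ) * (Ψ (pt l ((s * m : ℤ) : ℝ)) - Ψ (pt l i))) = 0 := by
      intro i hi
      rw [hj, hj, pt_sub, int_cast_eq, ← Complex.ofReal_mul]
      apply arg_ofReal_pos
      push_cast
      have : (σ * s * (σ * (s * m) + c - (σ * i + c)) : ℝ) = m - s * i := by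
        linear_combination (s * s * m - s * i) * hσσ + m * hss
      rw [this]
      have := (abs_le.1 hsle.le).2
      rcases hi with rfl | rfl <;> push_cast <;> linarith
    rw [e1 0 (by simp), e1 1 (by simp), e2 0 (by simp), e2 1 (by simp)] at this
    linarith
  have := eq_zero_of_far (f := fun n m => τ (pt l n) (pt l m)) hD
    (by obtain ⟨M, hM⟩ := far 1 (by simp)
        exact ⟨M, fun m hm => by simpa using hM m hm⟩)
    (by obtain ⟨M, hM⟩ := far (-1) (by simp)
        refine ⟨max M 1, fun m hm => ?_⟩
        have := hM m (by omega)
        simp only [neg_one_mul] at this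
        rw [hτ.symm Ψ.injective (hinj (by omega)), this, hτ.symm Ψ.injective (hinj (by omega))])
  rw [hD n m hnm, this, add_zero]

end Comparison

end BrouwerIndex

namespace BrouwerIndex

section Comparison

variable {h k Ψ : ℂ ≃ₜ ℂ} {τ : ℂ → ℂ → ℝ} {ε δ : Fin 2 → ℤ}

/-- If the turn of a conjugacy does not distinguish two consecutive points of a straightened
orbit, then it is constant on that orbit. -/
lemma conj_turn_const (hτ : IsTurn Ψ τ) (hs : IsStraight h ε) (hs' : IsStraight k δ)
    (hcomm : ∀ x, Ψ (h x) = k (Ψ x)) (hΨ : ∀ l, ∀ n : ℤ, ∃ m : ℤ, Ψ (pt l n) = pt l m) (l : Fin 2)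
    (hU : ∀ m : ℤ, m ≠ 0 → m ≠ 1 → τ (pt l (0 : ℤ)) (pt l m) = τ (pt l (1 : ℤ)) (pt l m)) :
    ∃ t : ℝ, ∀ n m : ℤ, n ≠ m → τ (pt l n) (pt l m) = t := by
  have hstep := conj_turn_line hτ hs hs' hcomm hΨ l
  have h1 : ∀ d : ℕ, ∀ n : ℤ, τ (pt l n) (pt l ((n + (d + 1) : ℤ) : ℝ)) =
      τ (pt l (0 : ℤ)) (pt l ((d + 1 : ℤ) : ℝ)) := by
    intro d n
    induction n using Int.induction_on with
    | zero => rw [zero_add]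
    | succ i ih =>
      rw [← ih, ← hstep i _ (by omega)]
      congr 3; ring
    | pred i ih =>
      rw [← ih, ← hstep (-i - 1) _ (by omega)]
      congr 3
      · ring
      · ring
  have h2 : ∀ d : ℕ, τ (pt l (0 : ℤ)) (pt l ((d + 1 : ℤ) : ℝ)) =
      τ (pt l (0 : ℤ)) (pt l ((1 : ℤ) : ℝ)) := by
    intro d
    induction d with
    | zero => simp
    | succ d ih =>
      rw [hU _ (by omega) (by omega), ← ih, ← h1 d 1]
      congr 3; push_cast; ring
  have h3 : ∀ n m : ℤ, n < m → τ (pt l n) (pt l m) = τ (pt l (0 : ℤ)) (pt l ((1 : ℤ) : ℝ)) := by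
    intro n m hnm
    obtain ⟨d, hd⟩ := Int.exists_add_of_le (show n + 1 ≤ m by omega)
    rw [← h2 d, ← h1 d n]
    congr 3; rw [hd]; ring
  refine ⟨τ (pt l (0 : ℤ)) (pt l ((1 : ℤ) : ℝ)), fun n m hnm => ?_⟩
  rcases lt_or_gt_of_ne hnm with h | h
  · exact h3 n m h
  · rw [hτ.symm Ψ.injective ((pt_injective l).ne (by exact_mod_cast hnm)), h3 m n h]

lemma arg_far {s : ℤ} (hs : s = 1 ∨ s = -1) {c m : ℤ} (hm : 0 < m) (l : Fin 2) :
    Complex.arg (s * (pt l ((s * m + c : ℤ) : ℝ) - pt l c)) = 0 := by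
  rw [pt_sub, int_cast_eq s, ← Complex.ofReal_mul]
  apply arg_ofReal_pos
  have hm' : (0 : ℝ) < m := by exact_mod_cast hm
  rcases hs with rfl | rfl <;> push_cast <;> linarith

lemma conj_turn_eq (hτ : IsTurn Ψ τ) (hs : IsStraight h ε) (hs' : IsStraight k δ)
    (hcomm : ∀ x, Ψ (h x) = k (Ψ x)) (hΨ : ∀ l, ∀ n : ℤ, ∃ m : ℤ, Ψ (pt l n) = pt l m)
    {t : Fin 2 → ℝ} (ht : ∀ l, ∀ n m : ℤ, n ≠ m → τ (pt l n) (pt l m) = t l) : t 0 = t 1 := by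
  obtain ⟨τh, hτh⟩ := hs.brouwer.op
  obtain ⟨τk, hτk⟩ := hs'.brouwer.op
  obtain ⟨e, he⟩ := conj_turn hτ hτh hτk hcomm
  obtain ⟨a, ha⟩ := hs.exists_turn_mixed hτh
  obtain ⟨b, hb⟩ := hs'.exists_turn_mixed hτk
  obtain ⟨σ₀, c₀, -, hσ₀, hj₀⟩ := conj_apply_pt hs hs' hcomm hΨ 0
  obtain ⟨σ₁, c₁, -, hσ₁, hj₁⟩ := conj_apply_pt hs hs' hcomm hΨ 1
  set N : ℤ → ℤ → ℝ := fun n m => τ (pt 0 n) (pt 1 m) -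
    (Complex.arg (Ψ (pt 1 m) - Ψ (pt 0 n)) - Complex.arg (pt 1 m - pt 0 n)) with hN
  obtain ⟨E, hE⟩ : ∃ E : ℝ, ∀ n m : ℤ, N (n + ε 0) (m + ε 1) = N n m + E := by
    refine ⟨2 * Real.pi * (b - a + e), fun n m => ?_⟩
    have h1 := he (pt 0 n) (pt 1 m) (pt_zero_ne_pt_one _ _)
    have h2 := ha n m
    have h3 := hb (σ₀ * n + c₀) (σ₁ * m + c₁)
    rw [← hj₀, ← hj₁, ← hcomm, ← hcomm] at h3
    rw [hs.apply_pt, hs.apply_pt] at h1 h2 h3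
    simp only [hN]
    linarith
  have far₁ : ∀ n s : ℤ, (s = 1 ∨ s = -1) → ∃ M : ℤ, ∀ m ≥ M,
      N n (s * m) = t 1 - s * (Real.pi * (1 - σ₁) / 2) := by
    intro n s hs1
    obtain ⟨M, hM⟩ := hτ.far hs1 hσ₁ hj₁ (pt 1 (0 : ℤ)) (pt 0 n)
    refine ⟨max M 1, fun m hm => ?_⟩
    have h1 := hM m (by omega)
    have hσs : σ₁ * s = 1 ∨ σ₁ * s = -1 := by
      rcases hs1 with rfl | rfl <;> rcases hσ₁ with h | h <;> simp [h]
    rw [ht 1 0 (s * m) (by rcases hs1 with rfl | rfl <;> omega)] at h1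
    have e1 := arg_far hs1 (c := 0) (show 0 < m by omega) 1
    have e2 := arg_far hσs (c := c₁) (show 0 < m by omega) 1
    rw [add_zero] at e1
    have e3 : Complex.arg ((σ₁ * s : ℤ) * (Ψ (pt 1 ((s * m : ℤ) : ℝ)) - Ψ (pt 1 (0 : ℤ)))) = 0 := by
      rw [← e2, hj₁, hj₁, mul_assoc, mul_zero, zero_add]
    rw [e1, e3, arg_int_mul_of_im_pos hσs (by rw [hj₁, hj₀, pt_one_sub_pt_zero_im]; norm_num),
      arg_int_mul_of_im_pos hs1 (by rw [pt_one_sub_pt_zero_im]; norm_num)] at h1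
    simp only [hN]
    push_cast at h1 ⊢
    linarith
  have far₀ : ∀ n s : ℤ, (s = 1 ∨ s = -1) → ∃ M : ℤ, ∀ m ≥ M,
      N (s * m) n = t 0 + s * (Real.pi * (1 - σ₀) / 2) := by
    intro n s hs1
    obtain ⟨M, hM⟩ := hτ.far hs1 hσ₀ hj₀ (pt 0 (0 : ℤ)) (pt 1 n)
    refine ⟨max M 1, fun m hm => ?_⟩
    have h1 := hM m (by omega)
    have hσs : σ₀ * s = 1 ∨ σ₀ * s = -1 := by
      rcases hs1 with rfl | rfl <;> rcases hσ₀ with h | h <;> simp [h]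
    rw [ht 0 0 (s * m) (by rcases hs1 with rfl | rfl <;> omega)] at h1
    have e1 := arg_far hs1 (c := 0) (show 0 < m by omega) 0
    have e2 := arg_far hσs (c := c₀) (show 0 < m by omega) 0
    rw [add_zero] at e1
    have e3 : Complex.arg ((σ₀ * s : ℤ) * (Ψ (pt 0 ((s * m : ℤ) : ℝ)) - Ψ (pt 0 (0 : ℤ)))) = 0 := by
      rw [← e2, hj₀, hj₀, mul_assoc, mul_zero, zero_add]
    rw [e1, e3, ← neg_sub (Ψ (pt 1 n)), ← neg_sub (pt 1 n),
      arg_int_mul_of_im_neg hσs (by rw [hj₁, hj₀, pt_one_sub_pt_zero_im]; norm_num),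
      arg_int_mul_of_im_neg hs1 (by rw [pt_one_sub_pt_zero_im]; norm_num),
      hτ.symm Ψ.injective (pt_zero_ne_pt_one _ _).symm] at h1
    simp only [hN]
    push_cast at h1 ⊢
    linarith
  have hE0 : E = 0 := by
    obtain ⟨M, hM⟩ := far₁ 0 1 (by simp)
    obtain ⟨M', hM'⟩ := far₁ (0 + ε 0) 1 (by simp)
    have h1 := hM (max M M' + 1) (by omega)
    have h2 := hM' (max M M' + 1 + ε 1) (by rcases hs.eps 1 with h | h <;> omega)
    rw [one_mul] at h1 h2
    rw [hE] at h2
    linarith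
  have hNadd : ∀ i : ℤ, ∀ n m : ℤ, N (n + i * ε 0) (m + i * ε 1) = N n m := by
    intro i
    induction i using Int.induction_on with
    | zero => simp
    | succ i ih =>
      intro n m
      rw [← ih n m, add_mul, add_mul, one_mul, one_mul, ← add_assoc, ← add_assoc, hE, hE0, add_zero]
    | pred i ih =>
      intro n m
      rw [← ih n m]
      have := hE (n + (-(i : ℤ) - 1) * ε 0) (m + (-(i : ℤ) - 1) * ε 1)
      rw [hE0, add_zero] at this
      rw [← this]
      congr 1 <;> ring
  obtain ⟨M₁, hM₁⟩ := far₁ 0 1 (by simp)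
  obtain ⟨M₂, hM₂⟩ := far₁ 0 (-1) (by simp)
  obtain ⟨M₃, hM₃⟩ := far₀ 0 1 (by simp)
  obtain ⟨M₄, hM₄⟩ := far₀ 0 (-1) (by simp)
  obtain ⟨m, hm⟩ : ∃ m, m = max (max M₁ M₂) (max M₃ M₄) := ⟨_, rfl⟩
  have f1 := hM₁ m (by omega)
  have f2 := hM₂ m (by omega)
  have f3 := hM₃ m (by omega)
  have f4 := hM₄ m (by omega)
  have g1 := hNadd (m * ε 1) 0 (-m)
  have g2 := hNadd (-(m * ε 1)) 0 m
  push_cast at f1 f2 f3 f4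
  simp only [one_mul, neg_one_mul, zero_add] at f1 f2 f3 f4 g1 g2
  have q : ε 1 * ε 1 = 1 := by rcases hs.eps 1 with h | h <;> simp [h]
  have g1' : -m + m * ε 1 * ε 1 = 0 := by linear_combination m * q
  have g2' : m + -(m * ε 1) * ε 1 = 0 := by linear_combination -m * q
  rw [g1'] at g1
  rw [g2'] at g2
  rcases hs.eps 0 with h0 | h0 <;> rcases hs.eps 1 with h1 | h1 <;> rw [h0, h1] at g1 g2 <;>
    simp only [mul_one, mul_neg, neg_neg] at g1 g2 <;> linarith

/-- Invariance of the index, granted that the turn of the conjugacy does not distinguish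
consecutive points of the orbits. -/
lemma displacement_sub_eq (hτ : IsTurn Ψ τ) (hs : IsStraight h ε) (hs' : IsStraight k δ)
    (hcomm : ∀ x, Ψ (h x) = k (Ψ x)) (hΨ : ∀ l, ∀ n : ℤ, ∃ m : ℤ, Ψ (pt l n) = pt l m)
    (hU : ∀ l, ∀ m : ℤ, m ≠ 0 → m ≠ 1 → τ (pt l (0 : ℤ)) (pt l m) = τ (pt l (1 : ℤ)) (pt l m))
    {A B : ℂ → ℝ} (hA : Continuous A) (hAa : ∀ x, IsArg (A x) (h x - x))
    (hB : Continuous B) (hBa : ∀ x, IsArg (B x) (k x - x)) (n₀ n₁ m₀ m₁ : ℤ) :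
    A (pt 1 n₁) - A (pt 0 n₀) = B (pt 1 m₁) - B (pt 0 m₀) := by
  choose t ht using fun l => conj_turn_const hτ hs hs' hcomm hΨ l (hU l)
  have ht01 := conj_turn_eq hτ hs hs' hcomm hΨ ht
  obtain ⟨c, hc⟩ := IsArg.exists_int_of_preconnected (X := ℂ) (S := univ) isPreconnected_univ
    (a := fun x => A x + τ x (h x)) (b := fun x => B (Ψ x)) (v := fun x => k (Ψ x) - Ψ x)
    (hA.add (hτ.continuous_comp continuous_id h.continuous
      fun x => (hs.brouwer.fpf x).symm)).continuousOn
    (hB.comp Ψ.continuous).continuousOn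
    (fun x _ => by
      rw [← hcomm]
      exact hτ.add_arg (hs.brouwer.fpf x).symm (hAa x))
    (fun x _ => hBa _) (fun x _ => sub_ne_zero.2 (hs'.brouwer.fpf _))
  have key : ∀ l, ∀ n m : ℤ, B (pt l m) = A (pt l n) + t l + 2 * Real.pi * c := by
    intro l n m
    obtain ⟨i, hi⟩ := hΨ l n
    have := hc (pt l n) (mem_univ _)
    rw [hi, hs.apply_pt, ht l _ _ (by rcases hs.eps l with h | h <;> omega)] at this
    rw [hs'.displacement_eq hB hBa l m i, this]
  rw [key 1 n₁, key 0 n₀, ht01]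
  ring

end Comparison

end BrouwerIndex

namespace BrouwerIndex

section Algebra

open LaurentPolynomial

/-- The free group on a generator `sgen` and a generator `xgen`. -/
abbrev FG : Type := FreeGroup Bool

/-- The first free generator. -/
def sgen : FG := FreeGroup.of true

/-- The second free generator. -/
def xgen : FG := FreeGroup.of false

/-- The homomorphism from the free group given by the images of the two generators. -/
def flift {G : Type*} [Group G] (a b : G) : FG →* G := FreeGroup.lift (Bool.rec b a)

@[simp] lemma flift_sgen {G : Type*} [Group G] (a b : G) : flift a b sgen = a := by
  simp [flift, sgen]

@[simp] lemma flift_xgen {G : Type*} [Group G] (a b : G) : flift a b xgen = b := by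
  simp [flift, xgen]

lemma FG.induction {p : FG → Prop} (g : FG) (h1 : p 1) (hs : p sgen) (hx : p xgen)
    (hinv : ∀ g, p g → p g⁻¹) (hmul : ∀ g h, p g → p h → p (g * h)) : p g := by
  have hof : ∀ b, p (FreeGroup.of b) := by rintro (_ | _) <;> assumption
  exact FreeGroup.induction_on g h1 hof (fun b _ => hinv _ (hof b)) hmul

/-- The exponent sum of the first generator. -/
def sdeg (g : FG) : ℤ := (flift (Multiplicative.ofAdd 1) 1 g : Multiplicative ℤ).toAdd

/-- The exponent sum of the second generator. -/
def xdeg (g : FG) : ℤ := (flift 1 (Multiplicative.ofAdd 1) g : Multiplicative ℤ).toAdd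

@[simp] lemma sdeg_mul (g h : FG) : sdeg (g * h) = sdeg g + sdeg h := by simp [sdeg]
@[simp] lemma sdeg_inv (g : FG) : sdeg g⁻¹ = -sdeg g := by simp [sdeg]
@[simp] lemma sdeg_zpow (g : FG) (n : ℤ) : sdeg (g ^ n) = n * sdeg g := by simp [sdeg]
@[simp] lemma sdeg_one : sdeg 1 = 0 := by simp [sdeg]
@[simp] lemma sdeg_sgen : sdeg sgen = 1 := by simp [sdeg]
@[simp] lemma sdeg_xgen : sdeg xgen = 0 := by simp [sdeg]

lemma flift_comm {G : Type*} [CommGroup G] (a b : G) (g : FG) :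
    flift a b g = a ^ sdeg g * b ^ xdeg g := by
  have hx : xdeg xgen = 1 := by simp [xdeg]
  have hs : xdeg sgen = 0 := by simp [xdeg]
  induction g using FG.induction with
  | h1 => simp [xdeg]
  | hs => simp [hs]
  | hx => simp [hx]
  | hinv g ih =>
    have : xdeg g⁻¹ = -xdeg g := by simp [xdeg]
    simp [ih, this, mul_comm]
  | hmul g h ihg ihh =>
    have : xdeg (g * h) = xdeg g + xdeg h := by simp [xdeg]
    rw [map_mul, ihg, ihh, this, sdeg_mul, zpow_add, zpow_add, mul_mul_mul_comm]

lemma intertwine {X Y : Type*} {ρ : FG →* Equiv.Perm X} {ρ' : FG →* Equiv.Perm Y} {φ : X → Y}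
    (hs : ∀ z, φ (ρ sgen z) = ρ' sgen (φ z)) (hx : ∀ z, φ (ρ xgen z) = ρ' xgen (φ z)) (g : FG) :
    ∀ z, φ (ρ g z) = ρ' g (φ z) := by
  induction g using FG.induction with
  | h1 => simp
  | hs => exact hs
  | hx => exact hx
  | hinv g ih =>
    intro z
    apply (ρ' g).injective
    rw [← ih, ← Equiv.Perm.mul_apply, ← Equiv.Perm.mul_apply, ← map_mul, ← map_mul]
    simp
  | hmul g h ihg ihh => intro z; simp [ihg, ihh]

/-- An affine bijection of a ring. -/
def affPerm {R : Type*} [Ring R] (a : Rˣ) (c : R) : Equiv.Perm R :=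
  (Units.mulLeft a).trans (Equiv.addRight c)

@[simp] lemma affPerm_apply {R : Type*} [Ring R] (a : Rˣ) (c z : R) : affPerm a c z = a * z + c :=
  rfl

lemma flift_affPerm {R : Type*} [CommRing R] (a b : Rˣ) (c d : R) (g : FG) :
    ∀ z, flift (affPerm a c) (affPerm b d) g z =
      (flift a b g : Rˣ) * z + flift (affPerm a c) (affPerm b d) g 0 := by
  induction g using FG.induction with
  | h1 => simp
  | hs => simp
  | hx => simp
  | hinv g ih =>
    intro z
    apply (flift (affPerm a c) (affPerm b d) g).injective
    have h1 : ∀ w, flift (affPerm a c) (affPerm b d) g (flift (affPerm a c) (affPerm b d) g⁻¹ w) =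
      w := by
      intro w
      rw [← Equiv.Perm.mul_apply, ← map_mul]
      simp
    have h2 := ih (flift (affPerm a c) (affPerm b d) g⁻¹ 0)
    rw [h1] at h2
    rw [h1, ih, mul_add, add_assoc, ← h2, map_inv, add_zero, Units.mul_inv_cancel_left]
  | hmul g h ihg ihh =>
    intro z
    rw [map_mul, Equiv.Perm.mul_apply, Equiv.Perm.mul_apply, ihg, ihh,
      ihg (flift (affPerm a c) (affPerm b d) h 0)]
    simp
    ring

/-- The monomials of degree one as units of the ring of Laurent polynomials. -/
noncomputable def tunit (A : Type*) [CommRing A] : A[T;T⁻¹]ˣ :=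
  ⟨LaurentPolynomial.T 1, LaurentPolynomial.T (-1),
    by rw [← T_add]; simp, by rw [← T_add]; simp⟩

lemma isUnit_laurent {A : Type*} [CommRing A] [IsDomain A] {Q : A[T;T⁻¹]} (hQ : IsUnit Q) :
    ∃ (r : A) (j : ℤ), IsUnit r ∧ Q = C r * LaurentPolynomial.T j := by
  obtain ⟨M, hM⟩ := isUnit_iff_exists_inv.1 hQ
  obtain ⟨n, q, hq⟩ := exists_T_pow Q
  obtain ⟨m, p, hp⟩ := exists_T_pow M
  have h1 : q * p = Polynomial.X ^ (n + m) := by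
    apply Polynomial.toLaurent_injective
    rw [map_mul, hq, hp, Polynomial.toLaurent_X_pow]
    push_cast
    rw [T_add]
    linear_combination (LaurentPolynomial.T n * LaurentPolynomial.T m) * hM
  obtain ⟨i, -, hi⟩ := (dvd_prime_pow Polynomial.prime_X _).1 (Dvd.intro _ h1)
  obtain ⟨u, hu⟩ := hi.symm
  obtain ⟨r, hr, hru⟩ := Polynomial.isUnit_iff.1 u.isUnit
  refine ⟨r, i - n, hr, ?_⟩
  have h2 : Q * LaurentPolynomial.T n * LaurentPolynomial.T (-n) =
      C r * LaurentPolynomial.T (i - n) := by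
    rw [← hq, ← hu, ← hru, map_mul, Polynomial.toLaurent_X_pow, Polynomial.toLaurent_C, T_sub]
    ring
  rwa [mul_assoc, ← T_add, add_neg_cancel, T_zero, mul_one] at h2

/-- The action of the free group on integer sequences where `sgen` acts by a shift and `xgen`
adds one at the origin. -/
def wact : FG →* Equiv.Perm (ℤ → ℤ) :=
  flift ((Equiv.addRight (-1 : ℤ)).symm.arrowCongr (Equiv.refl ℤ))
    (Equiv.addRight (Pi.single 0 1))

lemma wact_sgen (f : ℤ → ℤ) (m : ℤ) : wact sgen f m = f (m - 1) := by
  simp [wact, sub_eq_add_neg]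

lemma wact_xgen (f : ℤ → ℤ) : wact xgen f = f + Pi.single 0 1 := by
  simp [wact]

/-- The winding coefficients of an element of the free group. -/
def wcoef (m : ℤ) (g : FG) : ℤ := wact g 0 m

/-- A surjective endomorphism fixing `xgen` and preserving the degree of `sgen` does not produce
winding around other points than `0` and `1`. -/
theorem wcoef_eq_zero (θ : FG →* FG) (hx : θ xgen = xgen) (hs : ∃ g, θ g = sgen)
    (hd : sdeg (θ sgen) = 1) {m : ℤ} (h0 : m ≠ 0) (h1 : m ≠ 1) : wcoef m (θ sgen) = 0 := by
  let A := PowerSeries ℤ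
  let ev : A →+* ℤ := PowerSeries.constantCoeff
  obtain ⟨x, hxval⟩ : IsUnit (1 + PowerSeries.X : A) := by
    rw [PowerSeries.isUnit_iff_constantCoeff]; simp [A]
  have hevx : ev x = 1 := by rw [hxval, map_add, map_one]; exact add_eq_left.2 PowerSeries.constantCoeff_X
  have hx1 : (x : A) - 1 ≠ 0 := by rw [hxval, add_sub_cancel_left]; exact PowerSeries.X_ne_zero
  let t := tunit A
  let ξ : A[T;T⁻¹]ˣ := Units.map (C : A →+* A[T;T⁻¹]).toMonoidHom x
  have hξ : (ξ : A[T;T⁻¹]) = C (x : A) := rfl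
  let ρA := flift (affPerm t 1) (affPerm ξ 0)
  let ρB := flift (affPerm t 0) (affPerm ξ 1)
  let ρC := flift (affPerm t (1 - t)) (affPerm ξ 0)
  set c := θ sgen with hc
  set Q := ρA c 0 with hQ
  set P := ρB c 0 with hP
  set t' := flift t ξ c with ht'
  let μ : A[T;T⁻¹] →+* A[T;T⁻¹] := eval₂ C t'
  have hμt : μ t = t' := by
    have := eval₂_T C t' 1
    rwa [zpow_one] at this
  have hμx : μ ξ = ξ := eval₂_C C t' _
  have hQunit : IsUnit Q := by
    obtain ⟨g, hg⟩ := hs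
    have := intertwine (ρ := ρA) (ρ' := ρA.comp θ) (φ := fun z => Q * μ z)
      (fun z => by
        simp only [MonoidHom.comp_apply]
        rw [← hc, show ρA c (Q * μ z) = t' * (Q * μ z) + Q from flift_affPerm t ξ 1 0 c _]
        simp only [ρA, flift_sgen, affPerm_apply, map_add, map_mul, map_one, hμt]
        ring)
      (fun z => by
        simp only [MonoidHom.comp_apply, hx]
        simp only [ρA, flift_xgen, affPerm_apply, map_add, map_mul, map_zero, hμx]
        ring) g 0
    simp only [MonoidHom.comp_apply, hg, map_zero, mul_zero] at this
    simp only [ρA, flift_sgen, affPerm_apply, mul_zero, zero_add] at this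
    exact IsUnit.of_mul_eq_one _ this
  have hrel : (C (x : A) - 1) * P + 1 = (t' : A[T;T⁻¹]) + (1 - LaurentPolynomial.T 1) * Q := by
    have e1 := intertwine (ρ := ρB) (ρ' := ρC) (φ := fun z => (ξ - 1) * z + 1)
      (fun z => by simp [ρB, ρC]; ring) (fun z => by simp [ρB, ρC]; ring) c 0
    have e2 := intertwine (ρ := ρA) (ρ' := ρC) (φ := fun z => (1 - t) * z)
      (fun z => by simp [ρA, ρC]; ring) (fun z => by simp [ρA, ρC]; ring) c 0
    simp only [mul_zero, zero_add] at e1 e2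
    rw [show ρC c 1 = t' * 1 + ρC c 0 from flift_affPerm t ξ _ _ c _, ← e2, mul_one] at e1
    exact e1
  obtain ⟨r, j, hr, hrj⟩ := isUnit_laurent hQunit
  have ht'' : (t' : A[T;T⁻¹]) = C ((x ^ xdeg c : Aˣ) : A) * LaurentPolynomial.T 1 := by
    rw [ht', flift_comm, hd, zpow_one, mul_comm, Units.val_mul]
    congr 1
    rw [← map_zpow]
    rfl
  have hcoef : ∀ i : ℤ, (x - 1 : A) * P.coeff i + (if i = 0 then 1 else 0) =
      (if i = 1 then ((x ^ xdeg c : Aˣ) : A) else 0) +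
        ((if i = j then r else 0) - (if i = j + 1 then r else 0)) := by
    intro i
    have := congrArg (fun p => p.coeff i) hrel
    simp only [ht'', hrj] at this
    have e3 : (1 - LaurentPolynomial.T 1 : A[T;T⁻¹]) * (C r * LaurentPolynomial.T j) =
        C r * LaurentPolynomial.T j - C r * LaurentPolynomial.T (j + 1) := by
      rw [T_add]; ring
    have e4 : (C (x : A) - 1 : A[T;T⁻¹]) = C (x - 1 : A) := by simp
    have e5 : (1 : A[T;T⁻¹]) = C 1 * LaurentPolynomial.T 0 := by simp
    have e6 : ∀ (a : A) (n : ℤ),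
        (C a * LaurentPolynomial.T n).coeff i = if i = n then a else 0 := by
      intro a n
      rw [← smul_eq_C_mul]
      simp [eq_comm]
    rw [e3, e4, ← smul_eq_C_mul, e5] at this
    simpa only [AddMonoidAlgebra.coeff_add, AddMonoidAlgebra.coeff_sub, AddMonoidAlgebra.coeff_smul,
      Finsupp.add_apply, Finsupp.sub_apply, Finsupp.smul_apply, smul_eq_mul, e6] using this
  have hevu : ∀ k : ℤ, ev ((x ^ k : Aˣ) : A) = 1 := by
    intro k
    have h1 : Units.map ev.toMonoidHom x = 1 := Units.ext hevx
    have h2 : Units.map ev.toMonoidHom (x ^ k) = 1 := by rw [map_zpow, h1, one_zpow]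
    exact congrArg Units.val h2
  have hcoef' : ∀ i : ℤ, (if i = 0 then 1 else 0 : ℤ) = (if i = 1 then 1 else 0) +
      ((if i = j then ev r else 0) - (if i = j + 1 then ev r else 0)) := by
    intro i
    have := congrArg ev (hcoef i)
    simp only [map_add, map_mul, map_sub, hevx, map_one, sub_self, zero_mul, zero_add, apply_ite ev,
      map_zero, hevu] at this
    exact this
  have hevr : ev r ≠ 0 := (hr.map ev).ne_zero
  have hj : j = 0 := by
    have h1 := hcoef' 0
    have h2 := hcoef' j
    simp only [if_true] at h1 h2
    by_contra hj0
    split_ifs at h1 h2 <;> omega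
  have hPm : P.coeff m = 0 := by
    have := hcoef m
    rw [hj] at this
    simp only [h0, h1, if_false, zero_add, sub_zero, add_zero] at this
    exact (mul_eq_zero.1 this).resolve_left hx1
  have := intertwine (ρ := ρB) (ρ' := wact) (φ := fun z i => ev (z.coeff i))
    (fun z => by
      funext i
      rw [wact_sgen]
      simp only [ρB, flift_sgen, affPerm_apply, add_zero]
      congr 1
      have : (t : A[T;T⁻¹]) = LaurentPolynomial.T 1 := rfl
      rw [this, LaurentPolynomial.T, mul_comm,
        AddMonoidAlgebra.coeff_mul_single_eq_coeff_mul (i - 1)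
        (fun _ _ => eq_sub_iff_add_eq.symm), mul_one])
    (fun z => by
      funext i
      rw [wact_xgen]
      simp only [ρB, flift_xgen, affPerm_apply, hξ]
      rw [← smul_eq_C_mul]
      simp [hevx, Pi.single_apply]
      simp [← T_zero, eq_comm]
      ) c 0
  have h2 := congrFun this m
  simp only [← hP, hPm, map_zero] at h2
  rw [wcoef, h2]
  rfl

end Algebra

end BrouwerIndex

namespace BrouwerIndex

open Filter Topology

/-- The plane cut along the downward vertical rays issued from the integers. -/
def Up : Set ℂ := {z | (∃ n : ℤ, z.re = n) → 0 < z.im}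

/-- The plane cut along the upward vertical rays issued from the integers. -/
def Um : Set ℂ := {z | (∃ n : ℤ, z.re = n) → z.im < 0}

lemma isClosed_re_int : IsClosed {z : ℂ | ∃ n : ℤ, z.re = n} := by
  have : {z : ℂ | ∃ n : ℤ, z.re = n} = Complex.re ⁻¹' range ((↑) : ℤ → ℝ) := by
    ext z; simp [eq_comm]
  rw [this]
  exact Int.isClosedEmbedding_coe_real.isClosed_range.preimage Complex.continuous_re

lemma isOpen_Up : IsOpen Up := by
  have : Up = {z : ℂ | ∃ n : ℤ, z.re = n}ᶜ ∪ {z | 0 < z.im} := by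
    ext z; simp only [Up, mem_ofPred_eq, imp_iff_not_or, mem_union, mem_compl_iff]
  rw [this]
  exact isClosed_re_int.isOpen_compl.union (isOpen_lt continuous_const Complex.continuous_im)

lemma isOpen_Um : IsOpen Um := by
  have : Um = {z : ℂ | ∃ n : ℤ, z.re = n}ᶜ ∪ {z | z.im < 0} := by
    ext z; simp only [Um, mem_ofPred_eq, imp_iff_not_or, mem_union, mem_compl_iff]
  rw [this]
  exact isClosed_re_int.isOpen_compl.union (isOpen_lt Complex.continuous_im continuous_const)

lemma mem_Up_or_Um {z : ℂ} (hz : ∀ n : ℤ, z ≠ n) : z ∈ Up ∨ z ∈ Um := by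
  by_contra! h
  simp only [Up, Um, mem_ofPred_eq, not_forall, not_lt] at h
  obtain ⟨⟨⟨n, hn⟩, h1⟩, -, h2⟩ := h
  exact hz n (Complex.ext (by simpa using hn) (by simpa using le_antisymm h1 h2))

lemma re_ne_of_mem {z : ℂ} (hp : z ∈ Up) (hm : z ∈ Um) (n : ℤ) : z.re ≠ n := fun h =>
  lt_asymm (hp ⟨n, h⟩) (hm ⟨n, h⟩)

lemma add_one_mem_Up {z : ℂ} : z + 1 ∈ Up ↔ z ∈ Up := by
  simp only [Up, mem_ofPred_eq, Complex.add_re, Complex.one_re, Complex.add_im, Complex.one_im,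
    add_zero]
  refine imp_congr_left ⟨fun ⟨n, hn⟩ => ⟨n - 1, ?_⟩, fun ⟨n, hn⟩ => ⟨n + 1, ?_⟩⟩ <;> push_cast <;>
    linarith

lemma add_one_mem_Um {z : ℂ} : z + 1 ∈ Um ↔ z ∈ Um := by
  simp only [Um, mem_ofPred_eq, Complex.add_re, Complex.one_re, Complex.add_im, Complex.one_im,
    add_zero]
  refine imp_congr_left ⟨fun ⟨n, hn⟩ => ⟨n - 1, ?_⟩, fun ⟨n, hn⟩ => ⟨n + 1, ?_⟩⟩ <;> push_cast <;>
    linarith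

/-- The second translation generator of the free group. -/
def sm : FG := sgen * xgen⁻¹

/-- The transition elements between the two charts. -/
def yy (n : ℤ) : FG := sgen ^ n * sm ^ (-n)

lemma yy_add_one (n : ℤ) : yy (n + 1) = sgen * yy n * sm⁻¹ := by
  rw [yy, yy, zpow_add, neg_add, zpow_add, zpow_one, zpow_neg_one, (Commute.zpow_self sgen n).eq]
  simp only [mul_assoc]

lemma sdeg_sm : sdeg sm = 1 := by simp [sm]

@[simp] lemma sdeg_yy (n : ℤ) : sdeg (yy n) = 0 := by simp [yy, sdeg_sm]

lemma wact_apply (g : FG) : ∀ (f : ℤ → ℤ) (m : ℤ), wact g f m = f (m - sdeg g) + wcoef m g := by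
  induction g using FG.induction with
  | h1 => simp [wcoef]
  | hs => simp [wcoef, wact_sgen]
  | hx => simp [wcoef, wact_xgen]
  | hinv g ih =>
    have h : ∀ f m, wact g⁻¹ f m = f (m + sdeg g) - wcoef (m + sdeg g) g := by
      intro f m
      have := ih (wact g⁻¹ f) (m + sdeg g)
      rw [← Equiv.Perm.mul_apply, ← map_mul, mul_inv_cancel, map_one, Equiv.Perm.one_apply,
        add_sub_cancel_right] at this
      linarith
    intro f m
    rw [wcoef, h, h, sdeg_inv]
    simp
    ring
  | hmul g h ihg ihh =>
    intro f m
    rw [wcoef, map_mul, Equiv.Perm.mul_apply, Equiv.Perm.mul_apply, ihg, ihg (wact h 0), ihh,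
      ihh 0, sdeg_mul]
    simp
    ring_nf

lemma wcoef_mul (m : ℤ) (g h : FG) :
    wcoef m (g * h) = wcoef m g + wcoef (m - sdeg g) h := by
  rw [wcoef, map_mul, Equiv.Perm.mul_apply, wact_apply, add_comm]
  rfl

@[simp] lemma wcoef_one (m : ℤ) : wcoef m 1 = 0 := by simp [wcoef]

lemma wcoef_inv (m : ℤ) (g : FG) : wcoef m g⁻¹ = -wcoef (m + sdeg g) g := by
  have := wcoef_mul (m + sdeg g) g g⁻¹
  rw [mul_inv_cancel, wcoef_one, add_sub_cancel_right] at this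
  linarith

@[simp] lemma wcoef_sgen (m : ℤ) : wcoef m sgen = 0 := by simp [wcoef, wact_sgen]

lemma wcoef_xgen (m : ℤ) : wcoef m xgen = if m = 0 then 1 else 0 := by
  simp [wcoef, wact_xgen, Pi.single_apply]

lemma wcoef_xgen_zpow (m k : ℤ) : wcoef m (xgen ^ k) = if m = 0 then k else 0 := by
  induction k using Int.induction_on with
  | zero => simp
  | succ i ih =>
    rw [zpow_add_one, wcoef_mul, ih, sdeg_zpow, sdeg_xgen, wcoef_xgen, mul_zero, sub_zero]
    split_ifs <;> rfl
  | pred i ih =>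
    rw [zpow_sub_one, wcoef_mul, ih, wcoef_inv, sdeg_zpow, sdeg_xgen, wcoef_xgen, mul_zero,
      sub_zero, add_zero]
    split_ifs <;> rfl

lemma wcoef_yy (m n : ℤ) :
    wcoef m (yy n) = (if 0 < m then 1 else 0) - (if n < m then 1 else 0) := by
  have step : ∀ m n : ℤ,
      wcoef m (yy (n + 1)) = wcoef (m - 1) (yy n) + if m = 1 then 1 else 0 := by
    intro m n
    rw [yy_add_one, wcoef_mul, wcoef_mul, wcoef_inv, sdeg_sm, sm, wcoef_mul, wcoef_inv]
    simp [wcoef_xgen]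
    congr 1
    simp [sub_eq_zero]
  induction n using Int.induction_on generalizing m with
  | zero => simp [yy]
  | succ i ih => rw [step, ih]; split_ifs <;> lia
  | pred i ih =>
    have h := step (m + 1) (-i - 1)
    rw [sub_add_cancel, ih, add_sub_cancel_right] at h
    split_ifs at h ⊢ <;> lia

open Classical in
/-- The coordinate in the second chart of the point with first coordinate `v`. -/
noncomputable def cm (z : ℂ) (v : FG) : FG := if z ∈ Up then (yy ⌊z.re⌋)⁻¹ * v else v

lemma cm_mul (z : ℂ) (v g : FG) : cm z (v * g) = cm z v * g := by
  unfold cm; split_ifs <;> simp [mul_assoc]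

lemma cm_of_mem {z : ℂ} (h : z ∈ Up) (v : FG) : v = yy ⌊z.re⌋ * cm z v := by
  rw [cm, if_pos h, mul_inv_cancel_left]

lemma cm_of_notMem {z : ℂ} (h : z ∉ Up) (v : FG) : cm z v = v := by
  rw [cm, if_neg h]

lemma cm_inv_mul_cm (z : ℂ) (v w : FG) : (cm z v)⁻¹ * cm z w = v⁻¹ * w := by
  unfold cm; split_ifs <;> simp [mul_assoc]

@[simp] lemma sdeg_cm (z : ℂ) (v : FG) : sdeg (cm z v) = sdeg v := by
  unfold cm; split_ifs <;> simp

lemma eq_of_eventually {Y α : Type*} [TopologicalSpace Y] {S : Set Y} (hS : IsPreconnected S)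
    {c : Y → α} (h : ∀ y ∈ S, ∀ᶠ y' in 𝓝[S] y, c y' = c y) {x y : Y} (hx : x ∈ S) (hy : y ∈ S) :
    c x = c y := by
  let _ : TopologicalSpace α := ⊥
  have : DiscreteTopology α := ⟨rfl⟩
  refine hS.constant (fun y hy => ?_) hx hy
  rw [ContinuousWithinAt, nhds_discrete, tendsto_pure]
  exact h y hy

/-- The function `v` describes a lift of `f` to the covering of the complement of the integers
whose transition function from the second chart to the first one is `yy`. -/
structure IsLift {Y : Type*} [TopologicalSpace Y] (f : Y → ℂ) (v : Y → FG) (S : Set Y) : Prop where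
  cont : ContinuousOn f S
  ne : ∀ y ∈ S, ∀ n : ℤ, f y ≠ n
  up : ∀ y ∈ S, f y ∈ Up → ∀ᶠ y' in 𝓝[S] y, v y' = v y
  um : ∀ y ∈ S, f y ∈ Um → ∀ᶠ y' in 𝓝[S] y, cm (f y') (v y') = cm (f y) (v y)

namespace IsLift

variable {Y Z : Type*} [TopologicalSpace Y] [TopologicalSpace Z] {f : Y → ℂ} {v w : Y → FG}
  {S : Set Y}

lemma eventually_up (h : IsLift f v S) {y : Y} (hy : y ∈ S) (hu : f y ∈ Up) :
    ∀ᶠ y' in 𝓝[S] y, f y' ∈ Up :=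
  h.cont y hy (isOpen_Up.mem_nhds hu)

lemma eventually_um (h : IsLift f v S) {y : Y} (hy : y ∈ S) (hu : f y ∈ Um) :
    ∀ᶠ y' in 𝓝[S] y, f y' ∈ Um :=
  h.cont y hy (isOpen_Um.mem_nhds hu)

lemma comp (h : IsLift f v S) {p : Z → Y} {R : Set Z} (hp : ContinuousOn p R)
    (hR : MapsTo p R S) : IsLift (fun z => f (p z)) (fun z => v (p z)) R where
  cont := h.cont.comp hp hR
  ne z hz := h.ne _ (hR hz)
  up z hz _ := ((hp z hz).tendsto_nhdsWithin hR).eventually (h.up _ (hR hz) ‹_›)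
  um z hz _ := ((hp z hz).tendsto_nhdsWithin hR).eventually (h.um _ (hR hz) ‹_›)

lemma mul_right (h : IsLift f v S) (g : FG) : IsLift f (fun y => v y * g) S where
  cont := h.cont
  ne := h.ne
  up y hy hu := (h.up y hy hu).mono fun y' e => by rw [e]
  um y hy hu := (h.um y hy hu).mono fun y' e => by rw [cm_mul, cm_mul, e]

lemma congr (h : IsLift f v S) {f' : Y → ℂ} {v' : Y → FG} (hf : EqOn f' f S) (hv : EqOn v' v S) :
    IsLift f' v' S where
  cont := h.cont.congr hf
  ne y hy := by rw [hf hy]; exact h.ne y hy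
  up y hy hu := by
    rw [hf hy] at hu
    filter_upwards [h.up y hy hu, self_mem_nhdsWithin] with y' e hy'
    rw [hv hy, hv hy', e]
  um y hy hu := by
    rw [hf hy] at hu
    filter_upwards [h.um y hy hu, self_mem_nhdsWithin] with y' e hy'
    rw [hv hy, hv hy', hf hy, hf hy', e]

/-- A function of the coordinates of a lift which is locally constant in both charts is locally
constant. -/
lemma eq_of_charts {α : Type*} (h : IsLift f v S) (hS : IsPreconnected S) {c : Y → α}
    (hu : ∀ y ∈ S, f y ∈ Up → ∀ᶠ y' in 𝓝[S] y, c y' = c y)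
    (hm : ∀ y ∈ S, f y ∈ Um → ∀ᶠ y' in 𝓝[S] y, c y' = c y) {x y : Y} (hx : x ∈ S) (hy : y ∈ S) :
    c x = c y :=
  eq_of_eventually hS
    (fun y hy => (mem_Up_or_Um (h.ne y hy)).elim (fun hy' => hu y hy hy') fun hy' => hm y hy hy')
    hx hy

lemma exists_mul_right (h : IsLift f v S) (h' : IsLift f w S) (hS : IsPreconnected S) :
    ∃ g, ∀ y ∈ S, w y = v y * g := by
  rcases S.eq_empty_or_nonempty with rfl | ⟨x, hx⟩
  · exact ⟨1, by simp⟩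
  refine ⟨(v x)⁻¹ * w x, fun y hy => ?_⟩
  rw [← h.eq_of_charts hS (c := fun y => (v y)⁻¹ * w y) (fun y hy hu => ?_) (fun y hy hu => ?_)
    hy hx, mul_inv_cancel_left]
  · filter_upwards [h.up y hy hu, h'.up y hy hu] with y' e e'
    rw [e, e']
  · filter_upwards [h.um y hy hu, h'.um y hy hu] with y' e e'
    rw [← cm_inv_mul_cm (f y'), e, e', cm_inv_mul_cm]

lemma sdeg_eq (h : IsLift f v S) (hS : IsPreconnected S) {x y : Y} (hx : x ∈ S) (hy : y ∈ S) :
    sdeg (v x) = sdeg (v y) := by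
  refine h.eq_of_charts hS (c := fun y => sdeg (v y)) (fun y hy hu => ?_) (fun y hy hu => ?_) hx hy
  · filter_upwards [h.up y hy hu] with y' e
    rw [e]
  · filter_upwards [h.um y hy hu] with y' e
    rw [← sdeg_cm (f y'), e, sdeg_cm]

end IsLift

/-- The point with coordinate `v` over `z` lies in the translate by `g` of the cusp at `n`. -/
def Cusp (n : ℤ) (g : FG) (z : ℂ) (v : FG) : Prop :=
  (z ∈ Up → ∃ k : ℤ, v = sgen ^ n * xgen ^ k * g) ∧
    (z ∈ Um → ∃ k : ℤ, cm z v = sm ^ n * xgen ^ k * g)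

lemma exists_yy_mul_sm {z : ℂ} {n : ℤ} (hz : |z.re - n| < 1) :
    ∃ j : ℤ, yy ⌊z.re⌋ * sm ^ n = sgen ^ n * xgen ^ j := by
  rw [abs_lt] at hz
  have h : ⌊z.re⌋ = n ∨ ⌊z.re⌋ = n - 1 := by
    rw [Int.floor_eq_iff, Int.floor_eq_iff]
    push_cast
    rcases le_or_gt (n : ℝ) z.re with h | h
    · left; constructor <;> linarith
    · right; constructor <;> linarith
  rcases h with h | h
  · exact ⟨0, by simp [h, yy]⟩
  · refine ⟨-1, ?_⟩
    rw [h, yy, mul_assoc, ← zpow_add, zpow_sub_one, zpow_neg_one]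
    simp [sm, mul_assoc]

lemma cusp_iff {z : ℂ} {n : ℤ} (hz : |z.re - n| < 1) (hu : z ∈ Up) (g v : FG) :
    (∃ k : ℤ, v = sgen ^ n * xgen ^ k * g) ↔ ∃ k : ℤ, cm z v = sm ^ n * xgen ^ k * g := by
  obtain ⟨j, hj⟩ := exists_yy_mul_sm hz
  have h : ∀ k : ℤ, yy ⌊z.re⌋ * (sm ^ n * xgen ^ k * g) = sgen ^ n * xgen ^ (j + k) * g := by
    intro k
    rw [← mul_assoc, ← mul_assoc, hj, zpow_add, mul_assoc (sgen ^ n)]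
  constructor
  · rintro ⟨k, rfl⟩
    refine ⟨k - j, ?_⟩
    rw [cm, if_pos hu, inv_mul_eq_iff_eq_mul, h, add_sub_cancel]
  · rintro ⟨k, hk⟩
    exact ⟨j + k, by rw [← h, ← hk, ← cm_of_mem hu]⟩

lemma cusp_iff_up {z : ℂ} {n : ℤ} (hz : |z.re - n| < 1) (hu : z ∈ Up) {g v : FG} :
    Cusp n g z v ↔ ∃ k : ℤ, v = sgen ^ n * xgen ^ k * g :=
  ⟨fun h => h.1 hu, fun h => ⟨fun _ => h, fun _ => (cusp_iff hz hu g v).1 h⟩⟩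

lemma cusp_iff_um {z : ℂ} {n : ℤ} (hz : |z.re - n| < 1) (hm : z ∈ Um) {g v : FG} :
    Cusp n g z v ↔ ∃ k : ℤ, cm z v = sm ^ n * xgen ^ k * g :=
  ⟨fun h => h.2 hm, fun h => ⟨fun hu => (cusp_iff hz hu g v).2 h, fun _ => h⟩⟩

lemma exists_cusp {z : ℂ} {n : ℤ} (hz : |z.re - n| < 1) (hne : ∀ m : ℤ, z ≠ m) (v : FG) :
    ∃ g, Cusp n g z v := by
  rcases mem_Up_or_Um hne with hu | hm
  · exact ⟨(sgen ^ n)⁻¹ * v, (cusp_iff_up hz hu).2 ⟨0, by simp⟩⟩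
  · exact ⟨(sm ^ n)⁻¹ * cm z v, (cusp_iff_um hz hm).2 ⟨0, by simp⟩⟩

lemma Cusp.mul_right {n : ℤ} {g v : FG} {z : ℂ} (h : Cusp n g z v) (a : FG) :
    Cusp n (g * a) z (v * a) :=
  ⟨fun hu => (h.1 hu).imp fun k hk => by rw [hk, mul_assoc _ g],
    fun hm => (h.2 hm).imp fun k hk => by rw [cm_mul, hk, mul_assoc _ g]⟩

lemma IsLift.cusp_iff {Y : Type*} [TopologicalSpace Y] {f : Y → ℂ} {v : Y → FG} {S : Set Y}
    (h : IsLift f v S) (hS : IsPreconnected S) {n : ℤ} (hn : ∀ y ∈ S, |(f y).re - n| < 1) (g : FG)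
    {x y : Y} (hx : x ∈ S) (hy : y ∈ S) : Cusp n g (f x) (v x) ↔ Cusp n g (f y) (v y) := by
  refine iff_of_eq (h.eq_of_charts hS (c := fun y => Cusp n g (f y) (v y))
    (fun y hy hu => ?_) (fun y hy hu => ?_) hx hy)
  · filter_upwards [h.up y hy hu, h.eventually_up hy hu, self_mem_nhdsWithin] with y' e hu' hy'
    rw [cusp_iff_up (hn y hy) hu, cusp_iff_up (hn y' hy') hu', e]
  · filter_upwards [h.um y hy hu, h.eventually_um hy hu, self_mem_nhdsWithin] with y' e hu' hy'
    rw [cusp_iff_um (hn y hy) hu, cusp_iff_um (hn y' hy') hu', e]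

open Classical in
/-- The coordinate of the image under the unit translation of the point with coordinate `v`. -/
noncomputable def shiftv (z : ℂ) (v : FG) : FG := if z ∈ Up then sgen * v else sm * v

lemma cm_shiftv (z : ℂ) (v : FG) : cm (z + 1) (shiftv z v) = sm * cm z v := by
  by_cases hu : z ∈ Up
  · rw [cm, shiftv, if_pos hu, if_pos (add_one_mem_Up.2 hu), cm, if_pos hu]
    simp [yy_add_one, mul_assoc]
  · rw [cm, shiftv, if_neg hu, if_neg (mt add_one_mem_Up.1 hu), cm_of_notMem hu]

lemma IsLift.shift {Y : Type*} [TopologicalSpace Y] {f : Y → ℂ} {v : Y → FG} {S : Set Y}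
    (h : IsLift f v S) : IsLift (fun y => f y + 1) (fun y => shiftv (f y) (v y)) S where
  cont := h.cont.add continuousOn_const
  ne y hy n hn := h.ne y hy (n - 1) (by push_cast; rw [← hn]; ring)
  up y hy hu := by
    rw [add_one_mem_Up] at hu
    filter_upwards [h.up y hy hu, h.eventually_up hy hu] with y' e hu'
    rw [shiftv, shiftv, if_pos hu, if_pos hu', e]
  um y hy hu := by
    rw [add_one_mem_Um] at hu
    filter_upwards [h.um y hy hu] with y' e
    rw [cm_shiftv, cm_shiftv, e]

/-- The argument with values between `-π / 2` and `3 * π / 2`. -/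
noncomputable def argp (z : ℂ) : ℝ := (-Complex.I * z).arg + Real.pi / 2

/-- The argument with values between `-3 * π / 2` and `π / 2`. -/
noncomputable def argm (z : ℂ) : ℝ := (Complex.I * z).arg - Real.pi / 2

lemma isArg_argp (z : ℂ) : IsArg (argp z) z := by
  have h : IsArg (Real.pi / 2) Complex.I := by simpa using IsArg.arg Complex.I
  have := (IsArg.arg (-Complex.I * z)).mul h
  rwa [show -Complex.I * z * Complex.I = z by linear_combination (-z) * Complex.I_mul_I] at this

lemma isArg_argm (z : ℂ) : IsArg (argm z) z := by
  have h : IsArg (Real.pi / 2) Complex.I := by simpa using IsArg.arg Complex.I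
  have := (IsArg.arg (Complex.I * z)).div h
  rwa [mul_div_cancel_left₀ _ Complex.I_ne_zero] at this

lemma abs_argp_of_re_pos {z : ℂ} (h : 0 < z.re) : |argp z| < Real.pi / 2 := by
  have h1 : (-Complex.I * z).arg < 0 := by rw [Complex.arg_neg_iff]; simpa using h
  have h2 := Complex.neg_pi_lt_arg (-Complex.I * z)
  rw [argp, abs_lt]; constructor <;> linarith

lemma abs_argp_of_re_neg {z : ℂ} (h : z.re < 0) : |argp z - Real.pi| < Real.pi / 2 := by
  have h0 : 0 < (-Complex.I * z).im := by simpa using h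
  have h1 : 0 < (-Complex.I * z).arg := by
    refine lt_of_le_of_ne (Complex.arg_nonneg_iff.2 h0.le) fun e => ?_
    exact h0.ne' (Complex.arg_eq_zero_iff.1 e.symm).2
  have h2 : (-Complex.I * z).arg < Real.pi :=
    lt_of_le_of_ne (Complex.arg_le_pi _) fun e => h0.ne' (Complex.arg_eq_pi_iff.1 e).2
  rw [argp, abs_lt]; constructor <;> linarith

lemma abs_argm_of_re_pos {z : ℂ} (h : 0 < z.re) : |argm z| < Real.pi / 2 := by
  have h0 : 0 < (Complex.I * z).im := by simpa using h
  have h1 : 0 < (Complex.I * z).arg := by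
    refine lt_of_le_of_ne (Complex.arg_nonneg_iff.2 h0.le) fun e => ?_
    exact h0.ne' (Complex.arg_eq_zero_iff.1 e.symm).2
  have h2 : (Complex.I * z).arg < Real.pi :=
    lt_of_le_of_ne (Complex.arg_le_pi _) fun e => h0.ne' (Complex.arg_eq_pi_iff.1 e).2
  rw [argm, abs_lt]; constructor <;> linarith

lemma abs_argm_of_re_neg {z : ℂ} (h : z.re < 0) : |argm z + Real.pi| < Real.pi / 2 := by
  have h1 : (Complex.I * z).arg < 0 := by rw [Complex.arg_neg_iff]; simpa using h
  have h2 := Complex.neg_pi_lt_arg (Complex.I * z)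
  rw [argm, abs_lt]; constructor <;> linarith

lemma eq_of_abs_two_pi_lt {a b : ℝ} (k : ℤ) (h : b = a + 2 * Real.pi * k)
    (hk : |b - a| < 2 * Real.pi) : b = a := by
  have hπ := Real.pi_pos
  have : k = 0 := by
    rw [h, add_sub_cancel_left, abs_mul, abs_of_pos (by positivity)] at hk
    have : |(k : ℝ)| < 1 := by
      by_contra! h1
      nlinarith
    exact Int.abs_lt_one_iff.1 (by exact_mod_cast this)
  rw [h, this]; simp

lemma argp_eq_argm {z : ℂ} (h : z.re ≠ 0) :
    argp z = argm z + 2 * Real.pi * ((if z.re < 0 then 1 else 0 : ℤ) : ℝ) := by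
  have hz : z ≠ 0 := fun e => h (by simp [e])
  split_ifs with h0
  · obtain ⟨k, hk⟩ := IsArg.exists_int hz ((isArg_argm z).add_int 1) (isArg_argp z)
    have h1 := abs_argp_of_re_neg h0
    have h2 := abs_argm_of_re_neg h0
    refine eq_of_abs_two_pi_lt k hk ?_
    rw [abs_lt] at *
    push_cast
    constructor <;> linarith
  · obtain ⟨k, hk⟩ := IsArg.exists_int hz ((isArg_argm z).add_int 0) (isArg_argp z)
    have h0' : 0 < z.re := lt_of_le_of_ne (not_lt.1 h0) h.symm
    have h1 := abs_argp_of_re_pos h0'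
    have h2 := abs_argm_of_re_pos h0'
    refine eq_of_abs_two_pi_lt k hk ?_
    rw [abs_lt] at *
    push_cast
    constructor <;> linarith

lemma continuousAt_argp {z : ℂ} (h : z.re = 0 → 0 < z.im) : ContinuousAt argp z := by
  refine ContinuousAt.add (ContinuousAt.comp (Complex.continuousAt_arg ?_) (by fun_prop))
    continuousAt_const
  rw [Complex.mem_slitPlane_iff]
  rcases eq_or_ne z.re 0 with h0 | h0
  · left; simpa using h h0
  · right; simpa using h0

lemma continuousAt_argm {z : ℂ} (h : z.re = 0 → z.im < 0) : ContinuousAt argm z := by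
  refine ContinuousAt.sub (ContinuousAt.comp (Complex.continuousAt_arg ?_) (by fun_prop))
    continuousAt_const
  rw [Complex.mem_slitPlane_iff]
  rcases eq_or_ne z.re 0 with h0 | h0
  · left; simpa using h h0
  · right; simpa using h0

lemma continuousAt_argp_sub {z : ℂ} (h : z ∈ Up) (m : ℤ) :
    ContinuousAt (fun z : ℂ => argp (z - m)) z := by
  refine ContinuousAt.comp (continuousAt_argp fun h0 => ?_) (by fun_prop)
  simpa using h ⟨m, by simpa [sub_eq_zero] using h0⟩

lemma continuousAt_argm_sub {z : ℂ} (h : z ∈ Um) (m : ℤ) :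
    ContinuousAt (fun z : ℂ => argm (z - m)) z := by
  refine ContinuousAt.comp (continuousAt_argm fun h0 => ?_) (by fun_prop)
  simpa using h ⟨m, by simpa [sub_eq_zero] using h0⟩

open Classical in
/-- The argument of `z - m` determined by a point of the covering over `z`. -/
noncomputable def Ang (m : ℤ) (z : ℂ) (v : FG) : ℝ :=
  if z ∈ Up then argp (z - m) + 2 * Real.pi * (wcoef m v : ℤ)
  else argm (z - m) + 2 * Real.pi * ((wcoef m v + if 0 < m then 1 else 0 : ℤ) : ℝ)

lemma Ang_up (m : ℤ) {z : ℂ} (h : z ∈ Up) (v : FG) :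
    Ang m z v = argp (z - m) + 2 * Real.pi * (wcoef m v : ℤ) := by
  rw [Ang, if_pos h]

lemma Ang_um (m : ℤ) {z : ℂ} (h : z ∈ Um) (v : FG) :
    Ang m z v =
      argm (z - m) + 2 * Real.pi * ((wcoef m (cm z v) + if 0 < m then 1 else 0 : ℤ) : ℝ) := by
  by_cases hu : z ∈ Up
  · have h1 : ((z - m).re < 0) ↔ ⌊z.re⌋ < m := by simp [Int.floor_lt]
    have h2 : (z - m).re ≠ 0 := by simpa [sub_eq_zero] using re_ne_of_mem hu h m
    conv_lhs => rw [Ang_up m hu, cm_of_mem hu v, wcoef_mul, wcoef_yy, sdeg_yy, sub_zero,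
      argp_eq_argm h2]
    simp only [h1]
    push_cast
    ring
  · rw [Ang, if_neg hu, cm_of_notMem hu]

lemma Ang_mul (m : ℤ) (z : ℂ) (v g : FG) :
    Ang m z (v * g) = Ang m z v + 2 * Real.pi * (wcoef (m - sdeg v) g : ℤ) := by
  unfold Ang
  split_ifs <;> rw [wcoef_mul] <;> push_cast <;> ring

lemma isArg_Ang (m : ℤ) (z : ℂ) (v : FG) : IsArg (Ang m z v) (z - m) := by
  unfold Ang
  split_ifs
  · exact (isArg_argp _).add_int _
  · exact (isArg_argm _).add_int _
  · exact (isArg_argm _).add_int _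

lemma IsLift.continuousOn_Ang {Y : Type*} [TopologicalSpace Y] {f : Y → ℂ} {v : Y → FG} {S : Set Y}
    (h : IsLift f v S) (m : ℤ) : ContinuousOn (fun y => Ang m (f y) (v y)) S := by
  intro y hy
  rcases mem_Up_or_Um (h.ne y hy) with hu | hu
  · have h1 : ContinuousWithinAt
        (fun y' => argp (f y' - m) + 2 * Real.pi * (wcoef m (v y) : ℤ)) S y :=
      ((continuousAt_argp_sub hu m).comp_continuousWithinAt (h.cont y hy)).add
        continuousWithinAt_const
    refine h1.congr_of_eventuallyEq ?_ (Ang_up m hu _)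
    filter_upwards [h.up y hy hu, h.eventually_up hy hu] with y' e hu'
    rw [Ang_up m hu', e]
  · have h1 : ContinuousWithinAt (fun y' => argm (f y' - m) +
        2 * Real.pi * ((wcoef m (cm (f y) (v y)) + if 0 < m then 1 else 0 : ℤ) : ℝ)) S y :=
      ((continuousAt_argm_sub hu m).comp_continuousWithinAt (h.cont y hy)).add
        continuousWithinAt_const
    refine h1.congr_of_eventuallyEq ?_ (Ang_um m hu _)
    filter_upwards [h.um y hy hu, h.eventually_um hy hu] with y' e hu'
    rw [Ang_um m hu', e]

lemma wcoef_sgen_zpow (m n : ℤ) : wcoef m (sgen ^ n) = 0 := by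
  induction n using Int.induction_on generalizing m with
  | zero => simp
  | succ i ih => rw [zpow_add_one, wcoef_mul, ih, wcoef_sgen, add_zero]
  | pred i ih => rw [zpow_sub_one, wcoef_mul, ih, wcoef_inv, wcoef_sgen, neg_zero, add_zero]

lemma wcoef_sm_zpow (m n : ℤ) :
    wcoef m (sm ^ n) = (if n < m then 1 else 0) - (if 0 < m then 1 else 0) := by
  have h : yy n * sm ^ n = sgen ^ n := by simp [yy]
  have h2 := congrArg (wcoef m) h
  rw [wcoef_mul, wcoef_sgen_zpow, wcoef_yy, sdeg_yy, sub_zero] at h2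
  linarith

/-- Near a puncture the argument relative to another integer is determined by the cusp. -/
lemma Cusp.abs_Ang_lt {m n : ℤ} {g v : FG} {z : ℂ} (h : Cusp n g z v) (hz : |z.re - n| < 1)
    (hne : ∀ m : ℤ, z ≠ m) (hmn : m ≠ n) :
    |Ang m z v - (2 * Real.pi * (wcoef (m - n) g : ℤ) + if n < m then Real.pi else 0)| <
      Real.pi / 2 := by
  have hk : ∀ k : ℤ, wcoef (m - n) (xgen ^ k * g) = wcoef (m - n) g := by
    intro k
    rw [wcoef_mul, wcoef_xgen_zpow, if_neg (sub_ne_zero.2 hmn), sdeg_zpow, sdeg_xgen, mul_zero,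
      sub_zero, zero_add]
  have hre : (n < m ∧ (z - m).re < 0) ∨ (¬ n < m ∧ 0 < (z - m).re) := by
    rw [abs_lt] at hz
    simp only [Complex.sub_re, Complex.intCast_re]
    rcases lt_or_gt_of_ne hmn with h | h
    · have : (m : ℝ) + 1 ≤ n := by exact_mod_cast h
      exact Or.inr ⟨h.not_gt, by linarith⟩
    · have : (n : ℝ) + 1 ≤ m := by exact_mod_cast h
      exact Or.inl ⟨h, by linarith⟩
  rcases mem_Up_or_Um hne with hu | hu
  · obtain ⟨k, rfl⟩ := h.1 hu
    rw [Ang_up m hu, mul_assoc (sgen ^ n), wcoef_mul, wcoef_sgen_zpow, sdeg_zpow, sdeg_sgen,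
      mul_one, hk,
      zero_add]
    rcases hre with ⟨h1, h2⟩ | ⟨h1, h2⟩
    · rw [if_pos h1]
      convert abs_argp_of_re_neg h2 using 2
      ring
    · rw [if_neg h1]
      convert abs_argp_of_re_pos h2 using 2
      ring
  · obtain ⟨k, hk'⟩ := h.2 hu
    rw [Ang_um m hu, hk', mul_assoc (sm ^ n), wcoef_mul, wcoef_sm_zpow, sdeg_zpow, sdeg_sm, mul_one,
      hk]
    rcases hre with ⟨h1, h2⟩ | ⟨h1, h2⟩
    · rw [if_pos h1, if_pos h1]
      convert abs_argm_of_re_neg h2 using 2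
      push_cast
      ring
    · rw [if_neg h1, if_neg h1]
      convert abs_argm_of_re_pos h2 using 2
      push_cast
      ring

/-- The plane without the integers. -/
abbrev Punctured : Type := {z : ℂ // ∀ n : ℤ, z ≠ n}

instance : TopologicalSpace FG := ⊥

instance : DiscreteTopology FG := ⟨rfl⟩

open Classical in
/-- The coordinate, in the first chart, of the origin of the given chart. -/
noncomputable def chartOrigin (i : Bool) (z : ℂ) : FG := if i then 1 else yy ⌊z.re⌋

/-- The domains of the two charts. -/
def chartDomain (i : Bool) : Set ℂ := if i then Up else Um

lemma isOpen_chartDomain (i : Bool) : IsOpen (chartDomain i) := by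
  cases i
  · exact isOpen_Um
  · exact isOpen_Up

open Classical in
/-- The covering of the punctured plane whose total space contains the lifts. -/
noncomputable def coveringCore : FiberBundleCore Bool Punctured FG where
  baseSet i := Subtype.val ⁻¹' chartDomain i
  isOpen_baseSet i := (isOpen_chartDomain i).preimage continuous_subtype_val
  indexAt z := decide (z.1 ∈ Up)
  mem_baseSet_at z := by
    by_cases h : z.1 ∈ Up
    · simp [h, chartDomain]
    · simpa [h, chartDomain] using (mem_Up_or_Um z.2).resolve_left h
  coordChange i j z v := (chartOrigin j z.1)⁻¹ * chartOrigin i z.1 * v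
  coordChange_self i z _ v := by simp
  continuousOn_coordChange i j := by
    by_cases hij : i = j
    · subst hij
      simpa using continuous_snd.continuousOn
    rintro ⟨z, v⟩ ⟨⟨hi, hj⟩, -⟩
    have hz : ∀ n : ℤ, z.1.re ≠ n := by
      cases i <;> cases j
      · exact absurd rfl hij
      · exact re_ne_of_mem hj hi
      · exact re_ne_of_mem hi hj
      · exact absurd rfl hij
    have h1 : ∀ᶠ p : Punctured × FG in 𝓝 (z, v), ⌊p.1.1.re⌋ = ⌊z.1.re⌋ := by
      have h2 : ContinuousAt (fun p : Punctured × FG => p.1.1.re) (z, v) := by fun_prop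
      filter_upwards [h2 (Ioo_mem_nhds (lt_of_le_of_ne (Int.floor_le z.1.re) (hz _).symm)
        (Int.lt_floor_add_one z.1.re))] with p hp
      exact Int.floor_eq_iff.2 ⟨hp.1.le, hp.2⟩
    have h2 : ∀ᶠ p : Punctured × FG in 𝓝 (z, v), p.2 = v := by
      have := (continuous_snd.tendsto (z, v) : Tendsto (Prod.snd : Punctured × FG → FG) _ _)
      rw [nhds_discrete FG] at this
      exact tendsto_pure.1 this
    refine ContinuousAt.continuousWithinAt ?_
    rw [ContinuousAt, nhds_discrete FG, tendsto_pure]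
    filter_upwards [h1, h2] with p hp hp'
    rw [hp']
    simp only [chartOrigin, hp]
  coordChange_comp i j k z _ v := by simp [mul_assoc]

lemma coveringCore_isCoveringMap : IsCoveringMap coveringCore.proj :=
  FiberBundle.isCoveringMap

lemma coveringCore_change_true (z : Punctured) (v : FG) (hu : z.1 ∈ Up) :
    coveringCore.coordChange (coveringCore.indexAt z) true z v = v := by
  simp [coveringCore, chartOrigin, hu]

lemma coveringCore_change_false (z : Punctured) (v : FG) :
    coveringCore.coordChange (coveringCore.indexAt z) false z v = cm z.1 v := by
  by_cases hu : z.1 ∈ Up <;> simp [coveringCore, chartOrigin, hu, cm]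

/-- The section of the covering given by its coordinate. -/
noncomputable def coveringPoint {Y : Type*} (f : Y → Punctured) (v : Y → FG) (y : Y) :
    coveringCore.TotalSpace := ⟨f y, v y⟩

lemma continuousAt_coveringPoint {Y : Type*} [TopologicalSpace Y] {f : Y → Punctured} {v : Y → FG}
    {y : Y} (hf : ContinuousAt f y) (i : Bool) (hy : (f y).1 ∈ chartDomain i) :
    ContinuousAt (coveringPoint f v) y ↔ ∀ᶠ y' in 𝓝 y,
      coveringCore.coordChange (coveringCore.indexAt (f y')) i (f y') (v y') =
      coveringCore.coordChange (coveringCore.indexAt (f y)) i (f y) (v y) := by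
  have h1 : coveringPoint f v ⁻¹' (coveringCore.localTriv i).source ∈ 𝓝 y :=
    hf (((isOpen_chartDomain i).preimage continuous_subtype_val).mem_nhds hy)
  rw [(coveringCore.localTriv i).toOpenPartialHomeomorph.continuousAt_iff_continuousAt_comp_left h1]
  have h2 : (coveringCore.localTriv i).toOpenPartialHomeomorph ∘ coveringPoint f v = fun y' =>
      (f y', coveringCore.coordChange (coveringCore.indexAt (f y')) i (f y') (v y')) := rfl
  rw [h2, ContinuousAt, nhds_prod_eq, Filter.tendsto_prod_iff', nhds_discrete FG, tendsto_pure]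
  exact and_iff_right hf

lemma continuous_coveringPoint_iff {Y : Type*} [TopologicalSpace Y] {f : Y → Punctured}
    {v : Y → FG} (hf : Continuous f) :
    Continuous (coveringPoint f v) ↔ IsLift (fun y => (f y).1) v univ := by
  have hu : ∀ y, (f y).1 ∈ Up → (ContinuousAt (coveringPoint f v) y ↔ ∀ᶠ y' in 𝓝 y, v y' = v y) :=
    by
    intro y hy
    rw [continuousAt_coveringPoint hf.continuousAt true hy]
    have : ∀ᶠ y' in 𝓝 y, (f y').1 ∈ Up :=
      hf.continuousAt ((isOpen_Up.preimage continuous_subtype_val).mem_nhds hy)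
    refine eventually_congr ?_
    filter_upwards [this] with y' hy'
    rw [coveringCore_change_true _ _ hy, coveringCore_change_true _ _ hy']
  have hm : ∀ y, (f y).1 ∈ Um → (ContinuousAt (coveringPoint f v) y ↔
      ∀ᶠ y' in 𝓝 y, cm (f y').1 (v y') = cm (f y).1 (v y)) := by
    intro y hy
    rw [continuousAt_coveringPoint hf.continuousAt false hy]
    simp only [coveringCore_change_false]
  rw [continuous_iff_continuousAt]
  constructor
  · intro h
    refine ⟨(continuous_subtype_val.comp hf).continuousOn, fun y _ => (f y).2, ?_, ?_⟩
    · intro y _ hy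
      rw [nhdsWithin_univ]
      exact (hu y hy).1 (h y)
    · intro y _ hy
      rw [nhdsWithin_univ]
      exact (hm y hy).1 (h y)
  · intro h y
    rcases mem_Up_or_Um (f y).2 with hy | hy
    · rw [hu y hy, ← nhdsWithin_univ]
      exact h.up y trivial hy
    · rw [hm y hy, ← nhdsWithin_univ]
      exact h.um y trivial hy

lemma isLift_subtype {Y : Type*} [TopologicalSpace Y] {f : Y → ℂ} {v : Y → FG} {S : Set Y} :
    IsLift (fun y : S => f y) (fun y => v y) univ ↔ IsLift f v S := by
  constructor
  · intro h
    refine ⟨continuousOn_iff_continuous_domRestrict.2 (continuousOn_univ.1 h.cont),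
      fun y hy => h.ne ⟨y, hy⟩ trivial, fun y hy hu => ?_, fun y hy hu => ?_⟩
    · have := h.up ⟨y, hy⟩ trivial hu
      rw [nhdsWithin_univ, nhds_subtype_eq_comap_nhdsWithin] at this
      obtain ⟨t, ht, hts⟩ := mem_comap.1 this
      filter_upwards [ht, self_mem_nhdsWithin] with y' h1 h2
      exact hts (show (⟨y', h2⟩ : S) ∈ Subtype.val ⁻¹' t from h1)
    · have := h.um ⟨y, hy⟩ trivial hu
      rw [nhdsWithin_univ, nhds_subtype_eq_comap_nhdsWithin] at this
      obtain ⟨t, ht, hts⟩ := mem_comap.1 this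
      filter_upwards [ht, self_mem_nhdsWithin] with y' h1 h2
      exact hts (show (⟨y', h2⟩ : S) ∈ Subtype.val ⁻¹' t from h1)
  · intro h
    exact h.comp continuous_subtype_val.continuousOn fun y _ => y.2

/-- The homotopy lifting property of the covering. -/
theorem exists_lift_homotopy {Y : Type*} [TopologicalSpace Y] {S : Set Y} {F : ℝ × Y → ℂ}
    (hF : ContinuousOn F (Icc 0 1 ×ˢ S)) (hne : ∀ p ∈ Icc (0:ℝ) 1 ×ˢ S, ∀ n : ℤ, F p ≠ n)
    {v : Y → FG} (hv : IsLift (fun y => F (0, y)) v S) :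
    ∃ V : ℝ × Y → FG, IsLift F V (Icc 0 1 ×ˢ S) ∧ ∀ y ∈ S, V (0, y) = v y := by
  classical
  have hmem : ∀ p : unitInterval × S, ((p.1 : ℝ), (p.2 : Y)) ∈ Icc (0:ℝ) 1 ×ˢ S :=
    fun p => ⟨p.1.2, p.2.2⟩
  let H : C(unitInterval × S, Punctured) :=
    ⟨fun p => ⟨F (p.1, p.2), hne _ (hmem p)⟩, by
      refine Continuous.subtype_mk (hF.comp_continuous (by fun_prop) hmem) _⟩
  let f0 : S → Punctured := fun y => H (0, y)
  have hf0 : Continuous f0 := by fun_prop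
  have hv0 : Continuous (coveringPoint f0 fun y => v y) :=
    (continuous_coveringPoint_iff hf0).2 (isLift_subtype.2 hv)
  let L := coveringCore_isCoveringMap.liftHomotopy H ⟨_, hv0⟩ fun y => rfl
  have hL : ∀ p, (L p).1 = H p := congrFun (coveringCore_isCoveringMap.liftHomotopy_lifts H _ _)
  have hL0 : ∀ y, L (0, y) = coveringPoint f0 (fun y => v y) y :=
    coveringCore_isCoveringMap.liftHomotopy_zero H ⟨_, hv0⟩ _
  let l : unitInterval × S → FG := fun p => (L p).2
  have hmk : ∀ (q : coveringCore.TotalSpace) (b : Punctured), q.1 = b →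
      q = coveringPoint (Y := Unit) (fun _ => b) (fun _ => q.2) () := by
    rintro ⟨b, w⟩ _ rfl
    rfl
  have hc : Continuous (coveringPoint H l) := L.continuous.congr fun p => hmk _ _ (hL p)
  rw [continuous_coveringPoint_iff H.continuous] at hc
  let W : ℝ × Y → FG := fun p => if h : p.1 ∈ Icc (0:ℝ) 1 ∧ p.2 ∈ S then
    l (⟨p.1, h.1⟩, ⟨p.2, h.2⟩) else 1
  have hW : ∀ (p : ℝ × Y) (h : p.1 ∈ Icc (0:ℝ) 1 ∧ p.2 ∈ S),
    W p = l (⟨p.1, h.1⟩, ⟨p.2, h.2⟩) := fun p h => dif_pos h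
  refine ⟨W, isLift_subtype.1 ?_, fun y hy => ?_⟩
  · let q : (Icc (0:ℝ) 1 ×ˢ S : Set (ℝ × Y)) → unitInterval × S :=
      fun p => (⟨p.1.1, p.2.1⟩, ⟨p.1.2, p.2.2⟩)
    have hq : Continuous q := by fun_prop
    refine (hc.comp (p := q) hq.continuousOn fun _ _ => trivial).congr (fun p _ => rfl) ?_
    intro p _
    exact hW _ p.2
  · rw [hW _ ⟨by simp, hy⟩]
    exact congrArg (fun p => p.2) (hL0 ⟨y, hy⟩)

/-- The closed half plane on the side of `s`, without the integers. -/
def half (s : ℝ) : Set ℂ := {z | 0 ≤ s * z.im ∧ ∀ n : ℤ, z ≠ n}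

lemma half_one_subset : half 1 ⊆ Up := by
  rintro z ⟨h1, h2⟩ ⟨n, hn⟩
  rw [one_mul] at h1
  exact lt_of_le_of_ne h1 fun e => h2 n (Complex.ext (by simpa using hn) (by simpa using e.symm))

lemma half_neg_one_subset : half (-1) ⊆ Um := by
  rintro z ⟨h1, h2⟩ ⟨n, hn⟩
  exact lt_of_le_of_ne (by linarith) fun e =>
    h2 n (Complex.ext (by simpa using hn) (by simpa using e))

lemma ofReal_mem_half {n : ℤ} {r : ℝ} (hr : r ∈ Ioo (n : ℝ) (n + 1)) (s : ℝ) : (r : ℂ) ∈ half s :=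
    by
  refine ⟨by simp, fun m hm => ?_⟩
  have hm' : r = m := by exact_mod_cast hm
  rw [hm'] at hr
  have h1 : n < m := by exact_mod_cast hr.1
  have h2 : m < n + 1 := by exact_mod_cast hr.2
  lia

lemma starConvex_half {s : ℝ} {c : ℂ} (hc : 0 < s * c.im) : StarConvex ℝ c (half s) := by
  intro z hz a b ha hb hab
  rcases ha.eq_or_lt with rfl | ha
  · obtain rfl : b = 1 := by linarith
    simpa using hz
  have h : 0 < s * (a • c + b • z).im := by
    have h1 := mul_pos ha hc
    have h2 := mul_nonneg hb hz.1
    simp only [Complex.add_im, Complex.smul_im, smul_eq_mul]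
    linarith
  refine ⟨h.le, fun n hn => ?_⟩
  rw [hn] at h
  simp at h

/-- The trace of a small disc around an integer on a half plane. -/
def halfBall (s : ℝ) (n : ℤ) (δ : ℝ) : Set ℂ := half s ∩ Metric.ball (n : ℂ) δ

lemma exists_starConvex_halfBall {s : ℝ} (hs : s = 1 ∨ s = -1) (n : ℤ) {δ : ℝ} (hδ : 0 < δ) :
    ∃ c ∈ halfBall s n δ, StarConvex ℝ c (halfBall s n δ) := by
  have him : ((n : ℂ) + (s * (δ / 2) : ℝ) * Complex.I).im = s * (δ / 2) := by simp
  have h1 : 0 < s * ((n : ℂ) + (s * (δ / 2) : ℝ) * Complex.I).im := by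
    rw [him]; rcases hs with rfl | rfl <;> linarith
  have h2 : (n : ℂ) + (s * (δ / 2) : ℝ) * Complex.I ∈ Metric.ball (n : ℂ) δ := by
    rw [mem_ball_iff_norm, add_sub_cancel_left, norm_mul, Complex.norm_I, mul_one,
      Complex.norm_real, Real.norm_eq_abs, abs_mul, abs_of_pos (half_pos hδ)]
    rcases hs with rfl | rfl <;> simp [hδ]
  refine ⟨_, ⟨⟨h1.le, fun m hm => ?_⟩, h2⟩,
    (starConvex_half h1).inter ((convex_ball _ _).starConvex h2)⟩
  rw [hm] at h1
  simp at h1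

lemma isPreconnected_half {s : ℝ} (hs : s = 1 ∨ s = -1) : IsPreconnected (half s) := by
  have h1 : 0 < s * ((s : ℂ) * Complex.I).im := by rcases hs with rfl | rfl <;> simp
  have h2 : (s : ℂ) * Complex.I ∈ half s := ⟨h1.le, fun m hm => by rw [hm] at h1; simp at h1⟩
  exact ((starConvex_half h1).isPathConnected h2).isConnected.isPreconnected

lemma isPreconnected_halfBall {s : ℝ} (hs : s = 1 ∨ s = -1) (n : ℤ) {δ : ℝ} (hδ : 0 < δ) :
    IsPreconnected (halfBall s n δ) := by
  obtain ⟨c, hc, h⟩ := exists_starConvex_halfBall hs n hδ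
  exact (h.isPathConnected hc).isConnected.isPreconnected

lemma exists_lift_starConvex {V : Type*} [NormedAddCommGroup V] [NormedSpace ℝ V] {S : Set V} {c :
    V} (hS : StarConvex ℝ c S)
    (hc : c ∈ S) {f : V → ℂ} (hf : ContinuousOn f S) (hne : ∀ y ∈ S, ∀ n : ℤ, f y ≠ n) :
    ∃ v, IsLift f v S := by
  have hm : MapsTo (fun p : ℝ × V => (1 - p.1) • c + p.1 • p.2) (Icc 0 1 ×ˢ S) S :=
    fun p hp => hS hp.2 (by linarith [hp.1.2]) hp.1.1 (by ring)
  have h0 : IsLift (fun y : V => f ((1 - (0:ℝ)) • c + (0:ℝ) • y)) (fun _ => 1) S := by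
    simp only [sub_zero, one_smul, zero_smul, add_zero]
    exact ⟨continuousOn_const, fun _ _ => hne c hc, by simp, by simp⟩
  obtain ⟨W, hW, -⟩ := exists_lift_homotopy (F := fun p : ℝ × V => f ((1 - p.1) • c + p.1 • p.2))
    (hf.comp (by fun_prop) hm) (fun p hp => hne _ (hm hp)) h0
  refine ⟨fun y => W (1, y), (hW.comp (p := fun y : V => ((1 : ℝ), y)) (R := S) (by fun_prop)
    fun y hy => ⟨by simp, hy⟩).congr (fun y _ => ?_) fun _ _ => rfl⟩
  simp

lemma exists_lift_half {s : ℝ} (hs : s = 1 ∨ s = -1) {f : ℂ → ℂ} (hf : Continuous f)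
    (hne : ∀ z : ℂ, (∀ n : ℤ, z ≠ n) → ∀ n : ℤ, f z ≠ n) : ∃ v, IsLift f v (half s) := by
  have h1 : 0 < s * ((s : ℂ) * Complex.I).im := by rcases hs with rfl | rfl <;> simp
  have h2 : (s : ℂ) * Complex.I ∈ half s := ⟨h1.le, fun m hm => by rw [hm] at h1; simp at h1⟩
  exact exists_lift_starConvex (starConvex_half h1) h2 hf.continuousOn fun y hy => hne y hy.2

/-- The lift sends the half disc at `n` to the translate by `g` of the cusp at `n`. -/
def HasCusp (f : ℂ → ℂ) (v : ℂ → FG) (s : ℝ) (n : ℤ) (g : FG) : Prop :=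
  ∃ δ > 0, ∀ z ∈ halfBall s n δ, |(f z).re - n| < 1 ∧ Cusp n g (f z) (v z)

lemma HasCusp.mul_right {f : ℂ → ℂ} {v : ℂ → FG} {s : ℝ} {n : ℤ} {g : FG} (h : HasCusp f v s n g)
    (a : FG) : HasCusp f (fun z => v z * a) s n (g * a) := by
  obtain ⟨δ, hδ, h⟩ := h
  exact ⟨δ, hδ, fun z hz => ⟨(h z hz).1, (h z hz).2.mul_right a⟩⟩

lemma exists_ball_re {f : ℂ → ℂ} (hf : Continuous f) {n : ℤ} (hn : f n = n) :
    ∃ δ > 0, ∀ z ∈ Metric.ball (n : ℂ) δ, |(f z).re - n| < 1 := by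
  have h : ContinuousAt (fun z => |(f z).re - n|) (n : ℂ) := by fun_prop
  have h0 : |(f n).re - n| < 1 := by simp [hn]
  exact Metric.eventually_nhds_iff_ball.1 (h.eventually (gt_mem_nhds h0))

lemma IsLift.hasCusp_of_mem {f : ℂ → ℂ} {v : ℂ → FG} {s : ℝ} (h : IsLift f v (half s))
    (hs : s = 1 ∨ s = -1) {n : ℤ} {δ : ℝ} (hδ : 0 < δ)
    (hb : ∀ z ∈ Metric.ball (n : ℂ) δ, |(f z).re - n| < 1) {g : FG} {z : ℂ}
    (hz : z ∈ halfBall s n δ) (hg : Cusp n g (f z) (v z)) : HasCusp f v s n g :=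
  ⟨δ, hδ, fun w hw => ⟨hb w hw.2, ((h.comp continuousOn_id fun _ hx => hx.1).cusp_iff
    (isPreconnected_halfBall hs n hδ) (fun y hy => hb y hy.2) g hz hw).1 hg⟩⟩

lemma IsLift.exists_hasCusp {f : ℂ → ℂ} {v : ℂ → FG} {s : ℝ} (h : IsLift f v (half s))
    (hs : s = 1 ∨ s = -1) (hf : Continuous f) {n : ℤ} (hn : f n = n) :
    ∃ g, HasCusp f v s n g := by
  obtain ⟨δ, hδ, hb⟩ := exists_ball_re hf hn
  obtain ⟨c, hc, -⟩ := exists_starConvex_halfBall hs n hδ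
  obtain ⟨g, hg⟩ := exists_cusp (hb c hc.2) (h.ne c hc.1) (v c)
  exact ⟨g, h.hasCusp_of_mem hs hδ hb hc hg⟩

lemma exists_real_mem_halfBall {n : ℤ} {δ : ℝ} (hδ : 0 < δ) :
    ∃ r ∈ Ioo (n : ℝ) (n + 1), ∀ s, (r : ℂ) ∈ halfBall s n δ := by
  refine ⟨n + min (δ / 2) (1 / 2), ?_, fun s => ?_⟩
  · have := lt_min (half_pos hδ) (one_half_pos (α := ℝ))
    have := min_le_right (δ / 2) (1 / 2)
    constructor <;> linarith
  · refine ⟨ofReal_mem_half (n := n) ?_ s, ?_⟩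
    · have := lt_min (half_pos hδ) (one_half_pos (α := ℝ))
      have := min_le_right (δ / 2) (1 / 2)
      constructor <;> linarith
    · have := lt_min (half_pos hδ) (one_half_pos (α := ℝ))
      have := min_le_left (δ / 2) (1 / 2)
      rw [mem_ball_iff_norm]
      push_cast
      rw [add_sub_cancel_left, Complex.norm_real, Real.norm_eq_abs, abs_of_pos]
      all_goals linarith

/-- The open interval between two consecutive integers, in the complex plane. -/
def gap (n : ℤ) : Set ℂ := Complex.ofReal '' Ioo (n : ℝ) (n + 1)

lemma isPreconnected_gap (n : ℤ) : IsPreconnected (gap n) :=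
  isPreconnected_Ioo.image _ Complex.continuous_ofReal.continuousOn

lemma gap_subset (n : ℤ) (s : ℝ) : gap n ⊆ half s := by
  rintro _ ⟨r, hr, rfl⟩
  exact ofReal_mem_half hr s

lemma Cusp.sdeg_eq {n : ℤ} {g v : FG} {z : ℂ} (h : Cusp n g z v) (hz : ∀ m : ℤ, z ≠ m) :
    sdeg v = n + sdeg g := by
  rcases mem_Up_or_Um hz with hu | hm
  · obtain ⟨k, rfl⟩ := h.1 hu
    simp
  · obtain ⟨k, hk⟩ := h.2 hm
    rw [← sdeg_cm z, hk]
    simp [sdeg_sm]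

/-- Lifts of a map to the two half planes, normalised at the origin. -/
structure LiftPair (f : ℂ → ℂ) (v : ℝ → ℂ → FG) : Prop where
  lift : ∀ s : ℝ, s = 1 ∨ s = -1 → IsLift f (v s) (half s)
  eq : ∀ z ∈ gap 0, v (-1) z = v 1 z
  cusp : ∀ s : ℝ, s = 1 ∨ s = -1 → HasCusp f (v s) s 0 1

theorem exists_liftPair {f : ℂ → ℂ} (hf : Continuous f) (h0 : f 0 = 0)
    (hne : ∀ z : ℂ, (∀ n : ℤ, z ≠ n) → ∀ n : ℤ, f z ≠ n) : ∃ v, LiftPair f v := by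
  obtain ⟨a, ha⟩ := exists_lift_half (s := 1) (by simp) hf hne
  obtain ⟨b, hb⟩ := exists_lift_half (s := -1) (by simp) hf hne
  obtain ⟨g, hg⟩ := ha.exists_hasCusp (by simp) hf (n := 0) (by simpa using h0)
  obtain ⟨y, hy⟩ := (ha.comp continuousOn_id (gap_subset 0 1)).exists_mul_right
    (hb.comp continuousOn_id (gap_subset 0 (-1))) (isPreconnected_gap 0)
  simp only [id] at hy
  have hb' := hb.mul_right (y⁻¹ * g⁻¹)
  have heq : ∀ z ∈ gap 0, b z * (y⁻¹ * g⁻¹) = a z * g⁻¹ := by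
    intro z hz
    rw [hy z hz, mul_assoc, mul_inv_cancel_left]
  have hg1 := hg.mul_right g⁻¹
  rw [mul_inv_cancel] at hg1
  refine ⟨fun s => if s = 1 then fun z => a z * g⁻¹ else fun z => b z * (y⁻¹ * g⁻¹), ?_, ?_, ?_⟩
  · rintro s (rfl | rfl)
    · simpa using ha.mul_right g⁻¹
    · rw [if_neg (by norm_num)]
      exact hb'
  · intro z hz
    rw [if_neg (by norm_num), if_pos rfl, heq z hz]
  · rintro s (rfl | rfl)
    · simpa using hg1
    · rw [if_neg (by norm_num)]
      obtain ⟨δ, hδ, hc⟩ := hg1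
      obtain ⟨δ', hδ', hball⟩ := exists_ball_re hf (n := 0) (by simpa using h0)
      obtain ⟨r, hr, hrm⟩ := exists_real_mem_halfBall (n := 0) (lt_min hδ hδ')
      have hr1 : (r : ℂ) ∈ halfBall 1 0 δ :=
        ⟨(hrm 1).1, Metric.ball_subset_ball (min_le_left _ _) (hrm 1).2⟩
      have hr2 : (r : ℂ) ∈ halfBall (-1) 0 δ' :=
        ⟨(hrm (-1)).1, Metric.ball_subset_ball (min_le_right _ _) (hrm (-1)).2⟩
      refine hb'.hasCusp_of_mem (by simp) hδ' hball hr2 ?_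
      rw [heq _ ⟨r, hr, rfl⟩]
      exact (hc _ hr1).2

lemma HasCusp.exists_mem {f : ℂ → ℂ} {v : ℂ → FG} {s : ℝ} {n : ℤ} {g : FG}
    (h : HasCusp f v s n g) (hs : s = 1 ∨ s = -1) : ∃ z ∈ half s, Cusp n g (f z) (v z) := by
  obtain ⟨δ, hδ, h⟩ := h
  obtain ⟨c, hc, -⟩ := exists_starConvex_halfBall hs n hδ
  exact ⟨c, hc.1, (h c hc).2⟩

lemma LiftPair.sdeg_eq_zero {f : ℂ → ℂ} {v : ℝ → ℂ → FG} (h : LiftPair f v) {s : ℝ}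
    (hs : s = 1 ∨ s = -1) {z : ℂ} (hz : z ∈ half s) : sdeg (v s z) = 0 := by
  obtain ⟨c, hc, hc'⟩ := (h.cusp s hs).exists_mem hs
  rw [(h.lift s hs).sdeg_eq (isPreconnected_half hs) hz hc,
    hc'.sdeg_eq ((h.lift s hs).ne c hc)]
  simp

/-- A homotopy relative to the integers, in the complement of the integers, from `f` to the
conjugate of `f` by the unit translation. -/
structure IsShiftHomotopy (f : ℂ → ℂ) (K : ℝ × ℂ → ℂ) : Prop where
  cont : Continuous K
  zero : ∀ z, K (0, z) = f z
  one : ∀ z, K (1, z) + 1 = f (z + 1)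
  int : ∀ u, ∀ n : ℤ, K (u, n) = n
  ne : ∀ u, ∀ z : ℂ, (∀ n : ℤ, z ≠ n) → ∀ n : ℤ, K (u, z) ≠ n

lemma IsShiftHomotopy.apply_int {f : ℂ → ℂ} {K : ℝ × ℂ → ℂ} (hK : IsShiftHomotopy f K) (n : ℤ) :
    f n = n := by
  rw [← hK.zero, hK.int]

lemma IsShiftHomotopy.apply_ne {f : ℂ → ℂ} {K : ℝ × ℂ → ℂ} (hK : IsShiftHomotopy f K) (z : ℂ)
    (hz : ∀ n : ℤ, z ≠ n) (n : ℤ) : f z ≠ n := by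
  rw [← hK.zero]
  exact hK.ne 0 z hz n

lemma exists_neg_real_mem_halfBall {δ : ℝ} (hδ : 0 < δ) :
    ∃ z ∈ gap (-1), ∀ s, z ∈ halfBall s 0 δ := by
  have h1 := lt_min (half_pos hδ) (one_half_pos (α := ℝ))
  have h2 := min_le_right (δ / 2) (1 / 2)
  have h3 := min_le_left (δ / 2) (1 / 2)
  have h : ((-min (δ / 2) (1 / 2) : ℝ) : ℂ) ∈ gap (-1) :=
    ⟨_, ⟨by push_cast; linarith, by push_cast; linarith⟩, rfl⟩
  refine ⟨_, h, fun s => ⟨gap_subset _ s h, ?_⟩⟩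
  rw [mem_ball_iff_norm, Int.cast_zero, sub_zero, Complex.norm_real, Real.norm_eq_abs, abs_neg,
    abs_of_pos h1]
  linarith

lemma Cusp.inv_mul_eq {n : ℤ} {z : ℂ} {v w g : FG} (hz : ∀ m : ℤ, z ≠ m) (hv : Cusp n g z v)
    (hw : Cusp n g z w) : ∃ j : ℤ, v⁻¹ * w = g⁻¹ * xgen ^ j * g := by
  rcases mem_Up_or_Um hz with hu | hm
  · obtain ⟨a, rfl⟩ := hv.1 hu
    obtain ⟨b, rfl⟩ := hw.1 hu
    exact ⟨-a + b, by rw [zpow_add, zpow_neg]; group⟩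
  · obtain ⟨a, ha⟩ := hv.2 hm
    obtain ⟨b, hb⟩ := hw.2 hm
    rw [← cm_inv_mul_cm z, ha, hb]
    exact ⟨-a + b, by rw [zpow_add, zpow_neg]; group⟩

section

variable {f : ℂ → ℂ} {v : ℝ → ℂ → FG} {τ : ℂ → ℂ → ℝ}

lemma LiftPair.exists_Ang_eq (h : LiftPair f v) (hτ : IsTurn f τ) (h0 : f 0 = 0) {s : ℝ}
    (hs : s = 1 ∨ s = -1) {a : ℂ → ℝ} (ha : ContinuousOn a (half s))
    (ha' : ∀ z ∈ half s, IsArg (a z) z) :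
    ∃ k : ℤ, ∀ z ∈ half s, Ang 0 (f z) (v s z) = a z + τ 0 z + 2 * Real.pi * k := by
  have hne : ∀ z ∈ half s, (0 : ℂ) ≠ z := fun z hz e => hz.2 0 (by rw [← e]; simp)
  have hτc : ContinuousOn (fun z => τ 0 z) (half s) :=
    hτ.continuousOn_comp continuousOn_const continuousOn_id hne
  refine IsArg.exists_int_of_preconnected (isPreconnected_half hs) (ha.add hτc)
    ((h.lift s hs).continuousOn_Ang 0) (v := f) (fun z hz => ?_) (fun z hz => ?_) (fun z hz => ?_)
  · have := hτ.add_arg (hne z hz) (a := a z) (by rw [sub_zero]; exact ha' z hz)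
    simpa [h0] using this
  · simpa using isArg_Ang 0 (f z) (v s z)
  · simpa using (h.lift s hs).ne z hz 0

lemma LiftPair.eq_gap_neg_one (h : LiftPair f v) (hτ : IsTurn f τ) (h0 : f 0 = 0) {g : FG}
    (hg : ∀ z ∈ gap (-1), v (-1) z = v 1 z * g) : g = xgen⁻¹ := by
  have hs : (1 : ℝ) = 1 ∨ (1 : ℝ) = -1 := Or.inl rfl
  have hs' : (-1 : ℝ) = 1 ∨ (-1 : ℝ) = -1 := Or.inr rfl
  have re0 : ∀ z : ℂ, z.re = 0 → ∃ n : ℤ, z.re = n := fun z hz => ⟨0, by simpa using hz⟩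
  obtain ⟨k, hk⟩ := h.exists_Ang_eq hτ h0 hs
    (fun z hz => (continuousAt_argp fun e =>
      half_one_subset hz (re0 z e)).continuousWithinAt) fun z _ => isArg_argp z
  obtain ⟨l, hl⟩ := h.exists_Ang_eq hτ h0 hs'
    (fun z hz => (continuousAt_argm fun e =>
      half_neg_one_subset hz (re0 z e)).continuousWithinAt) fun z _ => isArg_argm z
  have hkl : 2 * Real.pi * (k : ℝ) = 2 * Real.pi * l := by
    have hz : ((1 / 2 : ℝ) : ℂ) ∈ gap 0 := ⟨_, ⟨by norm_num, by norm_num⟩, rfl⟩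
    have h1 := hk _ (gap_subset 0 1 hz)
    have h2 := hl _ (gap_subset 0 (-1) hz)
    have hre : ((1 / 2 : ℝ) : ℂ).re = 1 / 2 := Complex.ofReal_re _
    rw [h.eq _ hz, h1, argp_eq_argm (by rw [hre]; norm_num), hre, if_neg (by norm_num)] at h2
    simp only [Int.cast_zero, mul_zero, add_zero] at h2
    linarith
  obtain ⟨δ, hδ, hc⟩ := h.cusp 1 hs
  obtain ⟨δ', hδ', hc'⟩ := h.cusp (-1) hs'
  obtain ⟨z, hz, hzb⟩ := exists_neg_real_mem_halfBall (lt_min hδ hδ')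
  have c1 := (hc z ⟨(hzb 1).1, Metric.ball_subset_ball (min_le_left _ _) (hzb 1).2⟩).2
  have c2 := (hc' z ⟨(hzb (-1)).1, Metric.ball_subset_ball (min_le_right _ _) (hzb (-1)).2⟩).2
  obtain ⟨j, hj⟩ := c1.inv_mul_eq ((h.lift 1 hs).ne z (hzb 1).1) c2
  rw [hg z hz, inv_mul_cancel_left] at hj
  have h1 := hk z (hzb 1).1
  have h2 := hl z (hzb (-1)).1
  have hre : z.re < 0 := by
    obtain ⟨r, hr, rfl⟩ := hz
    simpa using hr.2
  rw [argp_eq_argm hre.ne, if_pos hre] at h1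
  rw [hg z hz, Ang_mul, h.sdeg_eq_zero hs (hzb 1).1, h1, hj] at h2
  simp only [sub_zero, inv_one, one_mul, mul_one, wcoef_xgen_zpow, if_pos] at h2
  have h3 : 2 * Real.pi * ((j + 1 : ℤ) : ℝ) = 2 * Real.pi * ((0 : ℤ) : ℝ) := by push_cast at h2 ⊢; linarith
  have h4 := eq_zero_of_two_pi_mul h3
  rw [hj, show j = -1 by lia]
  simp

end

section

variable {f : ℂ → ℂ} {v : ℝ → ℂ → FG} {K : ℝ × ℂ → ℂ}

lemma sub_one_mem_half {s : ℝ} {z : ℂ} (hz : z ∈ half s) : z - 1 ∈ half s :=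
  ⟨by simpa using hz.1, fun n hn => hz.2 (n + 1) (by push_cast; rw [← hn]; ring)⟩

lemma sub_one_mem_gap {n : ℤ} {z : ℂ} (hz : z ∈ gap (n + 1)) : z - 1 ∈ gap n := by
  obtain ⟨r, hr, rfl⟩ := hz
  push_cast at hr
  exact ⟨r - 1, ⟨by linarith [hr.1], by linarith [hr.2]⟩, by simp⟩

lemma gap_nonempty (n : ℤ) : (gap n).Nonempty :=
  ⟨_, n + 1 / 2, ⟨by linarith, by linarith⟩, rfl⟩

lemma shiftv_mul (z : ℂ) (v g : FG) : shiftv z (v * g) = shiftv z v * g := by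
  unfold shiftv; split_ifs <;> rw [mul_assoc]

lemma sdeg_shiftv (z : ℂ) (v : FG) : sdeg (shiftv z v) = 1 + sdeg v := by
  unfold shiftv; split_ifs <;> simp [sdeg_sm]

lemma Cusp.shiftv {n : ℤ} {g v : FG} {z : ℂ} (h : Cusp n g z v) :
    Cusp (n + 1) g (z + 1) (shiftv z v) := by
  refine ⟨fun hu => ?_, fun hm => ?_⟩
  · rw [add_one_mem_Up] at hu
    refine (h.1 hu).imp fun k hk => ?_
    rw [BrouwerIndex.shiftv, if_pos hu, hk, add_comm, zpow_one_add]
    simp only [mul_assoc]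
  · rw [add_one_mem_Um] at hm
    refine (h.2 hm).imp fun k hk => ?_
    rw [cm_shiftv, hk, add_comm, zpow_one_add]
    simp only [mul_assoc]

/-- The lift `V` of the homotopy `K` starts at `v` and ends at the translate of `v` by `c`. -/
structure IsShiftLift (f : ℂ → ℂ) (K : ℝ × ℂ → ℂ) (v : ℂ → FG) (s : ℝ) (V : ℝ × ℂ → FG) (c : FG) :
    Prop where
  lift : IsLift K V (Icc 0 1 ×ˢ half s)
  zero : ∀ z ∈ half s, V (0, z) = v z
  one : ∀ z ∈ half s, shiftv (K (1, z - 1)) (V (1, z - 1)) = v z * c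

lemma LiftPair.exists_isShiftLift (h : LiftPair f v) (hK : IsShiftHomotopy f K) {s : ℝ}
    (hs : s = 1 ∨ s = -1) : ∃ V c, IsShiftLift f K (v s) s V c := by
  obtain ⟨V, hV, hV0⟩ := exists_lift_homotopy (F := K) (S := half s) hK.cont.continuousOn
    (fun p hp => hK.ne p.1 p.2 hp.2.2)
    ((h.lift s hs).congr (fun z _ => hK.zero z) fun _ _ => rfl)
  have h1 : IsLift f (fun z => shiftv (K (1, z - 1)) (V (1, z - 1))) (half s) := by
    refine (hV.comp (p := fun z : ℂ => ((1 : ℝ), z - 1)) (R := half s) (by fun_prop)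
      fun z hz => ⟨by simp, sub_one_mem_half hz⟩).shift.congr (fun z _ => ?_) fun _ _ => rfl
    simp only [hK.one, sub_add_cancel]
  obtain ⟨c, hc⟩ := (h.lift s hs).exists_mul_right h1 (isPreconnected_half hs)
  exact ⟨V, c, hV, hV0, hc⟩

lemma LiftPair.sdeg_shift (h : LiftPair f v) {s : ℝ} (hs : s = 1 ∨ s = -1) {V : ℝ × ℂ → FG} {c : FG}
    (hV : IsShiftLift f K (v s) s V c) : sdeg c = 1 := by
  obtain ⟨z, hz⟩ := (gap_nonempty 0).mono (gap_subset 0 s)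
  have hz' := sub_one_mem_half hz
  have h1 := congrArg sdeg (hV.one z hz)
  rw [sdeg_shiftv, sdeg_mul, h.sdeg_eq_zero hs hz,
    hV.lift.sdeg_eq (y := (0, z - 1)) (isPreconnected_Icc.prod (isPreconnected_half hs))
      ⟨by simp, hz'⟩ ⟨by simp, hz'⟩, hV.zero _ hz', h.sdeg_eq_zero hs hz'] at h1
  simpa using h1.symm

lemma IsShiftLift.gap_add_one {V W : ℝ × ℂ → FG} {c d : FG} (hV : IsShiftLift f K (v 1) 1 V c)
    (hW : IsShiftLift f K (v (-1)) (-1) W d) {n : ℤ} {g g' : FG}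
    (hg : ∀ z ∈ gap n, v (-1) z = v 1 z * g) (hg' : ∀ z ∈ gap (n + 1), v (-1) z = v 1 z * g') :
    g' = c * g * d⁻¹ := by
  obtain ⟨a, ha⟩ := (hV.lift.comp (p := id) (R := Icc 0 1 ×ˢ gap n) continuousOn_id
    fun p hp => ⟨hp.1, gap_subset n 1 hp.2⟩).exists_mul_right (hW.lift.comp (p := id)
    (R := Icc 0 1 ×ˢ gap n) continuousOn_id fun p hp => ⟨hp.1, gap_subset n (-1) hp.2⟩)
    (isPreconnected_Icc.prod (isPreconnected_gap n))
  obtain ⟨z, hz⟩ := gap_nonempty (n + 1)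
  have hz' := sub_one_mem_gap hz
  have h1 := ha (0, z - 1) ⟨by simp, hz'⟩
  have h2 := ha (1, z - 1) ⟨by simp, hz'⟩
  simp only [id] at h1 h2
  rw [hV.zero _ (gap_subset n 1 hz'), hW.zero _ (gap_subset n (-1) hz'), hg _ hz',
    mul_right_inj] at h1
  have h3 := hW.one z (gap_subset _ _ hz)
  rw [h2, shiftv_mul, hV.one z (gap_subset _ _ hz), ← h1, hg' z hz, mul_assoc, mul_assoc,
    mul_right_inj] at h3
  rw [h3, mul_inv_cancel_right]

lemma exists_ball_re_homotopy (hK : IsShiftHomotopy f K) :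
    ∃ δ > 0, ∀ u ∈ Icc (0 : ℝ) 1, ∀ z ∈ Metric.ball (0 : ℂ) δ, |(K (u, z)).re| < 1 := by
  have ho : IsOpen {p : ℝ × ℂ | |(K p).re| < 1} :=
    isOpen_lt (by have := hK.cont; fun_prop) continuous_const
  obtain ⟨A, B, -, hB, hA, h0, hAB⟩ := generalized_tube_lemma (s := Icc (0 : ℝ) 1)
    isCompact_Icc (t := {(0 : ℂ)}) isCompact_singleton ho (by
      rintro ⟨u, z⟩ ⟨-, rfl⟩
      have := hK.int u 0
      simp only [Int.cast_zero] at this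
      simp [this])
  obtain ⟨δ, hδ, hb⟩ := Metric.isOpen_iff.1 hB 0 (h0 rfl)
  exact ⟨δ, hδ, fun u hu z hz => hAB (mk_mem_prod (hA hu) (hb hz))⟩

lemma LiftPair.hasCusp_one (h : LiftPair f v) (hK : IsShiftHomotopy f K) {s : ℝ}
    (hs : s = 1 ∨ s = -1) {V : ℝ × ℂ → FG} {c : FG} (hV : IsShiftLift f K (v s) s V c) :
    HasCusp f (v s) s 1 c⁻¹ := by
  obtain ⟨δ₁, hδ₁, h1⟩ := exists_ball_re_homotopy hK
  obtain ⟨δ₂, hδ₂, h2⟩ := h.cusp s hs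
  have hδ := lt_min hδ₁ hδ₂
  refine ⟨min δ₁ δ₂, hδ, fun z hz => ?_⟩
  have hz' : z - 1 ∈ halfBall s 0 (min δ₁ δ₂) := by
    refine ⟨sub_one_mem_half hz.1, ?_⟩
    have := hz.2
    rw [mem_ball_iff_norm] at this ⊢
    simpa using this
  have hb : ∀ p ∈ Icc (0 : ℝ) 1 ×ˢ halfBall s 0 (min δ₁ δ₂), |(K p).re - (0 : ℤ)| < 1 := by
    rintro ⟨u, w⟩ ⟨hu, hw⟩
    rw [Int.cast_zero, sub_zero]
    refine h1 u hu w (Metric.ball_subset_ball (min_le_left δ₁ δ₂) ?_)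
    simpa using hw.2
  have hf : f z = K (1, z - 1) + 1 := by rw [hK.one, sub_add_cancel]
  have hc0 : Cusp 0 1 (K (0, z - 1)) (V (0, z - 1)) := by
    rw [hK.zero, hV.zero _ hz'.1]
    exact (h2 _ ⟨hz'.1, Metric.ball_subset_ball (min_le_right _ _) hz'.2⟩).2
  have hc1 : Cusp 0 1 (K (1, z - 1)) (V (1, z - 1)) :=
    ((hV.lift.comp (p := id) continuousOn_id fun p hp => ⟨hp.1, hp.2.1⟩).cusp_iff
      (isPreconnected_Icc.prod (isPreconnected_halfBall hs 0 hδ)) hb 1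
      (x := (0, z - 1)) (y := (1, z - 1)) ⟨by simp, hz'⟩ ⟨by simp, hz'⟩).1 hc0
  constructor
  · have := hb (1, z - 1) ⟨by simp, hz'⟩
    rw [hf]
    simpa using this
  · have := hc1.shiftv.mul_right c⁻¹
    rw [hV.one z hz.1, mul_inv_cancel_right, ← hf] at this
    simpa using this

end

lemma mem_half_inter_half {z : ℂ} (h1 : z ∈ half 1) (h2 : z ∈ half (-1)) : z ∈ gap ⌊z.re⌋ := by
  have him : z.im = 0 := by have := h1.1; have := h2.1; linarith
  have hz : z = (z.re : ℂ) := Complex.ext (by simp) (by simpa using him)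
  refine ⟨z.re, ⟨lt_of_le_of_ne (Int.floor_le _) fun e => h1.2 ⌊z.re⌋ ?_, Int.lt_floor_add_one _⟩,
    hz.symm⟩
  exact hz.trans (by exact_mod_cast e.symm)

lemma mem_half_or_mem_half {z : ℂ} (hz : ∀ n : ℤ, z ≠ n) : z ∈ half 1 ∨ z ∈ half (-1) := by
  rcases le_total 0 z.im with h | h
  · exact Or.inl ⟨by linarith, hz⟩
  · exact Or.inr ⟨by linarith, hz⟩

lemma eventually_mem_half {z : ℂ} (s : ℝ) (hz : ∀ n : ℤ, z ≠ n) (h : z ∉ half s) :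
    ∀ᶠ w in 𝓝 z, w ∉ half s := by
  have h1 : s * z.im < 0 := not_le.1 fun h' => h ⟨h', hz⟩
  have h2 : ContinuousAt (fun w : ℂ => s * w.im) z := by fun_prop
  filter_upwards [h2.eventually (gt_mem_nhds h1)] with w hw hw'
  exact hw.not_ge hw'.1

lemma ofReal_mem_Up {r : ℝ} (hr : r ∈ Ioo (0 : ℝ) 1) : (r : ℂ) ∈ Up :=
  half_one_subset (ofReal_mem_half (n := 0) (by simpa using hr) 1)

/-- Preimages of the open unit interval are transported into the range of an endomorphism which
intertwines the coordinates of a pair of lifts. -/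
lemma LiftPair.exists_apply_eq_sgen {Ψ : ℂ ≃ₜ ℂ} {v : ℝ → ℂ → FG} (h : LiftPair Ψ v)
    (h_int : ∀ n : ℤ, Ψ n = n) {θ : FG →* FG} (hx : θ xgen = xgen)
    (hy : ∀ n : ℤ, ∀ z ∈ gap n, v (-1) z = v 1 z * θ (yy n))
    (hp : HasCusp Ψ (v 1) 1 1 (θ sgen)⁻¹) (hm : HasCusp Ψ (v (-1)) (-1) 1 (θ sm)⁻¹) :
    ∃ g, θ g = sgen := by
  classical
  have hsymm : ∀ n : ℤ, Ψ.symm n = n := fun n => by rw [Ψ.symm_apply_eq, h_int]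
  let p : ℝ → ℂ := fun r => Ψ.symm (r : ℂ)
  have hne : ∀ r ∈ Ioo (0 : ℝ) 1, ∀ n : ℤ, p r ≠ n := by
    intro r hr n e
    simp only [p] at e
    rw [Ψ.symm_apply_eq, h_int] at e
    exact (ofReal_mem_half (n := 0) (by simpa using hr) 1).2 n e
  have hcont : Continuous p :=
    Ψ.symm.continuous.comp Complex.continuous_ofReal
  obtain ⟨w, hw⟩ := exists_lift_starConvex (c := (1 / 2 : ℝ)) (S := Ioo (0 : ℝ) 1)
    ((convex_Ioo _ _).starConvex (by norm_num)) (by norm_num) hcont.continuousOn hne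
  have hΨp : ∀ r, Ψ (p r) = r := fun r => Ψ.apply_symm_apply _
  let e₁ : ℝ → FG := fun r => v 1 (p r) * θ (w r)
  let e₂ : ℝ → FG := fun r => v (-1) (p r) * θ (cm (p r) (w r))
  have h12 : ∀ r, p r ∈ half 1 → p r ∈ half (-1) → e₂ r = e₁ r := by
    intro r h1 h2
    simp only [e₁, e₂]
    conv_rhs => rw [cm_of_mem (half_one_subset h1) (w r)]
    rw [hy _ _ (mem_half_inter_half h1 h2), map_mul, mul_assoc]
  have hUp : ∀ r ∈ Ioo (0 : ℝ) 1, Ψ (p r) ∈ Up := fun r hr => by rw [hΨp]; exact ofReal_mem_Up hr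
  have hloc : ∀ s, s = 1 ∨ s = -1 → ∀ r ∈ Ioo (0 : ℝ) 1, p r ∈ half s →
      ∀ᶠ r' in 𝓝[Ioo 0 1] r, p r' ∈ half s → v s (p r') = v s (p r) := by
    intro s hs r hr hrs
    have := (h.lift s hs).up _ hrs (hUp r hr)
    rw [eventually_nhdsWithin_iff] at this
    exact eventually_nhdsWithin_of_eventually_nhds (hcont.continuousAt.eventually this)
  have hloc₁ : ∀ r ∈ Ioo (0 : ℝ) 1, p r ∈ half 1 →
      ∀ᶠ r' in 𝓝[Ioo 0 1] r, p r' ∈ half 1 → e₁ r' = e₁ r := by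
    intro r hr hr1
    filter_upwards [hloc 1 (Or.inl rfl) r hr hr1, hw.up r hr (half_one_subset hr1)] with r' h1 h2 h3
    simp only [e₁]
    rw [h1 h3, h2]
  have hloc₂ : ∀ r ∈ Ioo (0 : ℝ) 1, p r ∈ half (-1) →
      ∀ᶠ r' in 𝓝[Ioo 0 1] r, p r' ∈ half (-1) → e₂ r' = e₂ r := by
    intro r hr hr1
    filter_upwards [hloc (-1) (Or.inr rfl) r hr hr1, hw.um r hr (half_neg_one_subset hr1)]
      with r' h1 h2 h3
    simp only [e₂]
    rw [h1 h3, h2]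
  have hfar : ∀ s, ∀ r ∈ Ioo (0 : ℝ) 1, p r ∉ half s → ∀ᶠ r' in 𝓝[Ioo 0 1] r, p r' ∉ half s :=
    fun s r hr hrs => eventually_nhdsWithin_of_eventually_nhds
      (hcont.continuousAt.eventually (eventually_mem_half s (hne r hr) hrs))
  let e : ℝ → FG := fun r => if p r ∈ half 1 then e₁ r else e₂ r
  have hconst : ∀ r ∈ Ioo (0 : ℝ) 1, ∀ r' ∈ Ioo (0 : ℝ) 1, e r = e r' := by
    refine fun r hr r' hr' => eq_of_eventually isPreconnected_Ioo (fun r hr => ?_) hr hr'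
    by_cases h1 : p r ∈ half 1
    · by_cases h2 : p r ∈ half (-1)
      · filter_upwards [hloc₁ r hr h1, hloc₂ r hr h2, self_mem_nhdsWithin] with r' a b hr'
        simp only [e, if_pos h1]
        split_ifs with h3
        · exact a h3
        · rw [b ((mem_half_or_mem_half (hne r' hr')).resolve_left h3), h12 r h1 h2]
      · filter_upwards [hloc₁ r hr h1, hfar _ r hr h2, self_mem_nhdsWithin] with r' a b hr'
        have h3 := (mem_half_or_mem_half (hne r' hr')).resolve_right b
        simp only [e, if_pos h1, if_pos h3]
        exact a h3
    · have h2 := (mem_half_or_mem_half (hne r hr)).resolve_left h1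
      filter_upwards [hloc₂ r hr h2, hfar _ r hr h1, self_mem_nhdsWithin] with r' a b hr'
      simp only [e, if_neg h1, if_neg b]
      exact a ((mem_half_or_mem_half (hne r' hr')).resolve_left b)
  have hnear : ∀ n : ℤ, ∀ δ > 0, ∀ᶠ r in 𝓝 (n : ℝ), p r ∈ Metric.ball (n : ℂ) δ := by
    intro n δ hδ
    have h1 : p n = n := by simp only [p, Complex.ofReal_intCast, hsymm]
    rw [← h1]
    exact hcont.continuousAt (x := (n : ℝ)) (Metric.ball_mem_nhds _ hδ)
  have hkey : ∀ n : ℤ, ∀ a b : FG, HasCusp Ψ (v 1) 1 n a → HasCusp Ψ (v (-1)) (-1) n b →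
      ∀ᶠ r in 𝓝 (n : ℝ), r ∈ Ioo (0 : ℝ) 1 →
        ∃ k : ℤ, ∃ g, e r = sgen ^ n * xgen ^ k * a * θ g ∨ e r = sgen ^ n * xgen ^ k * b * θ g :=
          by
    rintro n a b ⟨δ, hδ, ha⟩ ⟨δ', hδ', hb⟩
    filter_upwards [hnear n δ hδ, hnear n δ' hδ'] with r h1 h2 hr
    by_cases h3 : p r ∈ half 1
    · obtain ⟨k, hk⟩ := (ha _ ⟨h3, h1⟩).2.1 (hUp r hr)
      exact ⟨k, w r, Or.inl (by simp only [e, if_pos h3, e₁, hk])⟩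
    · have h4 := (mem_half_or_mem_half (hne r hr)).resolve_left h3
      obtain ⟨k, hk⟩ := (hb _ ⟨h4, h2⟩).2.1 (hUp r hr)
      exact ⟨k, cm (p r) (w r), Or.inr (by simp only [e, if_neg h3, e₂, hk])⟩
  have h0 := hkey 0 1 1 (h.cusp 1 (Or.inl rfl)) (h.cusp (-1) (Or.inr rfl))
  have h1 := hkey 1 _ _ hp hm
  rw [Int.cast_zero] at h0
  rw [Int.cast_one] at h1
  obtain ⟨r, hr, hr1⟩ := ((h0.filter_mono nhdsWithin_le_nhds).and
    (Ioo_mem_nhdsGT (zero_lt_one (α := ℝ)))).exists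
  obtain ⟨r', hr', hr1'⟩ := ((h1.filter_mono nhdsWithin_le_nhds).and
    (Ioo_mem_nhdsLT (zero_lt_one (α := ℝ)))).exists
  have hxk : ∀ k : ℤ, xgen ^ k = θ (xgen ^ k) := fun k => by rw [map_zpow, hx]
  have hr0 : e r ∈ θ.range := by
    obtain ⟨k, g, hg | hg⟩ := hr hr1 <;> rw [hg, hxk] <;> exact ⟨xgen ^ k * g, by simp⟩
  obtain ⟨k, g, hg⟩ := hr' hr1'
  rw [hconst r hr1 r' hr1'] at hr0
  have : ∃ a ∈ θ.range, e r' = sgen * a := by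
    rcases hg with hg | hg
    · exact ⟨θ (xgen ^ k * sgen⁻¹ * g), ⟨_, rfl⟩, by simp [hg, hx, mul_assoc]⟩
    · exact ⟨θ (xgen ^ k * sm⁻¹ * g), ⟨_, rfl⟩, by simp [hg, hx, mul_assoc]⟩
  obtain ⟨a, ha, hea⟩ := this
  have := θ.range.mul_mem hr0 (θ.range.inv_mem ha)
  rwa [hea, mul_inv_cancel_right] at this

/-- The rotation of a pair of lifts along the open unit interval. -/
lemma LiftPair.turn_eq {Ψ : ℂ ≃ₜ ℂ} {v : ℝ → ℂ → FG} {τ : ℂ → ℂ → ℝ} (h : LiftPair Ψ v)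
    (hτ : IsTurn Ψ τ) (h_int : ∀ n : ℤ, Ψ n = n) {c : FG} (hp : HasCusp Ψ (v 1) 1 1 c⁻¹)
    (hc : sdeg c = 1) {m : ℤ} (hm : wcoef m c = 0) (h0 : m ≠ 0) (h1 : m ≠ 1) :
    τ 0 m = τ 1 m := by
  have hs : (1 : ℝ) = 1 ∨ (1 : ℝ) = -1 := Or.inl rfl
  set q : ℝ := if 0 < m then Real.pi else 0 with hq
  have hmem : ∀ r ∈ Ioo (0 : ℝ) 1, (r : ℂ) ∈ half 1 := fun r hr =>
    ofReal_mem_half (n := 0) (by simpa using hr) 1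
  have hrm : ∀ r ∈ Ioo (0 : ℝ) 1, (r : ℂ) ≠ m := fun r hr => (hmem r hr).2 m
  have hqarg : ∀ r ∈ Ioo (0 : ℝ) 1, IsArg q ((r : ℂ) - m) := by
    intro r hr
    have e : (r : ℂ) - m = ((r - m : ℝ) : ℂ) := by push_cast; rfl
    rw [e, hq]
    split_ifs with hm0
    · have : (2 : ℝ) ≤ m := by exact_mod_cast (by lia : (2 : ℤ) ≤ m)
      have h2 : IsArg 0 ((m - r : ℝ) : ℂ) := IsArg.of_nonneg (by linarith [hr.2])
      have := h2.neg
      rw [zero_add] at this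
      convert this using 1
      push_cast; ring
    · have : (m : ℝ) ≤ -1 := by exact_mod_cast (by lia : m ≤ (-1 : ℤ))
      exact IsArg.of_nonneg (by linarith [hr.1])
  obtain ⟨k, hk⟩ := IsArg.exists_int_of_preconnected (isPreconnected_Ioo (a := (0 : ℝ)) (b := 1))
    (a := fun r => Ang m (Ψ r) (v 1 r) - q) (b := fun r => τ r m)
    (v := fun r : ℝ => (Ψ m - Ψ r) / (m - r))
    ((((h.lift 1 hs).continuousOn_Ang m).comp Complex.continuous_ofReal.continuousOn hmem).sub
      continuousOn_const)
    (hτ.continuousOn_comp Complex.continuous_ofReal.continuousOn continuousOn_const hrm)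
    (fun r hr => by
      have := (isArg_Ang m (Ψ r) (v 1 r)).div (hqarg r hr)
      rw [← neg_div_neg_eq, neg_sub, neg_sub] at this
      rwa [h_int])
    (fun r hr => hτ.isArg _ _ (hrm r hr))
    (fun r hr => div_ne_zero (sub_ne_zero.2 (Ψ.injective.ne (hrm r hr).symm))
      (sub_ne_zero.2 (hrm r hr).symm))
  have key : ∀ n : ℤ, n = 0 ∨ n = 1 → ∀ g, HasCusp Ψ (v 1) 1 n g → wcoef (m - n) g = 0 →
      τ n m = 2 * Real.pi * k := by
    rintro n hn g ⟨δ, hδ, hg⟩ hw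
    have hmn : m ≠ n := by rcases hn with rfl | rfl <;> assumption
    have hnm : ((n : ℝ) : ℂ) ≠ m := by exact_mod_cast hmn.symm
    have hbot : (𝓝[Ioo 0 1] (n : ℝ)).NeBot := by
      rw [← mem_closure_iff_nhdsWithin_neBot, closure_Ioo zero_ne_one]
      rcases hn with rfl | rfl <;> simp
    have hcont : Tendsto (fun r : ℝ => τ r m) (𝓝[Ioo 0 1] (n : ℝ)) (𝓝 (τ n m)) := by
      have h2 : ContinuousOn (fun r : ℝ => τ r m) {r : ℝ | (r : ℂ) ≠ m} :=
        hτ.continuousOn_comp Complex.continuous_ofReal.continuousOn continuousOn_const fun r hr => hr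
      have h3 : IsOpen {r : ℝ | (r : ℂ) ≠ m} :=
        isOpen_ne_fun Complex.continuous_ofReal continuous_const
      have h4 := (h2.continuousAt (h3.mem_nhds hnm)).tendsto
      rw [Complex.ofReal_intCast] at h4
      exact h4.mono_left nhdsWithin_le_nhds
    have hball : ∀ᶠ r : ℝ in 𝓝[Ioo 0 1] (n : ℝ), (r : ℂ) ∈ Metric.ball (n : ℂ) δ := by
      have := Complex.continuous_ofReal.continuousAt (x := (n : ℝ)) (Metric.ball_mem_nhds _ hδ)
      rw [Complex.ofReal_intCast] at this
      exact nhdsWithin_le_nhds this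
    have hle : |τ n m - 2 * Real.pi * k| ≤ Real.pi / 2 := by
      refine le_of_tendsto ((hcont.sub_const _).abs) ?_
      filter_upwards [hball, self_mem_nhdsWithin] with r hrb hr
      obtain ⟨h2, h3⟩ := hg r ⟨hmem r hr, hrb⟩
      have h4 := h3.abs_Ang_lt h2 ((h.lift 1 hs).ne _ (hmem r hr)) hmn
      have h5 : (if n < m then Real.pi else 0) = q := by
        rw [hq]
        congr 1
        rcases hn with rfl | rfl
        · rfl
        · exact propext ⟨fun h => by lia, fun h => by lia⟩
      rw [hw, h5] at h4
      rw [hk r hr]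
      refine le_of_eq_of_le (congrArg _ ?_) h4.le
      simp
    have h6 : IsArg (τ n m) 1 := by
      have h7 : (n : ℂ) ≠ m := by exact_mod_cast hmn.symm
      have := hτ.isArg n m h7
      rwa [h_int, h_int, div_self (sub_ne_zero.2 h7.symm)] at this
    obtain ⟨j, hj⟩ := IsArg.exists_int one_ne_zero IsArg.one h6
    rw [zero_add] at hj
    refine eq_of_abs_two_pi_lt (j - k) ?_ (lt_of_le_of_lt hle ?_)
    · rw [hj]; push_cast; ring
    · linarith [Real.pi_pos]
  have e0 := key 0 (Or.inl rfl) 1 (h.cusp 1 hs) (wcoef_one _)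
  have e1 := key 1 (Or.inr rfl) c⁻¹ hp (by rw [wcoef_inv, hc, sub_add_cancel, hm, neg_zero])
  rw [Int.cast_zero] at e0
  rw [Int.cast_one] at e1
  rw [e0, e1]

theorem IsShiftHomotopy.turn_eq {Ψ : ℂ ≃ₜ ℂ} {K : ℝ × ℂ → ℂ} {τ : ℂ → ℂ → ℝ}
    (hK : IsShiftHomotopy Ψ K) (hτ : IsTurn Ψ τ) {m : ℤ} (h0 : m ≠ 0) (h1 : m ≠ 1) :
    τ 0 m = τ 1 m := by
  have hs : (1 : ℝ) = 1 ∨ (1 : ℝ) = -1 := Or.inl rfl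
  have hs' : (-1 : ℝ) = 1 ∨ (-1 : ℝ) = -1 := Or.inr rfl
  have hΨ0 : Ψ 0 = 0 := by simpa using hK.apply_int 0
  obtain ⟨v, hv⟩ := exists_liftPair Ψ.continuous hΨ0 hK.apply_ne
  have hy : ∀ n : ℤ, ∃ g, ∀ z ∈ gap n, v (-1) z = v 1 z * g := fun n =>
    ((hv.lift 1 hs).comp continuousOn_id (gap_subset n 1)).exists_mul_right
      ((hv.lift (-1) hs').comp continuousOn_id (gap_subset n (-1))) (isPreconnected_gap n)
  choose y hy using hy
  obtain ⟨V, c, hV⟩ := hv.exists_isShiftLift hK hs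
  obtain ⟨W, d, hW⟩ := hv.exists_isShiftLift hK hs'
  have hrec : ∀ n, y (n + 1) = c * y n * d⁻¹ := fun n => hV.gap_add_one hW (hy n) (hy (n + 1))
  have hy0 : y 0 = 1 := by
    obtain ⟨z, hz⟩ := gap_nonempty 0
    have := hy 0 z hz
    rw [hv.eq z hz] at this
    exact left_eq_mul.1 this
  have hy1 : y (-1) = xgen⁻¹ := hv.eq_gap_neg_one hτ hΨ0 (hy (-1))
  have hd : d = c * xgen⁻¹ := by
    have := hrec (-1)
    rw [neg_add_cancel, hy0, hy1] at this
    exact (eq_mul_inv_iff_mul_eq.1 this).symm ▸ (one_mul d).symm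
  let θ : FG →* FG := flift c xgen
  have hθs : θ sgen = c := flift_sgen _ _
  have hθx : θ xgen = xgen := flift_xgen _ _
  have hθm : θ sm = d := by rw [sm, map_mul, map_inv, hθs, hθx, hd]
  have hyy : ∀ n, y n = θ (yy n) := by
    intro n
    induction n using Int.induction_on with
    | zero => simp [hy0, yy]
    | succ i ih => rw [hrec, ih, yy_add_one, map_mul, map_mul, map_inv, hθs, hθm]
    | pred i ih =>
      have h2 := hrec (-i - 1)
      have h3 := congrArg θ (yy_add_one (-i - 1))
      rw [map_mul, map_mul, map_inv, hθs, hθm, sub_add_cancel, ← ih] at h3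
      rw [sub_add_cancel, h3] at h2
      exact (mul_left_cancel (mul_right_cancel h2)).symm
  have hcp := hv.hasCusp_one hK hs hV
  have hcm := hv.hasCusp_one hK hs' hW
  have hdeg := hv.sdeg_shift hs hV
  rw [← hθs] at hcp hdeg
  rw [← hθm] at hcm
  have hex := hv.exists_apply_eq_sgen hK.apply_int hθx
    (fun n z hz => by rw [hy n z hz, hyy]) hcp hcm
  exact hv.turn_eq hτ hK.apply_int hcp hdeg (wcoef_eq_zero θ hθx hex hdeg h0 h1) h0 h1

/-- Continuous self-maps of the plane preserving the integers and their complement. -/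
structure IsIntMap (f : ℂ → ℂ) : Prop where
  cont : Continuous f
  int : ∀ n : ℤ, ∃ m : ℤ, f n = m
  ne : ∀ z : ℂ, (∀ n : ℤ, z ≠ n) → ∀ n : ℤ, f z ≠ n

/-- Homotopy relative to the integers, in the complement of the integers. -/
def IntHomotopic (f g : ℂ → ℂ) : Prop :=
  ∃ F : ℝ × ℂ → ℂ, Continuous F ∧ (∀ z, F (0, z) = f z) ∧ (∀ z, F (1, z) = g z) ∧
    (∀ u, ∀ n : ℤ, F (u, n) = f n) ∧ ∀ u, ∀ z : ℂ, (∀ n : ℤ, z ≠ n) → ∀ n : ℤ, F (u, z) ≠ n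

namespace IntHomotopic

variable {f g k p : ℂ → ℂ}

lemma symm (h : IntHomotopic f g) : IntHomotopic g f := by
  obtain ⟨F, hF, h0, h1, hn, hne⟩ := h
  refine ⟨fun q => F (1 - q.1, q.2), by fun_prop, fun z => by simp [h1], fun z => by simp [h0],
    fun u n => ?_, fun u z hz => hne _ z hz⟩
  simp only [hn, ← h1]

lemma trans (h : IntHomotopic f g) (h' : IntHomotopic g k) : IntHomotopic f k := by
  obtain ⟨F, hF, h0, h1, hn, hne⟩ := h
  obtain ⟨G, hG, h0', h1', hn', hne'⟩ := h'
  have hgf : ∀ n : ℤ, g n = f n := fun n => by rw [← h1, hn]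
  refine ⟨fun q => if q.1 ≤ 1 / 2 then F (2 * q.1, q.2) else G (2 * q.1 - 1, q.2), ?_, fun z => ?_,
    fun z => ?_, fun u n => ?_, fun u z hz => ?_⟩
  · refine Continuous.if_le (by fun_prop) (by fun_prop) continuous_fst continuous_const
      fun q hq => ?_
    rw [hq, mul_one_div_cancel two_ne_zero, sub_self, h1, h0']
  · simp [h0]
  · norm_num [h1']
  · dsimp only
    split_ifs
    · exact hn _ n
    · rw [hn', hgf]
  · dsimp only
    split_ifs
    · exact hne _ z hz
    · exact hne' _ z hz

lemma comp_left (hk : IsIntMap k) (h : IntHomotopic f g) :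
    IntHomotopic (fun z => k (f z)) (fun z => k (g z)) := by
  obtain ⟨F, hF, h0, h1, hn, hne⟩ := h
  have := hk.cont
  exact ⟨fun q => k (F q), by fun_prop, fun z => congrArg k (h0 z), fun z => congrArg k (h1 z),
    fun u n => congrArg k (hn u n), fun u z hz => hk.ne _ (hne u z hz)⟩

lemma comp_right (h : IntHomotopic f g) (hk : IsIntMap k) :
    IntHomotopic (fun z => f (k z)) (fun z => g (k z)) := by
  obtain ⟨F, hF, h0, h1, hn, hne⟩ := h
  have := hk.cont
  refine ⟨fun q => F (q.1, k q.2), by fun_prop, fun z => h0 _, fun z => h1 _,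
    fun u n => ?_, fun u z hz => hne u _ (hk.ne z hz)⟩
  obtain ⟨m, hm⟩ := hk.int n
  simp only [hm, hn]

end IntHomotopic

lemma isIntMap_add (e : ℤ) : IsIntMap fun z => z + e where
  cont := by fun_prop
  int n := ⟨n + e, by push_cast; rfl⟩
  ne z hz n hn := hz (n - e) (by push_cast; rw [← hn]; ring)

lemma IsIntMap.of_injective {f : ℂ → ℂ} (hf : Continuous f) (hi : Function.Injective f) {s c : ℤ}
    (hs : s = 1 ∨ s = -1) (h : ∀ n : ℤ, f n = (s * n + c : ℤ)) : IsIntMap f where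
  cont := hf
  int n := ⟨_, h n⟩
  ne z hz n hn := hz (s * (n - c)) (hi (by
    rw [hn, h]
    congr 1
    rcases hs with rfl | rfl <;> ring))

section

variable {G : ℂ ≃ₜ ℂ} {a : ℝ}

lemma im_ne_zero_of_line (hG : ∀ x : ℝ, G x = (x + a : ℝ)) {z : ℂ} (hz : z.im ≠ 0) :
    (G z).im ≠ 0 := by
  intro h
  have h1 : G z = G (((G z).re - a : ℝ) : ℂ) := by
    rw [hG, sub_add_cancel]
    exact Complex.ext (by simp) (by simpa using h)
  have h2 := G.injective h1
  rw [h2] at hz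
  simp at hz

lemma im_pos_of_line (hG : ∀ x : ℝ, G x = (x + a : ℝ)) {s : ℝ} {z₀ : ℂ}
    (h0 : 0 < s * z₀.im) (h0' : 0 < s * (G z₀).im) {z : ℂ} (hz : 0 < s * z.im) :
    0 < s * (G z).im := by
  have hconv : Convex ℝ {z : ℂ | 0 < s * z.im} := by
    intro x hx y hy b c hb hc hbc
    simp only [mem_ofPred_eq, Complex.add_im, Complex.smul_im, smul_eq_mul] at hx hy ⊢
    rcases hb.eq_or_lt with rfl | hb
    · obtain rfl : c = 1 := by linarith
      simpa using hy
    · have h1 := mul_pos hb hx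
      have h2 := mul_nonneg hc hy.le
      linarith
  have hcont : ContinuousOn (fun z => s * (G z).im) {z : ℂ | 0 < s * z.im} := by
    have := G.continuous
    fun_prop
  by_contra hlt
  obtain ⟨w, hw, hw0⟩ := hconv.isPreconnected.intermediate_value hz h0 hcont
    ⟨not_lt.1 hlt, h0'.le⟩
  have hw' : 0 < s * w.im := hw
  have hs : s ≠ 0 := by rintro rfl; simp at hw'
  exact im_ne_zero_of_line hG (right_ne_zero_of_mul hw'.ne')
    ((mul_eq_zero.1 hw0).resolve_left hs)

lemma im_mul_im_pos_of_line (hG : ∀ x : ℝ, G x = (x + a : ℝ)) {s : ℝ} {z₀ : ℂ}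
    (h0 : 0 < s * z₀.im) (h0' : 0 < s * (G z₀).im) {z : ℂ} (hz : z.im ≠ 0) :
    0 < z.im * (G z).im := by
  have hs : s ≠ 0 := by rintro rfl; simp at h0
  have h1 : ∀ {z : ℂ}, 0 < s * z.im → 0 < s * (G z).im := fun h => im_pos_of_line hG h0 h0' h
  have h2 : ∀ {z : ℂ}, 0 < -s * z.im → 0 < -s * (G z).im := by
    have h3 : 0 < -s * (G (G.symm (-s * Complex.I))).im := by
      have := mul_self_pos.2 hs
      simpa using this
    have h4 : (G.symm (-s * Complex.I)).im ≠ 0 := by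
      intro h4
      have h5 : G.symm (-s * Complex.I) = ((G.symm (-s * Complex.I)).re : ℂ) :=
        Complex.ext (by simp) (by simpa using h4)
      rw [h5, hG] at h3
      simp at h3
    have h5 : 0 < -s * (G.symm (-s * Complex.I)).im := by
      rcases lt_or_gt_of_ne (mul_ne_zero hs h4) with h | h
      · linarith
      · have := h1 h
        linarith
    intro z h
    exact im_pos_of_line hG (s := -s) (by simpa using h5) (by simpa using h3) h
  have h3 : 0 < (s * z.im) * (s * (G z).im) := by
    rcases lt_or_gt_of_ne (mul_ne_zero hs hz) with h | h
    · have h4 : 0 < -s * z.im := by linarith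
      have := mul_pos h4 (h2 h4)
      linarith
    · exact mul_pos h (h1 h)
  have h4 : (s * z.im) * (s * (G z).im) = (s * s) * (z.im * (G z).im) := by ring
  rw [h4] at h3
  exact pos_of_mul_pos_right h3 (mul_self_nonneg s)

lemma intHomotopic_add_of_line {e : ℤ} (hG : ∀ x : ℝ, G x = (x + e : ℝ)) {s : ℝ} {z₀ : ℂ}
    (h0 : 0 < s * z₀.im) (h0' : 0 < s * (G z₀).im) : IntHomotopic G (fun z => z + e) := by
  have hc := G.continuous
  refine ⟨fun q => (1 - max 0 (min 1 q.1) : ℝ) * G q.2 + (max 0 (min 1 q.1) : ℝ) * (q.2 + e),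
    by fun_prop, fun z => by simp, fun z => by simp, fun u n => ?_, fun u z hz n hn => ?_⟩
  · dsimp only
    rw [int_cast_eq n, hG]
    push_cast
    ring
  · dsimp only at hn
    have ht0 : 0 ≤ max 0 (min 1 u) := le_max_left _ _
    have ht1 : max 0 (min 1 u) ≤ 1 := max_le zero_le_one (min_le_left _ _)
    generalize max 0 (min 1 u) = t at hn ht0 ht1
    by_cases him : z.im = 0
    · obtain ⟨x, rfl⟩ : ∃ x : ℝ, z = x := ⟨z.re, Complex.ext (by simp) (by simpa using him)⟩
      rw [hG] at hn
      refine hz (n - e) ?_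
      push_cast at hn ⊢
      rw [← hn]
      ring
    · have h1 := im_mul_im_pos_of_line hG h0 h0' him
      have h2 := mul_self_pos.2 him
      have h3 : (1 - t) * (G z).im + t * z.im = 0 := by simpa using congrArg Complex.im hn
      have h4 : (1 - t) * (z.im * (G z).im) + t * (z.im * z.im) = 0 := by
        linear_combination z.im * h3
      have h5 := mul_nonneg (sub_nonneg.2 ht1) h1.le
      have h6 := mul_nonneg ht0 h2.le
      rcases ht0.eq_or_lt with rfl | ht
      · linarith
      · have := mul_pos ht h2
        linarith

end

lemma pt_eq_add (l : Fin 2) (x : ℝ) : pt l x = x + pt l 0 := by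
  have := pt_sub l x 0
  rw [sub_zero] at this
  rw [← this, sub_add_cancel]

lemma pt_sub_pt_im_ne_zero (l : Fin 2) : (pt (1 - l) 0 - pt l 0).im ≠ 0 := by
  fin_cases l <;> norm_num [pt]

lemma IsStraight.intHomotopic {h : ℂ ≃ₜ ℂ} {ε : Fin 2 → ℤ} (hs : IsStraight h ε) (l : Fin 2) :
    IntHomotopic (fun z => z + ε l) (fun z => h (z + pt l 0) - pt l 0) := by
  obtain ⟨g, F, hg, hF, hinj, h0, h1, hn⟩ := hs.isotopy
  let G : ℂ ≃ₜ ℂ := (Homeomorph.addRight (pt l 0)).trans (g.trans (Homeomorph.addRight (-pt l 0)))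
  have hGa : ∀ z, G z = g (z + pt l 0) - pt l 0 := fun z => (sub_eq_add_neg _ _).symm
  have hG : ∀ x : ℝ, G x = (x + ε l : ℝ) := by
    intro x
    rw [hGa, ← pt_eq_add, hg, pt_eq_add, add_sub_cancel_right]
  have hz := mul_self_pos.2 (pt_sub_pt_im_ne_zero l)
  have hz' : (G (pt (1 - l) 0 - pt l 0)).im = (pt (1 - l) 0 - pt l 0).im := by
    rw [hGa, sub_add_cancel, hg]
    rfl
  refine (intHomotopic_add_of_line hG hz (by rwa [hz'])).symm.trans (IntHomotopic.symm ?_)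
  have hh : ∀ t ∈ Icc (0:ℝ) 1, ∀ n : ℤ, F (t, n + pt l 0) - pt l 0 = h (n + pt l 0) - pt l 0 := by
    intro t ht n
    rw [int_cast_eq, ← pt_eq_add, hn t ht]
  have hc : ∀ u, max 0 (min 1 u) ∈ Icc (0:ℝ) 1 := fun u =>
    ⟨le_max_left _ _, max_le zero_le_one (min_le_left _ _)⟩
  refine ⟨fun q => F (max 0 (min 1 q.1), q.2 + pt l 0) - pt l 0, by fun_prop, fun z => by simp [h0],
    fun z => by simp [h1, hGa], fun u n => hh _ (hc u) n, fun u z hz n hzn => hz (n - ε l) ?_⟩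
  have h2 := hh _ (hc u) (n - ε l)
  have h3 : h ((n - ε l : ℤ) + pt l 0) - pt l 0 = n := by
    rw [← hh 1 (by simp), h1, ← hGa, int_cast_eq, hG]
    push_cast
    ring
  have h4 := hinj _ (hc u) (sub_left_injective (h2.trans (h3.trans hzn.symm)))
  have h5 := add_right_cancel h4
  exact h5.symm

lemma IntHomotopic.exists_shiftHomotopy {p : ℂ → ℂ} (hp : ∀ n : ℤ, p n = n)
    (h : IntHomotopic p (fun z => p (z + 1) - 1)) : ∃ K, IsShiftHomotopy p K := by
  obtain ⟨K, hK, h0, h1, hn, hne⟩ := h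
  exact ⟨K, hK, h0, fun z => by rw [h1, sub_add_cancel], fun u n => by rw [hn, hp], hne⟩

/-- If a homeomorphism commutes up to homotopy with a unit translation, then it commutes with the
positive one. -/
lemma IntHomotopic.shift {p : ℂ → ℂ} {e : ℤ} (he : e = 1 ∨ e = -1)
    (h : IntHomotopic (fun z => p (z + e)) (fun z => p z + e)) :
    IntHomotopic p (fun z => p (z + 1) - 1) := by
  rcases he with rfl | rfl
  · have := (h.comp_left (isIntMap_add (-1))).symm
    simpa [← sub_eq_add_neg] using this
  · have := h.comp_right (isIntMap_add 1)
    simpa [← sub_eq_add_neg] using this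

lemma turn_eq_of_conj {h k Ψ : ℂ ≃ₜ ℂ} {ε δ : Fin 2 → ℤ} {τ : ℂ → ℂ → ℝ} (hτ : IsTurn Ψ τ)
    (hs : IsStraight h ε) (hs' : IsStraight k δ) (hcomm : ∀ x, Ψ (h x) = k (Ψ x))
    (hΨ : ∀ l, ∀ n : ℤ, ∃ m : ℤ, Ψ (pt l n) = pt l m) (l : Fin 2) {m : ℤ} (h0 : m ≠ 0)
    (h1 : m ≠ 1) : τ (pt l (0 : ℤ)) (pt l m) = τ (pt l (1 : ℤ)) (pt l m) := by
  obtain ⟨σ, c, hσe, hσ, hx⟩ := conj_apply_pt hs hs' hcomm hΨ l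
  have hσσ : (σ : ℂ) * σ = 1 := by rcases hσ with rfl | rfl <;> norm_num
  have hσ0 : (σ : ℂ) ≠ 0 := left_ne_zero_of_mul_eq_one hσσ
  have hσδ : (σ : ℂ) * δ l = ε l := by
    rw [hσe]
    rcases hs'.eps l with h | h <;> simp [h]
  let P : ℂ ≃ₜ ℂ :=
    (Homeomorph.addRight (pt l 0)).trans (Ψ.trans (Homeomorph.addRight (-pt l 0)))
  let E : ℂ ≃ₜ ℂ := (Homeomorph.addRight (-c : ℂ)).trans (Homeomorph.mulLeft₀ (σ : ℂ) hσ0)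
  let p : ℂ ≃ₜ ℂ := P.trans E
  have hP : ∀ z, P z = Ψ (z + pt l 0) - pt l 0 := fun z => (sub_eq_add_neg _ _).symm
  have hE : ∀ z, E z = σ * (z - c) := fun z => congrArg ((σ : ℂ) * ·) (sub_eq_add_neg _ _).symm
  have hpE : ∀ z, p z = E (P z) := fun z => rfl
  have hPn : ∀ n : ℤ, P n = (σ * n + c : ℤ) := by
    intro n
    rw [hP, int_cast_eq n, ← pt_eq_add, hx, pt_eq_add, add_sub_cancel_right, ← int_cast_eq]
  have hpn : ∀ n : ℤ, p n = n := by
    intro n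
    rw [hpE, hPn, hE]
    push_cast
    linear_combination (n : ℂ) * hσσ
  have hEi : IsIntMap E := .of_injective E.continuous E.injective (c := -(σ * c)) hσ fun n => by
    rw [hE]
    push_cast
    ring
  have hPi : IsIntMap P := .of_injective P.continuous P.injective hσ hPn
  have hpi : IsIntMap p := .of_injective p.continuous p.injective (s := 1) (c := 0) (.inl rfl)
    fun n => by simpa using hpn n
  have H1 := (hs.intHomotopic l).comp_left hpi
  have H2 := ((hs'.intHomotopic l).comp_left hEi).comp_right hPi
  have e1 : (fun z => p (h (z + pt l 0) - pt l 0)) =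
      fun z => E (k (P z + pt l 0) - pt l 0) := by
    funext z
    rw [hpE, hP, hP, sub_add_cancel, sub_add_cancel, hcomm]
  have e2 : (fun z => E (P z + δ l)) = fun z => p z + ε l := by
    funext z
    rw [hpE, hE, hE, ← hσδ]
    ring
  rw [e1] at H1
  rw [e2] at H2
  obtain ⟨K, hK⟩ := ((H1.trans H2.symm).shift (hs.eps l)).exists_shiftHomotopy hpn
  have hpτ : IsTurn p fun x y => τ (x + pt l 0) (y + pt l 0) + Complex.arg σ := by
    refine ⟨?_, fun x y hxy => ?_⟩
    · refine ContinuousOn.add ?_ continuousOn_const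
      exact hτ.cont.comp (f := fun q : ℂ × ℂ => (q.1 + pt l 0, q.2 + pt l 0)) (by fun_prop)
        fun q hq => fun h => hq (add_right_cancel h)
    · have := (hτ.isArg (x + pt l 0) (y + pt l 0) fun h => hxy (add_right_cancel h)).mul
        (IsArg.arg (σ : ℂ))
      convert this using 1
      rw [hpE, hpE, hE, hE, hP, hP]
      ring
  have := hK.turn_eq hpτ h0 h1
  simp only [add_left_inj] at this
  rw [pt_eq_add l (0 : ℤ), pt_eq_add l (1 : ℤ), pt_eq_add l m, ← int_cast_eq]
  simpa using this

/-- The identification of the plane with `ℂ`. -/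
noncomputable def toC : Plane ≃ₜ ℂ := Complex.equivRealProdCLM.symm.toHomeomorph

lemma toC_re (p : Plane) : (toC p).re = p.1 := rfl

lemma toC_im (p : Plane) : (toC p).im = p.2 := rfl

/-- A plane homeomorphism, viewed on `ℂ`. -/
noncomputable def toCHomeo (f : Plane ≃ₜ Plane) : ℂ ≃ₜ ℂ := toC.symm.trans (f.trans toC)

lemma toCHomeo_apply (f : Plane ≃ₜ Plane) (z : ℂ) : toCHomeo f z = toC (f (toC.symm z)) := rfl

lemma toCHomeo_toC (f : Plane ≃ₜ Plane) (p : Plane) : toCHomeo f (toC p) = toC (f p) := by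
  rw [toCHomeo_apply, toC.symm_apply_apply]

lemma IsHomeoFun.injective {f : Plane → Plane} (h : IsHomeoFun f) : Function.Injective f := by
  obtain ⟨e, he⟩ := h
  rw [← funext he]
  exact e.injective

lemma isOP_toCHomeo {f : Plane ≃ₜ Plane} (h : OrientationPreserving f) : IsOP (toCHomeo f) := by
  obtain ⟨F, hF, hinj, h0, h1, -⟩ := h
  have c1 := toC.continuous
  have c2 := toC.symm.continuous
  obtain ⟨σ, hσ, -⟩ := IsTurn.id.transport (g := toCHomeo f)
    (fun q => toC (F (q.1, toC.symm q.2))) (by fun_prop)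
    (fun t ht => toC.injective.comp ((IsHomeoFun.injective (hinj t ht)).comp toC.symm.injective))
    (fun x => by rw [h0, id, toC.apply_symm_apply]) (fun x => by rw [h1, toCHomeo_apply])
  exact ⟨σ, hσ⟩

lemma toC_symm_pt_zero (x : ℝ) : toC.symm (pt 0 x) = (x, 1) := by
  rw [toC.symm_apply_eq]
  apply Complex.ext <;> simp [pt, toC_re, toC_im]

lemma toC_symm_pt_one (x : ℝ) : toC.symm (pt 1 x) = (x, 2) := by
  rw [toC.symm_apply_eq]
  apply Complex.ext <;> norm_num [pt, toC_re, toC_im]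

/-- The integer points of the two lines. -/
def intLine : Fin 2 → Set Plane := ![Z1, Z2]

lemma mem_intLine {l : Fin 2} {p : Plane} : p ∈ intLine l ↔ ∃ n : ℤ, toC p = pt l n := by
  fin_cases l
  · simp only [← toC.eq_symm_apply]
    simp [intLine, Z1, toC_symm_pt_zero]
  · simp only [← toC.eq_symm_apply]
    simp [intLine, Z2, toC_symm_pt_one]

lemma exists_int_unit {e : ℝ} (h : e = 1 ∨ e = -1) : ∃ n : ℤ, (n = 1 ∨ n = -1) ∧ (n : ℝ) = e := by
  rcases h with rfl | rfl
  · exact ⟨1, by simp⟩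
  · exact ⟨-1, by simp⟩

lemma isBrouwerC_conjH {h Φ : Plane ≃ₜ Plane} (hB : IsBrouwer h) (hΦ : OrientationPreserving Φ) :
    IsBrouwerC (toCHomeo (conjH Φ h)) := by
  refine ⟨?_, fun x hx => ?_⟩
  · have : toCHomeo (conjH Φ h) = toCHomeo Φ * toCHomeo h * (toCHomeo Φ)⁻¹ := by
      ext1 z
      simp only [Homeomorph.mul_apply]
      change _ = toCHomeo Φ (toCHomeo h ((toCHomeo Φ).symm z))
      simp [toCHomeo, conjH]
    rw [this]
    exact ((isOP_toCHomeo hΦ).mul (isOP_toCHomeo hB.1)).mul (isOP_toCHomeo hΦ).inv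
  · rw [toCHomeo_apply, ← toC.eq_symm_apply] at hx
    exact hB.2 _ ((Φ.eq_symm_apply).2 hx)

lemma exists_isStraight {h Φ : Plane ≃ₜ Plane} {O₁ O₂ : Set Plane} (hB : IsBrouwer h)
    (hΦ : AdmissibleStraightening h O₁ O₂ Φ) : ∃ ε, IsStraight (toCHomeo (conjH Φ h)) ε := by
  obtain ⟨hop, -, -, ε₁, ε₂, hε₁, hε₂, g, hg₁, hg₂, F, hF, hinj, h0, h1, hn⟩ := hΦ
  obtain ⟨n₁, hn₁, rfl⟩ := exists_int_unit hε₁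
  obtain ⟨n₂, hn₂, rfl⟩ := exists_int_unit hε₂
  have c1 := toC.continuous
  have c2 := toC.symm.continuous
  refine ⟨![n₁, n₂], isBrouwerC_conjH hB hop, fun l => by fin_cases l <;> assumption, toCHomeo g,
    fun q => toC (F (q.1, toC.symm q.2)), fun l x => ?_, by fun_prop,
    fun t ht => toC.injective.comp ((IsHomeoFun.injective (hinj t ht)).comp toC.symm.injective),
    fun x => congrArg toC (h0 _), fun x => congrArg toC (h1 _),
    fun t ht l n => ?_⟩
  · rw [toCHomeo_apply, ← toC.eq_symm_apply]
    fin_cases l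
    · simp [toC_symm_pt_zero, hg₁]
    · simp [toC_symm_pt_one, hg₂]
  · dsimp only
    rw [toCHomeo_apply, hn t ht]
    have : toC.symm (pt l n) ∈ intLine l := mem_intLine.2 ⟨n, toC.apply_symm_apply _⟩
    fin_cases l
    · exact Or.inl this
    · exact Or.inr this

lemma isArg_of_eq_smul {p : Plane} {θ : ℝ}
    (h : p = planeNorm p • (Real.cos θ, Real.sin θ)) : IsArg θ (toC p) := by
  have h1 : ‖toC p‖ = planeNorm p := by
    rw [Complex.norm_eq_sqrt_sq_add_sq, toC_re, toC_im, planeNorm]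
  have h2 := congrArg Prod.fst h
  have h3 := congrArg Prod.snd h
  rw [IsArg, h1]
  apply Complex.ext
  · simpa [toC_re, Complex.exp_re] using h2
  · simpa [toC_im, Complex.exp_im] using h3

lemma IsAngleFunction.sub_eq {k : Plane ≃ₜ Plane} {γ : ℝ → Plane} {θ : ℝ → ℝ}
    (hγ : ContinuousOn γ (Icc 0 1)) (hθ : IsAngleFunction k γ θ) {A : ℂ → ℝ}
    (hA : Continuous A) (hAa : ∀ x, IsArg (A x) (toCHomeo k x - x))
    (hk : ∀ x, toCHomeo k x ≠ x) : θ 1 - θ 0 = A (toC (γ 1)) - A (toC (γ 0)) := by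
  obtain ⟨c, hc⟩ := IsArg.exists_int_of_preconnected (isPreconnected_Icc (a := (0:ℝ)) (b := 1))
    (a := θ) (b := fun t => A (toC (γ t))) (v := fun t => toCHomeo k (toC (γ t)) - toC (γ t))
    hθ.1 (hA.comp_continuousOn (toC.continuous.comp_continuousOn hγ))
    (fun t ht => by
      rw [toCHomeo_toC]
      exact isArg_of_eq_smul (hθ.2 t ht))
    (fun t _ => hAa _) (fun t _ => sub_ne_zero.2 (hk _))
  have h0 := hc 0 (by simp)
  have h1 := hc 1 (by simp)
  linarith

lemma exists_pt_of_image {Φ Φ' : Plane ≃ₜ Plane} {O : Set Plane} {l : Fin 2}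
    (h : Φ '' O = intLine l) (h' : Φ' '' O = intLine l) (n : ℤ) :
    ∃ m : ℤ, toCHomeo (Φ.symm.trans Φ') (pt l n) = pt l m := by
  have h1 : toC.symm (pt l n) ∈ Φ '' O := h ▸ mem_intLine.2 ⟨n, toC.apply_symm_apply _⟩
  obtain ⟨x, hx, hxn⟩ := h1
  have h2 : Φ' x ∈ intLine l := h' ▸ mem_image_of_mem _ hx
  obtain ⟨m, hm⟩ := mem_intLine.1 h2
  refine ⟨m, ?_⟩
  rw [toCHomeo_apply, ← hxn, ← hm]
  simp

end BrouwerIndex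

/-- The Poincaré index of a Brouwer homeomorphism between two
orbits is independent of the choice of curve and of admissible straightening. -/
theorem index_well_defined
    (h : Plane ≃ₜ Plane) (hB : IsBrouwer h)
    (x₁ x₂ : Plane) (O₁ O₂ : Set Plane)
    (hO₁ : O₁ = horbit h x₁) (hO₂ : O₂ = horbit h x₂) (hne : O₁ ≠ O₂)
    (Φ Φ' : Plane ≃ₜ Plane)
    (hΦ : AdmissibleStraightening h O₁ O₂ Φ)
    (hΦ' : AdmissibleStraightening h O₁ O₂ Φ')
    (γ γ' : ℝ → Plane)
    (hγ : ContinuousOn γ (Icc 0 1)) (hγ' : ContinuousOn γ' (Icc 0 1))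
    (hγ0 : γ 0 ∈ Z1) (hγ1 : γ 1 ∈ Z2) (hγ'0 : γ' 0 ∈ Z1) (hγ'1 : γ' 1 ∈ Z2)
    (θ θ' : ℝ → ℝ)
    (hθ : IsAngleFunction (⇑(conjH Φ h)) γ θ)
    (hθ' : IsAngleFunction (⇑(conjH Φ' h)) γ' θ') :
    θ 1 - θ 0 = θ' 1 - θ' 0 := by
  obtain ⟨ε, hs⟩ := BrouwerIndex.exists_isStraight hB hΦ
  obtain ⟨δ, hs'⟩ := BrouwerIndex.exists_isStraight hB hΦ'
  obtain ⟨A, hA, hAa⟩ := BrouwerIndex.exists_displacement_arg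
    (BrouwerIndex.toCHomeo (conjH Φ h)).continuous hs.brouwer.fpf
  obtain ⟨B, hB', hBa⟩ := BrouwerIndex.exists_displacement_arg
    (BrouwerIndex.toCHomeo (conjH Φ' h)).continuous hs'.brouwer.fpf
  rw [BrouwerIndex.IsAngleFunction.sub_eq hγ hθ hA hAa hs.brouwer.fpf,
    BrouwerIndex.IsAngleFunction.sub_eq hγ' hθ' hB' hBa hs'.brouwer.fpf]
  obtain ⟨n₀, hn₀⟩ := (BrouwerIndex.mem_intLine (l := 0)).1 hγ0
  obtain ⟨n₁, hn₁⟩ := (BrouwerIndex.mem_intLine (l := 1)).1 hγ1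
  obtain ⟨m₀, hm₀⟩ := (BrouwerIndex.mem_intLine (l := 0)).1 hγ'0
  obtain ⟨m₁, hm₁⟩ := (BrouwerIndex.mem_intLine (l := 1)).1 hγ'1
  rw [hn₀, hn₁, hm₀, hm₁]
  obtain ⟨τ, hτ⟩ : BrouwerIndex.IsOP (BrouwerIndex.toCHomeo (Φ.symm.trans Φ')) := by
    have := (BrouwerIndex.isOP_toCHomeo hΦ'.1).mul (BrouwerIndex.isOP_toCHomeo hΦ.1).inv
    convert this using 1
    ext1 z
    rw [Homeomorph.mul_apply]
    change _ = BrouwerIndex.toCHomeo Φ' ((BrouwerIndex.toCHomeo Φ).symm z)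
    simp [BrouwerIndex.toCHomeo]
  have hcomm : ∀ x, BrouwerIndex.toCHomeo (Φ.symm.trans Φ')
      (BrouwerIndex.toCHomeo (conjH Φ h) x) = BrouwerIndex.toCHomeo (conjH Φ' h)
        (BrouwerIndex.toCHomeo (Φ.symm.trans Φ') x) := fun x => by
    simp [BrouwerIndex.toCHomeo, conjH]
  have hΨ : ∀ l, ∀ n : ℤ, ∃ m : ℤ, BrouwerIndex.toCHomeo (Φ.symm.trans Φ')
      (BrouwerIndex.pt l n) = BrouwerIndex.pt l m := by
    intro l
    fin_cases l
    · exact BrouwerIndex.exists_pt_of_image hΦ.2.1 hΦ'.2.1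
    · exact BrouwerIndex.exists_pt_of_image hΦ.2.2.1 hΦ'.2.2.1
  exact BrouwerIndex.displacement_sub_eq hτ hs hs' hcomm hΨ
    (fun l m h0 h1 => BrouwerIndex.turn_eq_of_conj hτ hs hs' hcomm hΨ l h0 h1)
    hA hAa hB' hBa n₀ n₁ m₀ m₁
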